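/- There exist θ ∈ (0,1) and a positive integer X₀ such that P(x) ≤ x^θ for every integer x ≥ X₀ that is not a prime-power. -/

import Mathlib

open scoped Classical

/-- The largest element of ℙ*₁ = ℙ* ∪ {1} (prime-powers together with 1) not exceeding `x`. -/
noncomputable def q (x : ℕ) : ℕ :=
  sSup {m : ℕ | (IsPrimePow m ∨ m = 1) ∧ m ≤ x}

/-- The prime-power map. -/
noncomputable def P (x : ℕ) : ℕ :=
  if x = 1 then 1
  else if IsPrimePow x then x / x.minFac
  else x - q x

/-- The orbit of `x` under `P`: `orbit x 1 = x` and `orbit x (n+1) = P (orbit x n)`. -/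
noncomputable def orbit (x n : ℕ) : ℕ := P^[n - 1] x

/-- The transient length `T x = min {n ≥ 1 : x_n = 1}`. -/
noncomputable def T (x : ℕ) : ℕ := sInf {n : ℕ | 1 ≤ n ∧ orbit x n = 1}

/-- The settling time `S x = min {n ≥ 1 : x_n ∈ ℙ*₁}`. -/
noncomputable def S (x : ℕ) : ℕ :=
  sInf {n : ℕ | 1 ≤ n ∧ (IsPrimePow (orbit x n) ∨ orbit x n = 1)}

namespace Hoheisel

open Finset Real MeasureTheory
open scoped ContDiff

/-- The set of `n ∈ (a, b]` divisible by no element of `A`. -/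
noncomputable def sifted (A : Finset ℕ) (a b : ℝ) : Finset ℕ :=
  {n ∈ Ioc ⌊a⌋₊ ⌊b⌋₊ | ∀ p ∈ A, ¬ p ∣ n}

lemma mem_sifted {A : Finset ℕ} {a b : ℝ} (ha : 0 ≤ a) (hb : 0 ≤ b) {n : ℕ} :
    n ∈ sifted A a b ↔ (a < n ∧ n ≤ b) ∧ ∀ p ∈ A, ¬ p ∣ n := by
  simp [sifted, Nat.floor_lt ha, Nat.le_floor_iff hb]

/-- Truncated inclusion-exclusion at a single integer with `k` prime factors. -/
lemma abs_indicator_sub_alternating_sum_le (k m : ℕ) (hm : 1 ≤ m) :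
    |(if k = 0 then (1 : ℝ) else 0) - ∑ i ∈ range m, (-1) ^ i * (k.choose i : ℝ)|
      ≤ k.choose m := by
  obtain ⟨m, rfl⟩ := Nat.exists_eq_add_of_le' hm
  rcases k with _ | k
  · simp [Finset.sum_range_succ']
  · have h := @Int.alternating_sum_range_choose_eq_choose k m
    have h' : (∑ i ∈ range (m + 1), (-1) ^ i * ((k + 1).choose i : ℝ)) = (-1) ^ m * k.choose m := by
      exact_mod_cast congrArg (Int.cast : ℤ → ℝ) h
    rw [h']
    simp only [Nat.add_eq_zero_iff, one_ne_zero, and_false, if_false, zero_sub, abs_neg, abs_mul,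
      abs_pow, abs_one, one_pow, one_mul, Nat.abs_cast]
    rw [Nat.choose_succ_succ]
    push_cast
    linarith [(Nat.cast_nonneg (k.choose m) : (0 : ℝ) ≤ _),
      (Nat.cast_nonneg (k.choose (m + 1)) : (0 : ℝ) ≤ _)]

lemma prod_dvd_iff {D : Finset ℕ} (hD : ∀ p ∈ D, p.Prime) (n : ℕ) :
    ∏ p ∈ D, p ∣ n ↔ ∀ p ∈ D, p ∣ n :=
  ⟨fun h _ hp => (Finset.dvd_prod_of_mem _ hp).trans h,
    fun h => Finset.prod_primes_dvd _ (fun _ hp => (hD _ hp).prime) h⟩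

lemma card_sifted_div {A D : Finset ℕ} (hA : ∀ p ∈ A, p.Prime) (hD : ∀ p ∈ D, p.Prime)
    (hdisj : Disjoint A D) (a b : ℝ) :
    #(sifted A (a / ∏ p ∈ D, (p : ℝ)) (b / ∏ p ∈ D, (p : ℝ))) =
      #{n ∈ sifted A a b | ∀ p ∈ D, p ∣ n} := by
  set d := ∏ p ∈ D, p with hd
  have hd0 : 0 < d := Finset.prod_pos fun p hp => (hD p hp).pos
  have hcast : ∏ p ∈ D, (p : ℝ) = (d : ℝ) := by simp [hd]
  rw [hcast]
  symm
  refine Finset.card_bij' (fun n _ => n / d) (fun n _ => d * n) ?_ ?_ ?_ ?_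
  · intro n hn
    simp only [sifted, mem_filter, mem_Ioc, Nat.floor_div_natCast] at hn ⊢
    obtain ⟨m, rfl⟩ := (prod_dvd_iff hD n).2 hn.2
    rw [← hd, Nat.mul_div_cancel_left _ hd0]
    rw [← hd] at hn
    refine ⟨⟨?_, ?_⟩, fun p hp h => hn.1.2 p hp (h.mul_left _)⟩
    · exact Nat.div_lt_of_lt_mul hn.1.1.1
    · rw [Nat.le_div_iff_mul_le hd0, mul_comm]; exact hn.1.1.2
  · intro n hn
    simp only [sifted, mem_filter, mem_Ioc, Nat.floor_div_natCast] at hn ⊢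
    refine ⟨⟨⟨?_, ?_⟩, fun p hp h => ?_⟩, (prod_dvd_iff hD _).1 (Dvd.intro _ rfl)⟩
    · have := (Nat.div_lt_iff_lt_mul hd0).1 hn.1.1
      rwa [mul_comm]
    · have := (Nat.le_div_iff_mul_le hd0).1 hn.1.2
      rwa [mul_comm]
    · rcases (hA p hp).dvd_mul.1 h with h | h
      · obtain ⟨r, hr, hpr⟩ := ((hA p hp).prime.dvd_finsetProd_iff _).1 h
        have := (Nat.prime_dvd_prime_iff_eq (hA p hp) (hD r hr)).1 hpr
        exact Finset.disjoint_left.1 hdisj hp (this ▸ hr)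
      · exact hn.2 p hp h
  · intro n hn
    exact Nat.mul_div_cancel' ((prod_dvd_iff hD n).2 (mem_filter.1 hn).2)
  · intro n _
    exact Nat.mul_div_cancel_left _ hd0

lemma sum_powersetCard_card_sifted {A B : Finset ℕ} (hA : ∀ p ∈ A, p.Prime)
    (hB : ∀ p ∈ B, p.Prime) (hdisj : Disjoint A B) (a b : ℝ) (i : ℕ) :
    ∑ D ∈ B.powersetCard i, (#(sifted A (a / ∏ p ∈ D, (p : ℝ)) (b / ∏ p ∈ D, (p : ℝ))) : ℝ) =
      ∑ n ∈ sifted A a b, ((#{p ∈ B | p ∣ n}).choose i : ℝ) := by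
  have h1 : ∀ D ∈ B.powersetCard i,
      (#(sifted A (a / ∏ p ∈ D, (p : ℝ)) (b / ∏ p ∈ D, (p : ℝ))) : ℝ) =
        ∑ n ∈ sifted A a b, if ∀ p ∈ D, p ∣ n then (1 : ℝ) else 0 := by
    intro D hD
    have hDQ := (mem_powersetCard.1 hD).1
    rw [card_sifted_div hA (fun p hp => hB p (hDQ hp)) (hdisj.mono_right hDQ)]
    simp [Finset.sum_boole]
  rw [Finset.sum_congr rfl h1, Finset.sum_comm]
  refine Finset.sum_congr rfl fun n _ => ?_
  rw [Finset.sum_boole, ← Finset.card_powersetCard]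
  congr 2
  ext D
  simp only [mem_filter, mem_powersetCard, subset_iff]
  grind

lemma card_sifted_union (A B : Finset ℕ) (a b : ℝ) :
    (#(sifted (A ∪ B) a b) : ℝ) =
      ∑ n ∈ sifted A a b, if #{p ∈ B | p ∣ n} = 0 then (1 : ℝ) else 0 := by
  rw [Finset.sum_boole]
  congr 2
  ext n
  simp only [sifted, mem_filter, mem_union, card_eq_zero, filter_eq_empty_iff]
  grind

/-- Truncated inclusion-exclusion (Brun). -/
lemma abs_card_sifted_union_sub_le {A B : Finset ℕ} (hA : ∀ p ∈ A, p.Prime)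
    (hB : ∀ p ∈ B, p.Prime) (hdisj : Disjoint A B) (a b : ℝ) {m : ℕ} (hm : 1 ≤ m) :
    |(#(sifted (A ∪ B) a b) : ℝ) - ∑ i ∈ range m, (-1) ^ i * ∑ D ∈ B.powersetCard i,
        (#(sifted A (a / ∏ p ∈ D, (p : ℝ)) (b / ∏ p ∈ D, (p : ℝ))) : ℝ)|
      ≤ ∑ D ∈ B.powersetCard m,
        (#(sifted A (a / ∏ p ∈ D, (p : ℝ)) (b / ∏ p ∈ D, (p : ℝ))) : ℝ) := by
  simp only [sum_powersetCard_card_sifted hA hB hdisj, card_sifted_union, Finset.mul_sum]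
  rw [Finset.sum_comm, ← Finset.sum_sub_distrib]
  exact (Finset.abs_sum_le_sum_abs _ _).trans
    (Finset.sum_le_sum fun n _ => abs_indicator_sub_alternating_sum_le _ m hm)

/-- The reciprocal elementary symmetric function `∑_{D ⊆ B, #D = i} 1 / ∏ D`. -/
noncomputable def recipEsymm (B : Finset ℕ) (i : ℕ) : ℝ :=
  ∑ D ∈ B.powersetCard i, ∏ p ∈ D, (1 / (p : ℝ))

lemma recipEsymm_nonneg (B : Finset ℕ) (i : ℕ) : 0 ≤ recipEsymm B i :=
  Finset.sum_nonneg fun _ _ => Finset.prod_nonneg fun _ _ => by positivity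

lemma sum_pow_mul_recipEsymm (B : Finset ℕ) (c : ℝ) {M : ℕ} (hM : #B + 1 ≤ M) :
    ∑ i ∈ range M, c ^ i * recipEsymm B i = ∏ p ∈ B, (1 + c * (1 / (p : ℝ))) := by
  rw [Finset.prod_one_add, Finset.sum_powerset]
  have hsub : ∑ i ∈ range M, c ^ i * recipEsymm B i =
      ∑ i ∈ range (#B + 1), c ^ i * recipEsymm B i := by
    symm
    refine Finset.sum_subset (Finset.range_subset_range.2 hM) fun i _ hi => ?_
    have : #B < i := by rw [Finset.mem_range] at hi; omega
    simp [recipEsymm, Finset.powersetCard_eq_empty.2 this]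
  rw [hsub]
  refine Finset.sum_congr rfl fun i _ => ?_
  rw [recipEsymm, Finset.mul_sum]
  refine Finset.sum_congr rfl fun D hD => ?_
  rw [Finset.prod_mul_distrib, Finset.prod_const, (mem_powersetCard.1 hD).2]

/-- The density `∏_{p ∈ A} (1 - 1/p)` of the integers divisible by no `p ∈ A`. -/
noncomputable def density (A : Finset ℕ) : ℝ := ∏ p ∈ A, (1 - 1 / (p : ℝ))

lemma density_pos {A : Finset ℕ} (hA : ∀ p ∈ A, p.Prime) : 0 < density A := by
  refine Finset.prod_pos fun p hp => ?_
  have : (1 : ℝ) < p := by exact_mod_cast (hA p hp).one_lt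
  rw [sub_pos, div_lt_one] <;> linarith

lemma density_union {A B : Finset ℕ} (hdisj : Disjoint A B) :
    density (A ∪ B) = density A * density B :=
  Finset.prod_union hdisj

lemma exp_neg_le_density {B : Finset ℕ} (hB : ∀ p ∈ B, p.Prime) {L : ℝ}
    (hL : ∑ p ∈ B, 1 / (p : ℝ) ≤ L) : exp (-(2 * L)) ≤ density B := by
  calc exp (-(2 * L)) ≤ exp (∑ p ∈ B, -(2 * (1 / (p : ℝ)))) := by
        rw [exp_le_exp, Finset.sum_neg_distrib, ← Finset.mul_sum]; linarith
    _ = ∏ p ∈ B, exp (-(2 * (1 / (p : ℝ)))) := exp_sum _ _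
    _ ≤ density B := by
        refine Finset.prod_le_prod (fun _ _ => (exp_pos _).le) fun p hp => ?_
        have hp2 : (2 : ℝ) ≤ p := by exact_mod_cast (hB p hp).two_le
        have hx : 1 / (p : ℝ) ≤ 1 / 2 := one_div_le_one_div_of_le two_pos hp2
        have hx0 : 0 < 1 / (p : ℝ) := by positivity
        generalize 1 / (p : ℝ) = t at *
        rw [exp_neg, inv_le_comm₀ (exp_pos _) (by linarith)]
        have h1 := add_one_le_exp (2 * t)
        refine le_trans ?_ h1
        rw [inv_le_iff_one_le_mul₀ (by linarith)]
        nlinarith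

/-- Passing from sifting by `A` to sifting by `A ∪ B`, given an asymptotic for `A`. -/
lemma abs_card_sifted_union_sub_density_le {A B : Finset ℕ} (hA : ∀ p ∈ A, p.Prime)
    (hB : ∀ p ∈ B, p.Prime) (hdisj : Disjoint A B) {a H L δ : ℝ} (hH : 0 ≤ H)
    {m : ℕ} (hm : 1 ≤ m) (hL : ∑ p ∈ B, 1 / (p : ℝ) ≤ L)
    (hasymp : ∀ D ⊆ B, #D ≤ m →
      |(#(sifted A (a / ∏ p ∈ D, (p : ℝ)) ((a + H) / ∏ p ∈ D, (p : ℝ))) : ℝ) -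
        H / (∏ p ∈ D, (p : ℝ)) * density A| ≤ δ * (H / (∏ p ∈ D, (p : ℝ)) * density A)) :
    |(#(sifted (A ∪ B) a (a + H)) : ℝ) - H * density (A ∪ B)| ≤
      H * density A * (δ * exp L + 2 * exp (-(2 * m)) * exp (exp 2 * L)) := by
  set e := recipEsymm B with he
  set c : ℕ → ℝ := fun i => ∑ D ∈ B.powersetCard i,
        (#(sifted A (a / ∏ p ∈ D, (p : ℝ)) ((a + H) / ∏ p ∈ D, (p : ℝ))) : ℝ) with hc
  set G := H * density A with hG
  have hG0 : 0 ≤ G := mul_nonneg hH (density_pos hA).le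
  have hδ : 0 ≤ δ * G := by
    have := (abs_nonneg _).trans (hasymp ∅ (empty_subset _) (by simp))
    simpa using this
  have hce : ∀ i ≤ m, |c i - G * e i| ≤ δ * G * e i := by
    intro i hi
    rw [hc, he, recipEsymm, Finset.mul_sum, Finset.mul_sum, ← Finset.sum_sub_distrib]
    refine (Finset.abs_sum_le_sum_abs _ _).trans (Finset.sum_le_sum fun D hD => ?_)
    obtain ⟨h1, h2⟩ := mem_powersetCard.1 hD
    have h3 := hasymp D h1 (h2.trans_le hi)
    have h4 : H / (∏ p ∈ D, (p : ℝ)) * density A = G * ∏ p ∈ D, (1 / (p : ℝ)) := by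
      rw [Finset.prod_div_distrib, Finset.prod_const_one, hG]; ring
    rw [h4, ← mul_assoc] at h3
    exact h3
  set M := max (m + 1) (#B + 1) with hMdef
  have hmM : m + 1 ≤ M := le_max_left _ _
  have hM : #B + 1 ≤ M := le_max_right _ _
  have hexp : ∀ c : ℝ, 0 ≤ c → ∑ i ∈ range M, c ^ i * e i ≤ exp (c * L) := by
    intro c hc
    rw [sum_pow_mul_recipEsymm B c hM]
    refine (prod_one_add_le_exp_sum B fun p => by positivity).trans ?_
    rw [exp_le_exp, ← Finset.mul_sum]
    exact mul_le_mul_of_nonneg_left hL hc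
  have he0 : ∀ i, 0 ≤ e i := recipEsymm_nonneg B
  have hdens : density B = ∑ i ∈ range M, (-1) ^ i * e i := by
    rw [sum_pow_mul_recipEsymm B (-1) hM]
    exact Finset.prod_congr rfl fun p _ => by ring
  have htail : ∑ i ∈ Ico m M, e i ≤ exp (-(2 * m)) * exp (exp 2 * L) := by
    have h1 : ∑ i ∈ Ico m M, e i ≤ exp (-(2 * m)) * ∑ i ∈ Ico m M, (exp 2) ^ i * e i := by
      rw [Finset.mul_sum]
      refine Finset.sum_le_sum fun i hi => ?_
      rw [← mul_assoc, ← exp_nat_mul, ← exp_add]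
      refine le_mul_of_one_le_left (he0 i) (one_le_exp ?_)
      have : (m : ℝ) ≤ i := by exact_mod_cast (mem_Ico.1 hi).1
      linarith
    refine h1.trans (mul_le_mul_of_nonneg_left ?_ (exp_pos _).le)
    refine le_trans ?_ (hexp _ (exp_pos _).le)
    exact Finset.sum_le_sum_of_subset_of_nonneg
      (fun i hi => mem_range.2 (mem_Ico.1 hi).2)
      fun i _ _ => mul_nonneg (by positivity) (he0 i)
  have hem : e m ≤ ∑ i ∈ Ico m M, e i :=
    Finset.single_le_sum (f := e) (fun i _ => he0 i) (mem_Ico.2 ⟨le_rfl, hmM⟩)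
  have hall : ∑ i ∈ range (m + 1), e i ≤ exp L := by
    have := hexp 1 zero_le_one
    simp only [one_pow, one_mul] at this
    exact (Finset.sum_le_sum_of_subset_of_nonneg (range_mono hmM) fun i _ _ => he0 i).trans this
  have hbrun := abs_card_sifted_union_sub_le hA hB hdisj a (a + H) hm
  rw [density_union hdisj, ← mul_assoc, ← hG]
  have h1 : |∑ i ∈ range m, (-1) ^ i * c i - G * ∑ i ∈ range m, (-1) ^ i * e i| ≤
      δ * G * ∑ i ∈ range m, e i := by
    rw [Finset.mul_sum, Finset.mul_sum, ← Finset.sum_sub_distrib]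
    refine (Finset.abs_sum_le_sum_abs _ _).trans (Finset.sum_le_sum fun i hi => ?_)
    have : (-1) ^ i * c i - G * ((-1) ^ i * e i) = (-1) ^ i * (c i - G * e i) := by ring
    rw [this, abs_mul, abs_pow, abs_neg, abs_one, one_pow, one_mul]
    exact hce i (mem_range.1 hi).le
  have h2 : |density B - ∑ i ∈ range m, (-1) ^ i * e i| ≤ ∑ i ∈ Ico m M, e i := by
    rw [hdens, ← Finset.sum_Ico_eq_sub _ (by omega)]
    refine (Finset.abs_sum_le_sum_abs _ _).trans (Finset.sum_le_sum fun i _ => ?_)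
    rw [abs_mul, abs_pow, abs_neg, abs_one, one_pow, one_mul, abs_of_nonneg (he0 i)]
  have h3 : |G * density B - G * ∑ i ∈ range m, (-1) ^ i * e i| ≤ G * ∑ i ∈ Ico m M, e i := by
    rw [← mul_sub, abs_mul, abs_of_nonneg hG0]
    exact mul_le_mul_of_nonneg_left h2 hG0
  have h4 := hce m le_rfl
  have h5 : δ * G * ∑ i ∈ range (m + 1), e i ≤ δ * G * exp L := mul_le_mul_of_nonneg_left hall hδ
  rw [Finset.sum_range_succ] at h5
  have h6 := mul_le_mul_of_nonneg_left htail hG0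
  have h7 := mul_le_mul_of_nonneg_left hem hG0
  change |_ - ∑ i ∈ range m, (-1) ^ i * c i| ≤ c m at hbrun
  rw [abs_le] at *
  constructor <;> linarith

lemma pow_div_dvd_factorial {p : ℕ} (hp : p.Prime) (n : ℕ) : p ^ (n / p) ∣ n.factorial := by
  have hb : Nat.log p n < Nat.log p n + 2 := by omega
  rw [hp.pow_dvd_factorial_iff hb]
  have := Finset.single_le_sum (f := fun i => n / p ^ i) (fun i _ => Nat.zero_le _)
    (mem_Ico.2 ⟨le_rfl, by omega⟩ : 1 ∈ Ico 1 (Nat.log p n + 2))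
  simpa using this

/-- The upper bound in the first theorem of Mertens. -/
lemma sum_log_div_le {n : ℕ} (hn : 1 ≤ n) :
    ∑ p ∈ n.primesLE, log p / p ≤ log n + log 4 := by
  have hn0 : (0 : ℝ) < n := by exact_mod_cast hn
  have h1 : ∏ p ∈ n.primesLE, p ^ (n / p) ∣ n.factorial := by
    refine Finset.prod_dvd_of_isRelPrime (fun p hp r hr hpr => ?_) fun p hp =>
      pow_div_dvd_factorial (Nat.prime_of_mem_primesLE hp) n
    exact Nat.coprime_iff_isRelPrime.1 (Nat.coprime_pow_primes _ _ (Nat.prime_of_mem_primesLE hp)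
      (Nat.prime_of_mem_primesLE hr) hpr)
  have h2 : ∑ p ∈ n.primesLE, ((n / p : ℕ) : ℝ) * log p ≤ n * log n := by
    have h3 : (∏ p ∈ n.primesLE, (p : ℝ) ^ (n / p)) ≤ (n : ℝ) ^ n := by
      exact_mod_cast (Nat.le_of_dvd n.factorial_pos h1).trans n.factorial_le_pow
    have hpos : ∀ p ∈ n.primesLE, (0 : ℝ) < (p : ℝ) ^ (n / p) := fun p hp =>
      pow_pos (by exact_mod_cast (Nat.prime_of_mem_primesLE hp).pos) _
    have h4 := log_le_log (Finset.prod_pos hpos) h3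
    rw [log_prod fun p hp => (hpos p hp).ne', log_pow] at h4
    simpa only [log_pow] using h4
  have h3 : ∑ p ∈ n.primesLE, log p ≤ log 4 * n := by
    rw [← Chebyshev.theta_eq_sum_primesLE_log]
    exact Chebyshev.theta_le_log4_mul_x hn0.le
  have h4 : n * ∑ p ∈ n.primesLE, log p / p ≤
      ∑ p ∈ n.primesLE, ((n / p : ℕ) : ℝ) * log p + ∑ p ∈ n.primesLE, log p := by
    rw [Finset.mul_sum, ← Finset.sum_add_distrib]
    refine Finset.sum_le_sum fun p hp => ?_
    have h5 : (n : ℝ) / p < (n / p : ℕ) + 1 := by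
      have := Nat.lt_floor_add_one ((n : ℝ) / p)
      rwa [Nat.floor_div_eq_div] at this
    have h6 : 0 ≤ log p := log_natCast_nonneg p
    calc (n : ℝ) * (log p / p) = n / p * log p := by ring
      _ ≤ ((n / p : ℕ) + 1) * log p := mul_le_mul_of_nonneg_right h5.le h6
      _ = _ := by ring
  refine le_of_mul_le_mul_left ?_ hn0
  linarith

/-- The primes up to `z`. -/
noncomputable def primesUpTo (z : ℝ) : Finset ℕ := Nat.primesLE ⌊z⌋₊

lemma mem_primesUpTo {z : ℝ} (hz : 0 ≤ z) {p : ℕ} : p ∈ primesUpTo z ↔ (p : ℝ) ≤ z ∧ p.Prime := by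
  rw [primesUpTo, Nat.mem_primesLE, Nat.le_floor_iff hz]

lemma prime_of_mem_primesUpTo {z : ℝ} : ∀ p ∈ primesUpTo z, p.Prime :=
  fun _ hp => Nat.prime_of_mem_primesLE hp

lemma density_primesUpTo_le {z : ℝ} (hz : 1 < z) : density (primesUpTo z) ≤ 1 / log z := by
  have hlog : 0 < log z := log_pos hz
  set n := ⌊z⌋₊ with hn
  let f : ℕ →* ℝ := ⟨⟨fun k => (k : ℝ)⁻¹, by simp⟩, by intro a b; simp [mul_comm]⟩
  have hf : ∀ {p : ℕ}, p.Prime → ‖f p‖ < 1 := by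
    intro p hp
    have : (1 : ℝ) < p := by exact_mod_cast hp.one_lt
    change ‖(p : ℝ)⁻¹‖ < 1
    rw [norm_inv, RCLike.norm_natCast]
    exact inv_lt_one_of_one_lt₀ this
  obtain ⟨-, hsum⟩ := EulerProduct.summable_and_hasSum_smoothNumbers_prod_primesBelow_geometric hf
    (n + 1)
  have hprod : ∏ p ∈ (n + 1).primesBelow, (1 - f p)⁻¹ = (density (primesUpTo z))⁻¹ := by
    rw [density, ← Finset.prod_inv_distrib]
    refine Finset.prod_congr rfl fun p _ => ?_
    rw [one_div]; rfl
  rw [hprod] at hsum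
  have hle : log z ≤ (density (primesUpTo z))⁻¹ := by
    have h1 : log z ≤ (harmonic n : ℝ) := by
      refine le_trans ?_ (log_add_one_le_harmonic n)
      refine log_le_log (by linarith) ?_
      exact_mod_cast (Nat.lt_floor_add_one z).le
    refine h1.trans ?_
    have hmem : ∀ k ∈ Icc 1 n, k ∈ (n + 1).smoothNumbers := fun k hk =>
      Nat.mem_smoothNumbers_of_lt (by grind) (by grind)
    let g : {k // k ∈ Icc 1 n} → (n + 1).smoothNumbers := fun k => ⟨k.1, hmem k.1 k.2⟩
    have hg : Function.Injective g := fun a b hab =>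
      Subtype.ext (congrArg (Subtype.val : (n + 1).smoothNumbers → ℕ) hab)
    have h2 := sum_le_hasSum ((Icc 1 n).attach.image g)
      (fun k _ => (by positivity : 0 ≤ ((k : ℕ) : ℝ)⁻¹)) hsum
    rw [Finset.sum_image fun a _ b _ hab => hg hab] at h2
    rw [harmonic_eq_sum_Icc]
    push_cast
    rw [← Finset.sum_attach]
    exact h2
  have hd := density_pos (A := primesUpTo z) prime_of_mem_primesUpTo
  rw [le_inv_comm₀ hlog hd] at hle
  simpa using hle

/-- Exact inclusion-exclusion with the trivial bound on each remainder. -/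
lemma abs_card_sifted_sub_le_two_pow {A : Finset ℕ} (hA : ∀ p ∈ A, p.Prime) {a H : ℝ}
    (ha : 0 ≤ a) (hH : 0 ≤ H) :
    |(#(sifted A a (a + H)) : ℝ) - H * density A| ≤ 2 ^ #A := by
  have h := abs_card_sifted_union_sub_le (A := ∅) (by simp) hA (disjoint_empty_left _) a (a + H)
    (m := #A + 1) (by omega)
  have hempty : A.powersetCard (#A + 1) = ∅ := Finset.powersetCard_eq_empty.2 (by omega)
  rw [hempty, Finset.sum_empty, abs_nonpos_iff, sub_eq_zero, Finset.empty_union] at h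
  have hdens : H * density A = ∑ i ∈ range (#A + 1), (-1) ^ i * ∑ D ∈ A.powersetCard i,
      H / ∏ p ∈ D, (p : ℝ) := by
    have h1 : density A = ∑ i ∈ range (#A + 1), (-1) ^ i * recipEsymm A i := by
      rw [sum_pow_mul_recipEsymm A (-1) le_rfl]
      exact Finset.prod_congr rfl fun p _ => by ring
    rw [h1, Finset.mul_sum]
    refine Finset.sum_congr rfl fun i _ => ?_
    rw [recipEsymm, mul_left_comm, Finset.mul_sum]
    congr 1
    refine Finset.sum_congr rfl fun D _ => ?_
    rw [Finset.prod_div_distrib, Finset.prod_const_one]; ring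
  rw [h, hdens, ← Finset.sum_sub_distrib]
  have hpow : (2 : ℝ) ^ #A = ∑ i ∈ range (#A + 1), ∑ D ∈ A.powersetCard i, (1 : ℝ) := by
    rw [← Finset.sum_powerset]
    simp
  rw [hpow]
  refine (Finset.abs_sum_le_sum_abs _ _).trans (Finset.sum_le_sum fun i _ => ?_)
  rw [← mul_sub, abs_mul, abs_pow, abs_neg, abs_one, one_pow, one_mul, ← Finset.sum_sub_distrib]
  refine (Finset.abs_sum_le_sum_abs _ _).trans (Finset.sum_le_sum fun D _ => ?_)
  have hd : 0 ≤ ∏ p ∈ D, (p : ℝ) := by positivity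
  have hle : ⌊a / ∏ p ∈ D, (p : ℝ)⌋₊ ≤ ⌊(a + H) / ∏ p ∈ D, (p : ℝ)⌋₊ :=
    Nat.floor_mono (div_le_div_of_nonneg_right (by linarith) hd)
  simp only [sifted, notMem_empty, IsEmpty.forall_iff, implies_true, filter_true, Nat.card_Ioc]
  rw [Nat.cast_sub hle]
  rw [add_div] at *
  have ha' : 0 ≤ a / ∏ p ∈ D, (p : ℝ) := div_nonneg ha hd
  have hH' : 0 ≤ H / ∏ p ∈ D, (p : ℝ) := div_nonneg hH hd
  generalize a / ∏ p ∈ D, (p : ℝ) = s at *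
  generalize H / ∏ p ∈ D, (p : ℝ) = t at *
  have h1 := Nat.floor_le ha'
  have h2 := Nat.lt_floor_add_one s
  have h3 := Nat.floor_le (add_nonneg ha' hH')
  have h4 := Nat.lt_floor_add_one (s + t)
  rw [abs_le]
  constructor <;> linarith

lemma primesUpTo_sq {w : ℝ} (hw : 3 ≤ w) :
    ∃ B : Finset ℕ, (∀ p ∈ B, p.Prime) ∧ (∀ p ∈ B, (p : ℝ) ≤ w ^ 2) ∧
      Disjoint (primesUpTo w) B ∧ primesUpTo (w ^ 2) = primesUpTo w ∪ B ∧
      ∑ p ∈ B, 1 / (p : ℝ) ≤ 4 := by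
  have hw0 : 0 ≤ w := by linarith
  have hsub : primesUpTo w ⊆ primesUpTo (w ^ 2) :=
    Nat.primesLE_mono (Nat.floor_mono (by nlinarith))
  refine ⟨primesUpTo (w ^ 2) \ primesUpTo w, fun p hp =>
    prime_of_mem_primesUpTo p (mem_sdiff.1 hp).1,
    fun p hp => ((mem_primesUpTo (by positivity)).1 (mem_sdiff.1 hp).1).1,
    disjoint_sdiff, (union_sdiff_of_subset hsub).symm, ?_⟩
  have hlogw : log 2 ≤ log w := log_le_log two_pos (by linarith)
  have hlog2 : 0 < log 2 := log_pos one_lt_two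
  have hlogw0 : 0 < log w := hlog2.trans_le hlogw
  have h1 : log w * ∑ p ∈ primesUpTo (w ^ 2) \ primesUpTo w, 1 / (p : ℝ) ≤
      ∑ p ∈ primesUpTo (w ^ 2), log p / p := by
    rw [Finset.mul_sum]
    refine le_trans (Finset.sum_le_sum fun p hp => ?_)
      (Finset.sum_le_sum_of_subset_of_nonneg sdiff_subset fun p _ _ =>
        div_nonneg (log_natCast_nonneg p) (Nat.cast_nonneg p))
    obtain ⟨hp1, hp2⟩ := mem_sdiff.1 hp
    rw [mem_primesUpTo hw0, not_and'] at hp2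
    have hp3 := not_le.1 (hp2 (prime_of_mem_primesUpTo p hp1))
    rw [mul_one_div]
    exact div_le_div_of_nonneg_right (log_le_log (by linarith) hp3.le) (Nat.cast_nonneg p)
  have hfl : 1 ≤ ⌊w ^ 2⌋₊ := Nat.le_floor (by push_cast; nlinarith)
  have h2 := h1.trans (sum_log_div_le hfl)
  have h3 : log (⌊w ^ 2⌋₊ : ℝ) ≤ 2 * log w := by
    have := log_le_log (by exact_mod_cast hfl) (Nat.floor_le (by positivity : 0 ≤ w ^ 2))
    simpa using this
  have h4 : log 4 = 2 * log 2 := by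
    rw [show (4 : ℝ) = 2 ^ 2 by norm_num, log_pow]; norm_num
  refine le_of_mul_le_mul_left ?_ hlogw0
  linarith

/-- The fundamental lemma of the sieve. -/
theorem fundamental_lemma : ∃ K : ℝ, 1 ≤ K ∧ ∀ z : ℝ, 3 ≤ z → ∀ a H : ℝ, 0 ≤ a → 0 < H →
    15 * log z ≤ log H →
    |(#(sifted (primesUpTo z) a (a + H)) : ℝ) - H * density (primesUpTo z)| ≤
      K * exp (-(log H / log z)) * (H * density (primesUpTo z)) := by
  set K : ℝ := 4 * exp (23 + exp 2 * 4) with hK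
  have hKbig : (2 : ℝ) ^ 20 ≤ K := by
    have h1 : exp 23 ≤ exp (23 + exp 2 * 4) := exp_le_exp.2 (by linarith [exp_pos 2])
    have h2 : (2 : ℝ) ^ 23 ≤ exp 23 := by
      have h3 : (2 : ℝ) ≤ exp 1 := by linarith [add_one_le_exp (1 : ℝ)]
      have := pow_le_pow_left₀ two_pos.le h3 23
      rwa [← exp_nat_mul, mul_one, Nat.cast_ofNat] at this
    rw [hK]; linarith
  refine ⟨K, by linarith, ?_⟩
  suffices h : ∀ n : ℕ, ∀ z : ℝ, 3 ≤ z → z < 9 ^ 2 ^ n → ∀ a H : ℝ, 0 ≤ a → 0 < H →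
      15 * log z ≤ log H →
      |(#(sifted (primesUpTo z) a (a + H)) : ℝ) - H * density (primesUpTo z)| ≤
        K * exp (-(log H / log z)) * (H * density (primesUpTo z)) by
    intro z hz
    obtain ⟨n, hn⟩ := pow_unbounded_of_one_lt z (by norm_num : (1 : ℝ) < 9)
    exact h n z hz (hn.trans_le (pow_le_pow_right₀ (by norm_num) Nat.lt_two_pow_self.le))
  intro n
  induction n with
  | zero =>
    intro z hz hz9 a H ha hH hHz
    simp only [pow_zero, pow_one] at hz9
    have hcard : #(primesUpTo z) ≤ 9 := by
      have h1 : primesUpTo z ⊆ Icc 1 9 := by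
        intro p hp
        have h2 := (mem_primesUpTo (by linarith)).1 hp
        refine mem_Icc.2 ⟨h2.2.one_le, ?_⟩
        exact_mod_cast (h2.1.trans hz9.le)
      simpa using card_le_card h1
    refine (abs_card_sifted_sub_le_two_pow prime_of_mem_primesUpTo ha hH.le).trans ?_
    have h2 : (2 : ℝ) ^ #(primesUpTo z) ≤ 2 ^ 9 := pow_le_pow_right₀ one_le_two hcard
    have hdens : (1 / 2 : ℝ) ^ 9 ≤ density (primesUpTo z) := by
      calc (1 / 2 : ℝ) ^ 9 ≤ (1 / 2) ^ #(primesUpTo z) :=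
            pow_le_pow_of_le_one (by norm_num) (by norm_num) hcard
        _ = ∏ p ∈ primesUpTo z, (1 / 2 : ℝ) := by simp
        _ ≤ _ := by
          refine Finset.prod_le_prod (fun _ _ => by norm_num) fun p hp => ?_
          have hp2 : (2 : ℝ) ≤ p := by exact_mod_cast (prime_of_mem_primesUpTo p hp).two_le
          have := one_div_le_one_div_of_le two_pos hp2
          linarith
    have hlogz : 1 ≤ log z := by
      rw [le_log_iff_exp_le (by linarith)]
      linarith [exp_one_lt_d9]
    have hone : 1 ≤ exp (-(log H / log z)) * H := by
      nth_rewrite 2 [← exp_log hH]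
      rw [← exp_add]
      refine one_le_exp ?_
      have : log H / log z ≤ log H := div_le_self (by linarith) hlogz
      linarith
    calc (2 : ℝ) ^ #(primesUpTo z) ≤ 2 ^ 20 * 1 * (1 / 2) ^ 9 := h2.trans (by norm_num)
      _ ≤ K * (exp (-(log H / log z)) * H) * density (primesUpTo z) := by gcongr
      _ = _ := by ring
  | succ n ih =>
    intro z hz hzn a H ha hH hHz
    rcases lt_or_ge z 9 with hz9 | hz9
    · refine ih z hz (hz9.trans_le ?_) a H ha hH hHz
      exact le_self_pow₀ (by norm_num) (by positivity)
    set w := √z with hw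
    have hw2 : w ^ 2 = z := sq_sqrt (by linarith)
    have hw3 : 3 ≤ w := le_sqrt_of_sq_le (by linarith)
    have hw0 : 0 < w := by linarith
    have hwn : w < 9 ^ 2 ^ n := by
      refine lt_of_pow_lt_pow_left₀ 2 (by positivity) ?_
      rw [hw2, ← pow_mul, ← pow_succ]; exact hzn
    obtain ⟨B, hBp, hBle, hdisj, hunion, hL⟩ := primesUpTo_sq hw3
    rw [hw2] at hunion hBle
    have hlogw : 0 < log w := log_pos (by linarith)
    have hlogz : log z = 2 * log w := by rw [← hw2, log_pow]; norm_num
    set v := log H / log z with hv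
    have hv15 : 15 ≤ v := by rw [hv, le_div_iff₀ (by linarith)]; exact hHz
    have hlogH : log H = v * (2 * log w) := by rw [hv, ← hlogz, div_mul_cancel₀ _ (by linarith)]
    set m := ⌊(v - 13) / 2⌋₊ with hm
    have hm1 : 1 ≤ m := Nat.le_floor (by push_cast; linarith)
    have hm2 : (m : ℝ) ≤ (v - 13) / 2 := Nat.floor_le (by linarith)
    have hm3 : (v - 13) / 2 < m + 1 := Nat.lt_floor_add_one _
    have key := abs_card_sifted_union_sub_density_le (A := primesUpTo w) (B := B) (a := a)
      (δ := K * exp (-(2 * v - 2 * m))) prime_of_mem_primesUpTo hBp hdisj hH.le hm1 hL (by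
        intro D hD hDm
        have hpos : ∀ p ∈ D, (0 : ℝ) < p := fun p hp => by exact_mod_cast (hBp p (hD hp)).pos
        set d := ∏ p ∈ D, (p : ℝ) with hd
        have hd0 : 0 < d := Finset.prod_pos hpos
        have hlogd : log d ≤ m * (2 * log w) := by
          rw [hd, log_prod fun p hp => (hpos p hp).ne', ← hlogz]
          refine (Finset.sum_le_card_nsmul D _ (log z) fun p hp =>
            log_le_log (hpos p hp) (hBle p (hD hp))).trans ?_
          rw [nsmul_eq_mul]
          exact mul_le_mul_of_nonneg_right (by exact_mod_cast hDm) (by linarith)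
        have hlogHd : (2 * v - 2 * m) * log w ≤ log (H / d) := by
          rw [log_div hH.ne' hd0.ne', hlogH]; nlinarith
        have h1 := ih w hw3 hwn (a / d) (H / d) (by positivity) (by positivity)
          (le_trans (mul_le_mul_of_nonneg_right (by linarith) hlogw.le) hlogHd)
        rw [← add_div] at h1
        refine h1.trans (mul_le_mul_of_nonneg_right ?_
          (mul_nonneg (by positivity) (density_pos prime_of_mem_primesUpTo).le))
        refine mul_le_mul_of_nonneg_left ?_ (by linarith)
        rw [exp_le_exp, neg_le_neg_iff, le_div_iff₀ hlogw]
        exact hlogHd)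
    rw [← hunion] at key
    refine key.trans ?_
    have hdz : density (primesUpTo w) * exp (-(2 * 4)) ≤ density (primesUpTo z) := by
      rw [hunion, density_union hdisj]
      exact mul_le_mul_of_nonneg_left (exp_neg_le_density hBp hL)
        (density_pos prime_of_mem_primesUpTo).le
    have hdw := density_pos (A := primesUpTo w) prime_of_mem_primesUpTo
    have hmain : K * exp (-(2 * v - 2 * m)) * exp 4 + 2 * exp (-(2 * m)) * exp (exp 2 * 4) ≤
        K * exp (-v) * exp (-(2 * 4)) := by
      have h1 : exp (-(2 * v - 2 * m)) * exp 4 ≤ exp (-v) * exp (-(2 * 4)) * exp (-1) := by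
        rw [← exp_add, ← exp_add, ← exp_add, exp_le_exp]; linarith
      have h2 : 2 * exp (-(2 * m)) * exp (exp 2 * 4) ≤ K / 2 * (exp (-v) * exp (-(2 * 4))) := by
        rw [hK, mul_assoc, ← exp_add, ← exp_add, mul_div_right_comm, mul_assoc, ← exp_add]
        norm_num only
        refine mul_le_mul_of_nonneg_left ?_ two_pos.le
        rw [exp_le_exp]; linarith
      have h3 : exp (-1) ≤ 1 / 2 := by
        rw [exp_neg, one_div]
        exact inv_anti₀ two_pos (by linarith [add_one_le_exp (1 : ℝ)])
      have h4 : 0 < exp (-v) * exp (-(2 * 4)) := by positivity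
      have hK0 : 0 < K := by linarith
      have h5 := mul_le_mul_of_nonneg_left h1 hK0.le
      have h6 := mul_le_mul_of_nonneg_left h3 (mul_pos hK0 h4).le
      rw [mul_assoc K, mul_assoc K]
      linear_combination h5 + h2 + h6
    calc H * density (primesUpTo w) * (K * exp (-(2 * v - 2 * m)) * exp 4 +
          2 * exp (-(2 * m)) * exp (exp 2 * 4))
        ≤ H * density (primesUpTo w) * (K * exp (-v) * exp (-(2 * 4))) :=
          mul_le_mul_of_nonneg_left hmain (by positivity)
      _ = K * exp (-v) * (H * (density (primesUpTo w) * exp (-(2 * 4)))) := by ring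
      _ ≤ K * exp (-v) * (H * density (primesUpTo z)) := by
          have hK0 : 0 < K := by linarith
          gcongr

lemma sifted_anti {A B : Finset ℕ} (h : A ⊆ B) (a b : ℝ) : sifted B a b ⊆ sifted A a b := by
  intro n hn
  simp only [sifted, mem_filter] at hn ⊢
  exact ⟨hn.1, fun p hp => hn.2 p (h hp)⟩

/-- The sieve asymptotic with an error term uniform in all intervals of length at least `√y`,
where `y = exp L`. -/
theorem abs_card_sifted_exp_sub_le : ∃ C L₀ : ℝ, 1 ≤ C ∧ 1 ≤ L₀ ∧ ∀ L, L₀ ≤ L → ∀ a H : ℝ,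
    0 ≤ a → 0 < H → L / 2 ≤ log H →
    |(#(sifted (primesUpTo (exp L)) a (a + H)) : ℝ) - H * density (primesUpTo (exp L))| ≤
      C * (H * (1 / L)) * exp (-(log H / L)) := by
  obtain ⟨K, hK1, hK⟩ := fundamental_lemma
  refine ⟨30 * (1 + K) * exp 15, 60, ?_, by norm_num, fun L hL a H ha hH hHL => ?_⟩
  · have : 1 ≤ exp 15 := one_le_exp (by norm_num)
    nlinarith
  have hL0 : 0 < L := by linarith
  have hexp2 : ∀ t : ℝ, 2 ≤ t → 3 ≤ exp t := fun t ht => by linarith [add_one_le_exp t]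
  have hdens : ∀ t : ℝ, 0 < t → density (primesUpTo (exp t)) ≤ 1 / t := fun t ht => by
    simpa using density_primesUpTo_le (one_lt_exp_iff.2 ht)
  have hd0 : ∀ t : ℝ, 0 < density (primesUpTo (exp t)) := fun t =>
    density_pos prime_of_mem_primesUpTo
  rcases le_or_gt (15 * L) (log H) with h15 | h15
  · have h1 := hK (exp L) (hexp2 L (by linarith)) a H ha hH (by simpa using h15)
    rw [log_exp] at h1
    refine h1.trans ?_
    have h2 : K ≤ 30 * (1 + K) * exp 15 := by
      have : 1 ≤ exp 15 := one_le_exp (by norm_num)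
      nlinarith
    calc K * exp (-(log H / L)) * (H * density (primesUpTo (exp L)))
        ≤ (30 * (1 + K) * exp 15) * exp (-(log H / L)) * (H * (1 / L)) := by
          have := hdens L hL0
          have := hd0 L
          gcongr
      _ = _ := by ring
  · have h1 := hK (exp (L / 30)) (hexp2 _ (by linarith)) a H ha hH (by rw [log_exp]; linarith)
    have hsub : primesUpTo (exp (L / 30)) ⊆ primesUpTo (exp L) :=
      Nat.primesLE_mono (Nat.floor_mono (exp_le_exp.2 (by linarith)))
    have hcard : (#(sifted (primesUpTo (exp L)) a (a + H)) : ℝ) ≤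
        #(sifted (primesUpTo (exp (L / 30))) a (a + H)) := by
      exact_mod_cast card_le_card (sifted_anti hsub _ _)
    have hd := hdens (L / 30) (by linarith)
    have hdL := hdens L hL0
    set d := density (primesUpTo (exp (L / 30)))
    have hG : 0 ≤ H * d := mul_nonneg hH.le (hd0 _).le
    have hle1 : K * exp (-(log H / log (exp (L / 30)))) * (H * d) ≤ K * (H * d) := by
      refine mul_le_mul_of_nonneg_right (mul_le_of_le_one_right (by linarith) ?_) hG
      rw [exp_le_one_iff, log_exp, neg_nonpos]
      exact div_nonneg (by linarith) (by linarith)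
    have hM : (1 + K) * (H * d) ≤ 30 * (1 + K) * (H * (1 / L)) := by
      have : H * d ≤ H * (1 / (L / 30)) := mul_le_mul_of_nonneg_left hd hH.le
      calc (1 + K) * (H * d) ≤ (1 + K) * (H * (1 / (L / 30))) :=
            mul_le_mul_of_nonneg_left this (by linarith)
        _ = _ := by field_simp
    have hfin : 30 * (1 + K) * (H * (1 / L)) ≤
        30 * (1 + K) * exp 15 * (H * (1 / L)) * exp (-(log H / L)) := by
      have h2 : 1 ≤ exp 15 * exp (-(log H / L)) := by
        rw [← exp_add]
        refine one_le_exp ?_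
        have : log H / L ≤ 15 := by rw [div_le_iff₀ hL0]; linarith
        linarith
      have h3 : 0 ≤ 30 * (1 + K) * (H * (1 / L)) := by positivity
      nlinarith
    have hW0 := hd0 L
    have hHW : H * density (primesUpTo (exp L)) ≤ H * (1 / L) :=
      mul_le_mul_of_nonneg_left hdL hH.le
    have hHW0 : 0 ≤ H * density (primesUpTo (exp L)) := by positivity
    have h4 : H * (1 / L) ≤ 30 * (1 + K) * (H * (1 / L)) :=
      le_mul_of_one_le_left (by positivity) (by linarith)
    have h5 : (0 : ℝ) ≤ #(sifted (primesUpTo (exp L)) a (a + H)) := Nat.cast_nonneg _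
    rw [abs_le] at *
    constructor <;> linarith

/-- Indicator of the integers `n > 1` free of prime factors up to `exp L`. -/
noncomputable def rough (L : ℝ) (n : ℕ) : ℝ :=
  if 1 < n ∧ ∀ p ∈ primesUpTo (exp L), ¬ p ∣ n then 1 else 0

/-- The density of the integers free of prime factors up to `exp L`. -/
noncomputable def roughDensity (L : ℝ) : ℝ := density (primesUpTo (exp L))

/-- The coefficient of the Dirichlet series `∑ rough(n) (log n)^j n^{-1-κ}`. -/
noncomputable def coeff (L : ℝ) (j : ℕ) (κ : ℝ) (n : ℕ) : ℝ :=
  rough L n * (log n ^ j * exp (-((1 + κ) * log n)))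

/-- The continuous model for `coeff`, up to the density. -/
noncomputable def model (j : ℕ) (κ v : ℝ) : ℝ := if 0 < v then v ^ j * exp (-(κ * v)) else 0

/-- The sum of `coeff` over `exp (u - τ) < n ≤ exp u`. -/
noncomputable def blockSum (L : ℝ) (j : ℕ) (κ τ u : ℝ) : ℝ :=
  ∑' n : ℕ, if log n ≤ u ∧ u < log n + τ then coeff L j κ n else 0

/-- The normalised discrepancy between `coeff` and its model on `exp (u - τ) < n ≤ exp u`. -/
noncomputable def discrepancy (L : ℝ) (j : ℕ) (κ τ u : ℝ) : ℝ :=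
  τ⁻¹ * (blockSum L j κ τ u - roughDensity L * ∫ v in (u - τ)..u, model j κ v)

lemma rough_nonneg (L : ℝ) (n : ℕ) : 0 ≤ rough L n := by
  unfold rough; split_ifs <;> norm_num

lemma rough_le_one (L : ℝ) (n : ℕ) : rough L n ≤ 1 := by
  unfold rough; split_ifs <;> norm_num

lemma roughDensity_pos (L : ℝ) : 0 < roughDensity L := density_pos prime_of_mem_primesUpTo

lemma roughDensity_le {L : ℝ} (hL : 0 < L) : roughDensity L ≤ 1 / L := by
  simpa [roughDensity] using density_primesUpTo_le (one_lt_exp_iff.2 hL)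

lemma rough_eq_zero_of_log_le {L : ℝ} {n : ℕ} (hn : log n ≤ L) : rough L n = 0 := by
  rw [rough, if_neg]
  rintro ⟨h1, h2⟩
  refine h2 n.minFac ?_ n.minFac_dvd
  rw [mem_primesUpTo (exp_pos _).le]
  refine ⟨?_, Nat.minFac_prime h1.ne'⟩
  have hn0 : (0 : ℝ) < n := by exact_mod_cast (by omega : 0 < n)
  rw [log_le_iff_le_exp hn0] at hn
  refine le_trans ?_ hn
  exact_mod_cast Nat.minFac_le (by omega)

lemma coeff_nonneg (L : ℝ) (j : ℕ) (κ : ℝ) (n : ℕ) : 0 ≤ coeff L j κ n :=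
  mul_nonneg (rough_nonneg L n) (mul_nonneg (pow_nonneg (log_natCast_nonneg n) j) (exp_pos _).le)

lemma coeff_eq_zero_of_log_le {L : ℝ} (j : ℕ) (κ : ℝ) {n : ℕ} (hn : log n ≤ L) :
    coeff L j κ n = 0 := by
  rw [coeff, rough_eq_zero_of_log_le hn, zero_mul]

lemma model_nonneg (j : ℕ) (κ v : ℝ) : 0 ≤ model j κ v := by
  unfold model; split_ifs <;> positivity

lemma model_le {j : ℕ} {κ u v : ℝ} (hκ : 0 ≤ κ) (hu : 0 ≤ u) (hv : v ≤ u) :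
    model j κ v ≤ u ^ j := by
  unfold model
  split_ifs with h
  · refine (mul_le_of_le_one_right (by positivity) ?_).trans (pow_le_pow_left₀ h.le hv j)
    exact exp_le_one_iff.2 (by nlinarith [mul_nonneg hκ h.le])
  · positivity

lemma blockSum_eq_zero {L : ℝ} (j : ℕ) (κ τ : ℝ) {u : ℝ} (hu : u ≤ L) :
    blockSum L j κ τ u = 0 := by
  rw [blockSum]
  convert tsum_zero with n
  split_ifs with h
  · exact coeff_eq_zero_of_log_le j κ (h.1.trans hu)
  · rfl

lemma blockSum_eq (L : ℝ) (j : ℕ) (κ : ℝ) {τ u : ℝ} (hu : τ ≤ u) :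
    blockSum L j κ τ u = ∑ n ∈ sifted (primesUpTo (exp L)) (exp (u - τ)) (exp u),
      log n ^ j * exp (-((1 + κ) * log n)) := by
  have hmem : ∀ n : ℕ, n ∈ sifted (primesUpTo (exp L)) (exp (u - τ)) (exp u) ↔
      (0 < n ∧ log n ≤ u ∧ u < log n + τ) ∧ ∀ p ∈ primesUpTo (exp L), ¬ p ∣ n := by
    intro n
    rw [mem_sifted (exp_pos _).le (exp_pos _).le]
    refine and_congr_left fun _ => ?_
    rcases Nat.eq_zero_or_pos n with rfl | hn
    · simp [(exp_pos (u - τ)).le]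
    · have hn0 : (0 : ℝ) < n := by exact_mod_cast hn
      rw [← lt_log_iff_exp_lt hn0, ← log_le_iff_le_exp hn0]
      constructor
      · rintro ⟨h1, h2⟩; exact ⟨hn, h2, by linarith⟩
      · rintro ⟨-, h1, h2⟩; exact ⟨by linarith, h1⟩
  rw [blockSum, tsum_eq_sum (s := sifted (primesUpTo (exp L)) (exp (u - τ)) (exp u))]
  · refine Finset.sum_congr rfl fun n hn => ?_
    obtain ⟨⟨h0, h1, h2⟩, h3⟩ := (hmem n).1 hn
    have hn1 : 1 < n := by
      have : (1 : ℝ) < n := by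
        rw [← log_pos_iff (by positivity)]; linarith
      exact_mod_cast this
    rw [if_pos ⟨h1, h2⟩, coeff, rough, if_pos ⟨hn1, h3⟩, one_mul]
  · intro n hn
    rw [hmem] at hn
    split_ifs with h
    · rw [coeff, rough, if_neg, zero_mul]
      rintro ⟨h1, h2⟩
      exact hn ⟨⟨by omega, h⟩, h2⟩
    · rfl

lemma abs_pow_mul_exp_sub_le {j : ℕ} {σ τ u v : ℝ} (hσ0 : 0 ≤ σ) (hσ : σ ≤ 2) (hτ : τ ≤ 1 / 2)
    (hu : 1 ≤ u) (hv1 : u - τ ≤ v) (hv2 : v ≤ u) :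
    |v ^ j * exp (-(σ * v)) - u ^ j * exp (-(σ * u))| ≤
      (4 + j) * τ * (u ^ j * exp (-(σ * u))) := by
  have hτ0 : 0 ≤ τ := by linarith
  have hv0 : 0 ≤ v := by linarith
  have hupper : v ^ j * exp (-(σ * v)) ≤ (1 + 4 * τ) * (u ^ j * exp (-(σ * u))) := by
    have h1 : exp (-(σ * v)) ≤ (1 + 4 * τ) * exp (-(σ * u)) := by
      have h2 : exp (2 * τ) ≤ 1 + 4 * τ := by
        have h3 := abs_exp_sub_one_sub_id_le (x := 2 * τ) (by rw [abs_le]; constructor <;> linarith)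
        have h4 := (abs_le.1 h3).2
        nlinarith
      refine le_trans ?_ (mul_le_mul_of_nonneg_right h2 (exp_pos _).le)
      rw [← exp_add, exp_le_exp]
      nlinarith
    calc v ^ j * exp (-(σ * v)) ≤ u ^ j * ((1 + 4 * τ) * exp (-(σ * u))) := by gcongr
      _ = _ := by ring
  have hlower : (1 - j * τ) * (u ^ j * exp (-(σ * u))) ≤ v ^ j * exp (-(σ * v)) := by
    have h1 : exp (-(σ * u)) ≤ exp (-(σ * v)) := exp_le_exp.2 (by nlinarith)
    have h2 : (1 - j * τ) * u ^ j ≤ v ^ j := by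
      have h3 := one_add_mul_le_pow (a := -τ) (by linarith) j
      have h4 : (1 + -τ) ^ j * u ^ j ≤ v ^ j := by
        rw [← mul_pow]
        exact pow_le_pow_left₀ (by nlinarith) (by nlinarith) j
      refine le_trans (mul_le_mul_of_nonneg_right ?_ (by positivity)) h4
      linarith
    calc (1 - j * τ) * (u ^ j * exp (-(σ * u))) = (1 - j * τ) * u ^ j * exp (-(σ * u)) := by ring
      _ ≤ v ^ j * exp (-(σ * u)) := mul_le_mul_of_nonneg_right h2 (exp_pos _).le
      _ ≤ _ := mul_le_mul_of_nonneg_left h1 (by positivity)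
  have hF : 0 ≤ u ^ j * exp (-(σ * u)) := by positivity
  have hj : (0 : ℝ) ≤ j := Nat.cast_nonneg j
  have h1 : 0 ≤ j * τ * (u ^ j * exp (-(σ * u))) := by positivity
  have h2 : 0 ≤ 4 * τ * (u ^ j * exp (-(σ * u))) := by positivity
  rw [abs_le]
  constructor <;> linarith

lemma abs_blockSum_sub_le (L : ℝ) (j : ℕ) {κ τ u : ℝ} (hκ0 : 0 ≤ κ) (hκ : κ ≤ 1)
    (hτ : τ ≤ 1 / 2) (hu : 1 ≤ u) :
    |blockSum L j κ τ u - u ^ j * exp (-((1 + κ) * u)) *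
      #(sifted (primesUpTo (exp L)) (exp (u - τ)) (exp u))| ≤
      (4 + j) * τ * (u ^ j * exp (-((1 + κ) * u))) *
        #(sifted (primesUpTo (exp L)) (exp (u - τ)) (exp u)) := by
  rw [blockSum_eq L j κ (by linarith)]
  set s := sifted (primesUpTo (exp L)) (exp (u - τ)) (exp u)
  set F := u ^ j * exp (-((1 + κ) * u)) with hF
  have h1 : F * (#s : ℝ) = ∑ n ∈ s, F := by simp [mul_comm]
  have h2 : (4 + j) * τ * F * (#s : ℝ) = ∑ n ∈ s, (4 + j) * τ * F := by simp [mul_comm]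
  rw [h1, h2, ← Finset.sum_sub_distrib]
  refine (Finset.abs_sum_le_sum_abs _ _).trans (Finset.sum_le_sum fun n hn => ?_)
  obtain ⟨⟨hn1, hn2⟩, -⟩ := (mem_sifted (exp_pos _).le (exp_pos _).le).1 hn
  have hn0 : (0 : ℝ) < n := (exp_pos _).trans hn1
  exact abs_pow_mul_exp_sub_le (by linarith) (by linarith) hτ hu
    ((lt_log_iff_exp_lt hn0).2 hn1).le ((log_le_iff_le_exp hn0).2 hn2)

lemma abs_integral_model_sub_le (j : ℕ) {κ τ u : ℝ} (hκ0 : 0 ≤ κ) (hκ : κ ≤ 1)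
    (hτ0 : 0 ≤ τ) (hτ : τ ≤ 1 / 2) (hu : 1 ≤ u) :
    |(∫ v in (u - τ)..u, model j κ v) - u ^ j * exp (-((1 + κ) * u)) * (exp u - exp (u - τ))| ≤
      (4 + j) * τ * (u ^ j * exp (-((1 + κ) * u))) * (exp u - exp (u - τ)) := by
  set F := u ^ j * exp (-((1 + κ) * u)) with hF
  have h1 : ∫ v in (u - τ)..u, model j κ v =
      ∫ v in (u - τ)..u, (v ^ j * exp (-((1 + κ) * v))) * exp v := by
    refine intervalIntegral.integral_congr fun v hv => ?_
    rw [Set.uIcc_of_le (by linarith)] at hv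
    simp only [model]
    rw [if_pos (by linarith [hv.1]), mul_assoc, ← exp_add]
    congr 2; ring
  have hc1 : Continuous fun v : ℝ => (v ^ j * exp (-((1 + κ) * v))) * exp v := by fun_prop
  have hc2 : ∀ c : ℝ, IntervalIntegrable (fun v : ℝ => c * exp v) MeasureTheory.volume (u - τ) u :=
    fun c => Continuous.intervalIntegrable (by fun_prop) _ _
  rw [h1, ← integral_exp, ← intervalIntegral.integral_const_mul,
    ← intervalIntegral.integral_const_mul, ← intervalIntegral.integral_sub
      (hc1.intervalIntegrable _ _) (hc2 F), ← norm_eq_abs]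
  refine intervalIntegral.norm_integral_le_of_norm_le (by linarith) ?_
    (hc2 _)
  refine MeasureTheory.ae_of_all _ fun v hv => ?_
  rw [← sub_mul, norm_mul, norm_of_nonneg (exp_pos v).le]
  exact mul_le_mul_of_nonneg_right (abs_pow_mul_exp_sub_le (by linarith) (by linarith) hτ
    hu hv.1.le hv.2) (exp_pos v).le

lemma discrepancy_of_nonpos {L : ℝ} (hL : 0 ≤ L) (j : ℕ) (κ : ℝ) {τ u : ℝ} (hτ : 0 ≤ τ)
    (hu : u ≤ 0) : discrepancy L j κ τ u = 0 := by
  rw [discrepancy, blockSum_eq_zero j κ τ (hu.trans hL)]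
  rw [intervalIntegral.integral_congr (g := fun _ => 0)]
  · simp
  · intro v hv
    rw [Set.uIcc_of_le (by linarith)] at hv
    exact if_neg (not_lt.2 (hv.2.trans hu))

set_option maxHeartbeats 400000 in
/-- The pointwise bound for the discrepancy, with `τ = exp (-L / 4)`. -/
theorem abs_discrepancy_le (j : ℕ) : ∃ C L₀ : ℝ, 1 ≤ C ∧ 1 ≤ L₀ ∧ ∀ L, L₀ ≤ L →
    ∀ κ, 0 < κ → κ ≤ 1 / L → ∀ u, 0 < u →
    |discrepancy L j κ (exp (-L / 4)) u| ≤
      C * (1 / L) * u ^ j * (exp (-(1 / L * u)) + exp (-L / 4) * exp (-(κ * u))) := by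
  obtain ⟨C, L₀, hC, hL₀, hS⟩ := abs_card_sifted_exp_sub_le
  have hj : (0 : ℝ) ≤ j := Nat.cast_nonneg j
  refine ⟨C * exp 2 + (4 + j) * (2 + C), max L₀ 4, ?_, hL₀.trans (le_max_left _ _),
    fun L hL κ hκ0 hκ u hu => ?_⟩
  · have : 1 ≤ exp 2 := one_le_exp (by norm_num)
    nlinarith
  have hL4 : 4 ≤ L := (le_max_right _ _).trans hL
  replace hS := hS L ((le_max_left _ _).trans hL)
  have hL0 : 0 < L := by linarith
  have hη1 : 1 / L ≤ 1 / 4 := one_div_le_one_div_of_le (by norm_num) hL4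
  set τ := exp (-L / 4) with hτ
  have hτ0 : 0 < τ := exp_pos _
  have hτ2 : τ ≤ 1 / 2 := by
    have h1 : τ ≤ exp (-1) := exp_le_exp.2 (by linarith)
    have h2 : exp (-1) ≤ 1 / 2 := by
      rw [exp_neg, one_div]
      exact inv_anti₀ two_pos (by linarith [add_one_le_exp (1 : ℝ)])
    exact h1.trans h2
  set W := roughDensity L with hW
  have hW0 : 0 < W := roughDensity_pos L
  have hWη : W ≤ 1 / L := roughDensity_le hL0
  set η := 1 / L with hη
  have hη0 : 0 < η := by positivity
  have hηL : η * L = 1 := one_div_mul_cancel hL0.ne'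
  have hCpos : 0 ≤ C * exp 2 := by positivity
  rcases lt_or_ge u L with huL | huL
  · rw [discrepancy, blockSum_eq_zero j κ τ huL.le, zero_sub, mul_neg, abs_neg, abs_mul,
      abs_mul, abs_of_pos hW0, abs_of_pos (inv_pos.2 hτ0)]
    have h1 : |∫ v in (u - τ)..u, model j κ v| ≤ u ^ j * τ := by
      have := intervalIntegral.norm_integral_le_of_norm_le_const (a := u - τ) (b := u)
        (f := model j κ) (C := u ^ j) (fun v hv => by
          rw [Set.uIoc_of_le (by linarith)] at hv
          rw [norm_of_nonneg (model_nonneg j κ v)]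
          exact model_le hκ0.le hu.le hv.2)
      simpa [abs_of_pos hτ0] using this
    have h2 : exp (-1) ≤ exp (-(η * u)) := exp_le_exp.2 (by nlinarith)
    have h3 : 1 ≤ exp 2 * exp (-1) := by
      rw [← exp_add]; exact one_le_exp (by norm_num)
    have h5 : 0 ≤ η * u ^ j := by positivity
    calc τ⁻¹ * (W * |∫ v in (u - τ)..u, model j κ v|) ≤ τ⁻¹ * (η * (u ^ j * τ)) := by gcongr
      _ = η * u ^ j := by field_simp
      _ ≤ (C * exp 2 + (4 + j) * (2 + C)) * (η * u ^ j) * exp (-1) := by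
        have h4 : 1 ≤ (C * exp 2 + (4 + j) * (2 + C)) * exp (-1) := by
          have h6 : 0 ≤ (4 + (j : ℝ)) * (2 + C) * exp (-1) := by positivity
          nlinarith
        nlinarith
      _ ≤ (C * exp 2 + (4 + j) * (2 + C)) * (η * u ^ j) *
          (exp (-(η * u)) + τ * exp (-(κ * u))) := by
        have h7 : 0 ≤ τ * exp (-(κ * u)) := by positivity
        refine mul_le_mul_of_nonneg_left (by linarith) ?_
        have : 0 ≤ (4 + (j : ℝ)) * (2 + C) := by positivity
        positivity
      _ = _ := by ring
  · set H := exp u - exp (u - τ) with hH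
    set F := u ^ j * exp (-((1 + κ) * u)) with hF
    have hF0 : 0 ≤ F := by positivity
    have hHeq : H = exp u * (1 - exp (-τ)) := by
      rw [hH, sub_eq_add_neg u τ, exp_add]; ring
    have hHle : H ≤ exp u * τ := by
      rw [hHeq]
      exact mul_le_mul_of_nonneg_left (by linarith [add_one_le_exp (-τ)]) (exp_pos _).le
    have hHge : exp u * τ * exp (-1) ≤ H := by
      rw [hHeq, mul_assoc]
      refine mul_le_mul_of_nonneg_left ?_ (exp_pos _).le
      have h2 : exp (-1) ≤ 1 / 2 := by
        rw [exp_neg, one_div]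
        exact inv_anti₀ two_pos (by linarith [add_one_le_exp (1 : ℝ)])
      have h3 : exp (-τ) ≤ 1 - τ / 2 := by
        have h3 := abs_exp_sub_one_sub_id_le (x := -τ) (by rw [abs_le]; constructor <;> linarith)
        have h4 := (abs_le.1 h3).2
        nlinarith
      nlinarith
    have hH0 : 0 < H := lt_of_lt_of_le (by positivity) hHge
    have hlogH : u - L / 4 - 1 ≤ log H := by
      rw [le_log_iff_exp_le hH0]
      refine le_trans (le_of_eq ?_) hHge
      rw [hτ, ← exp_add, ← exp_add]; congr 1; ring
    have hS1 := hS (exp (u - τ)) H (exp_pos _).le hH0 (by linarith)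
    have hab : exp (u - τ) + H = exp u := by rw [hH]; ring
    rw [hab, ← roughDensity, ← hW] at hS1
    set s : Finset ℕ := sifted (primesUpTo (exp L)) (exp (u - τ)) (exp u) with hs
    have hexpH : exp (-(log H / L)) ≤ exp 2 * exp (-(η * u)) := by
      rw [← exp_add, exp_le_exp, div_eq_inv_mul, ← one_div, ← hη]
      nlinarith [mul_le_mul_of_nonneg_left hlogH hη0.le]
    have hexp1 : exp (-(log H / L)) ≤ 1 := by
      rw [exp_le_one_iff, neg_nonpos]
      exact div_nonneg (by linarith) hL0.le
    have hcard : (#s : ℝ) ≤ (1 + C) * (H * η) := by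
      have h1 := (abs_le.1 hS1).2
      have h2 : C * (H * η) * exp (-(log H / L)) ≤ C * (H * η) :=
        mul_le_of_le_one_right (by positivity) hexp1
      have h3 := mul_le_mul_of_nonneg_left hWη hH0.le
      linarith
    have hsum : |blockSum L j κ τ u - F * #s| ≤ (4 + j) * τ * F * #s :=
      abs_blockSum_sub_le L j hκ0.le (by linarith) hτ2 (by linarith)
    have hintg : |(∫ v in (u - τ)..u, model j κ v) - F * H| ≤ (4 + j) * τ * F * H :=
      abs_integral_model_sub_le j hκ0.le (by linarith) hτ0.le hτ2 (by linarith)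
    have hFH : τ⁻¹ * (F * H) ≤ u ^ j * exp (-(κ * u)) := by
      have h1 : F * (exp u * τ) = τ * (u ^ j * exp (-(κ * u))) := by
        have : exp (-(κ * u)) = exp (-((1 + κ) * u)) * exp u := by
          rw [← exp_add]; congr 1; ring
        rw [hF, this]; ring
      rw [inv_mul_le_iff₀ hτ0, ← h1]
      exact mul_le_mul_of_nonneg_left hHle hF0
    have hκu : exp (-(κ * u)) ≤ 1 := exp_le_one_iff.2 (by nlinarith [mul_pos hκ0 hu])
    have hmain : |blockSum L j κ τ u - W * ∫ v in (u - τ)..u, model j κ v| ≤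
        F * H * η * (C * exp 2 * exp (-(η * u)) + (4 + j) * (2 + C) * τ) := by
      have e1 : |F * #s - W * (F * H)| ≤ F * (C * (H * η) * (exp 2 * exp (-(η * u)))) := by
        have : F * #s - W * (F * H) = F * (#s - H * W) := by ring
        rw [this, abs_mul, abs_of_nonneg hF0]
        refine mul_le_mul_of_nonneg_left (hS1.trans ?_) hF0
        exact mul_le_mul_of_nonneg_left hexpH (by positivity)
      have e2 : |W * (∫ v in (u - τ)..u, model j κ v) - W * (F * H)| ≤
          η * ((4 + j) * τ * F * H) := by
        rw [← mul_sub, abs_mul, abs_of_pos hW0]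
        exact mul_le_mul hWη hintg (abs_nonneg _) hη0.le
      have e3 : (4 + j) * τ * F * #s ≤ (4 + j) * τ * F * ((1 + C) * (H * η)) :=
        mul_le_mul_of_nonneg_left hcard (by positivity)
      rw [abs_le] at *
      constructor <;> linarith
    rw [discrepancy, abs_mul, abs_of_pos (inv_pos.2 hτ0)]
    have hE : 0 ≤ C * exp 2 * exp (-(η * u)) + (4 + j) * (2 + C) * τ := by positivity
    calc τ⁻¹ * |blockSum L j κ τ u - W * ∫ v in (u - τ)..u, model j κ v|
        ≤ τ⁻¹ * (F * H * η * (C * exp 2 * exp (-(η * u)) + (4 + j) * (2 + C) * τ)) :=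
          mul_le_mul_of_nonneg_left hmain (by positivity)
      _ = (τ⁻¹ * (F * H)) * (η * (C * exp 2 * exp (-(η * u)) + (4 + j) * (2 + C) * τ)) := by ring
      _ ≤ (u ^ j * exp (-(κ * u))) *
            (η * (C * exp 2 * exp (-(η * u)) + (4 + j) * (2 + C) * τ)) :=
          mul_le_mul_of_nonneg_right hFH (by positivity)
      _ = η * u ^ j * (C * exp 2 * exp (-(η * u)) * exp (-(κ * u)) +
            (4 + j) * (2 + C) * (τ * exp (-(κ * u)))) := by ring
      _ ≤ η * u ^ j * ((C * exp 2 + (4 + j) * (2 + C)) * exp (-(η * u)) +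
            (C * exp 2 + (4 + j) * (2 + C)) * (τ * exp (-(κ * u)))) := by
          have hb : 0 ≤ (4 + (j : ℝ)) * (2 + C) := by positivity
          refine mul_le_mul_of_nonneg_left (add_le_add ?_ ?_) (by positivity)
          · refine (mul_le_of_le_one_right (by positivity) hκu).trans ?_
            exact mul_le_mul_of_nonneg_right (by linarith) (exp_pos _).le
          · exact mul_le_mul_of_nonneg_right (by linarith) (by positivity)
      _ = _ := by ring

/-! ### Fourier transforms -/

/-- The additive character `u ↦ e^{-itu}`. -/
noncomputable def wave (t u : ℝ) : ℂ := Complex.exp (-(t * u) * Complex.I)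

lemma norm_wave (t u : ℝ) : ‖wave t u‖ = 1 := by
  have h : -((t : ℂ) * u) * Complex.I = ((-(t * u) : ℝ) : ℂ) * Complex.I := by push_cast; ring
  rw [wave, h, Complex.norm_exp_ofReal_mul_I]

lemma wave_add (t u v : ℝ) : wave t (u + v) = wave t u * wave t v := by
  rw [wave, wave, wave, ← Complex.exp_add]; congr 1; push_cast; ring

lemma wave_zero (t : ℝ) : wave t 0 = 1 := by simp [wave]

lemma wave_comm (t u : ℝ) : wave t u = wave u t := by
  rw [wave, wave, mul_comm (t : ℂ)]

lemma conj_wave (t u : ℝ) : (starRingEnd ℂ) (wave t u) = wave t (-u) := by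
  rw [wave, wave, ← Complex.exp_conj]; simp

@[fun_prop]
lemma continuous_wave : Continuous fun p : ℝ × ℝ => wave p.1 p.2 := by
  unfold wave; fun_prop

lemma continuous_wave_right (t : ℝ) : Continuous (wave t) := by
  unfold wave; fun_prop

lemma integrable_mul_wave {f : ℝ → ℂ} (hf : Integrable f) (t : ℝ) :
    Integrable fun u => f u * wave t u :=
  hf.mul_bdd (c := 1) (continuous_wave_right t).aestronglyMeasurable
    (.of_forall fun u => (norm_wave t u).le)

lemma continuous_integral_mul_wave {f : ℝ → ℂ} (hf : Integrable f) :
    Continuous fun t => ∫ u, f u * wave t u := by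
  refine continuous_of_dominated (bound := fun u => ‖f u‖)
    (fun t => (integrable_mul_wave hf t).aestronglyMeasurable)
    (fun t => .of_forall fun u => by simp [norm_wave]) hf.norm (.of_forall fun u => ?_)
  exact continuous_const.mul (by unfold wave; fun_prop)

lemma norm_integral_mul_wave_le (f : ℝ → ℂ) (t : ℝ) :
    ‖∫ u, f u * wave t u‖ ≤ ∫ u, ‖f u‖ := by
  refine (norm_integral_le_integral_norm _).trans_eq ?_
  simp [norm_wave]

lemma integral_convolution_mul_wave {f g : ℝ → ℂ} (hf : Integrable f) (hg : Integrable g) (t : ℝ) :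
    ∫ w, (∫ u, f u * g (w - u)) * wave t w =
      (∫ u, f u * wave t u) * ∫ u, g u * wave t u := by
  have h := integral_convolution (ContinuousLinearMap.mul ℝ ℂ) (integrable_mul_wave hf t)
    (integrable_mul_wave hg t) (μ := volume) (ν := volume)
  rw [ContinuousLinearMap.mul_apply'] at h
  rw [← h]
  congr 1 with w
  rw [convolution_def, ← integral_mul_const]
  congr 1 with u
  rw [ContinuousLinearMap.mul_apply', show wave t w = wave t u * wave t (w - u) by
    rw [← wave_add]; congr 1; ring]
  ring

lemma integrable_integral_mul_sub {f g : ℝ → ℂ} (hf : Integrable f) (hg : Integrable g) :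
    Integrable fun w => ∫ u, f u * g (w - u) :=
  hf.integrable_convolution (ContinuousLinearMap.mul ℝ ℂ) hg

lemma integral_fourier_mul {f g : ℝ → ℂ} (hf : Integrable f) (hg : Integrable g) :
    ∫ t, (∫ u, f u * wave t u) * g t = ∫ u, f u * ∫ t, g t * wave u t := by
  simp_rw [← integral_mul_const, ← integral_const_mul]
  rw [integral_integral_swap]
  · congr 1 with u
    congr 1 with t
    rw [wave_comm]; ring
  · have h : Integrable (fun p : ℝ × ℝ => g p.1 * f p.2) (volume.prod volume) := hg.mul_prod hf
    refine (h.mul_bdd (c := 1) (g := fun p : ℝ × ℝ => wave p.1 p.2)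
      continuous_wave.aestronglyMeasurable (.of_forall fun p => (norm_wave _ _).le)).congr
      (.of_forall fun p => ?_)
    simp only [Function.uncurry]; ring

lemma integral_gaussian_mul_wave {b : ℝ} (hb : 0 < b) (u : ℝ) :
    ∫ t : ℝ, ((exp (-b * t ^ 2) : ℝ) : ℂ) * wave u t =
      ((√(π / b) * exp (-(1 / (4 * b)) * u ^ 2) : ℝ) : ℂ) := by
  have h := fourierIntegral_gaussian (b := (b : ℂ)) (by simpa using hb) (-u)
  calc _ = ∫ x : ℝ, Complex.exp (Complex.I * (-u) * x) * Complex.exp (-(b : ℂ) * (x : ℂ) ^ 2) := by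
        congr 1 with t
        rw [mul_comm, wave]; push_cast; congr 2; ring
    _ = _ := by
        rw [h]; push_cast
        congr 1
        · rw [Real.sqrt_eq_rpow, Complex.ofReal_cpow (by positivity)]; push_cast; rfl
        · congr 1; field_simp

lemma abs_integral_mul_sub_le {h : ℝ → ℝ} (h2 : Integrable fun u => h u ^ 2) (w : ℝ) :
    |∫ u, h u * h (u - w)| ≤ ∫ u, h u ^ 2 := by
  have h2' : Integrable fun u => h (u - w) ^ 2 := h2.comp_sub_right w
  calc |∫ u, h u * h (u - w)| ≤ ∫ u, (h u ^ 2 + h (u - w) ^ 2) / 2 := by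
        rw [← Real.norm_eq_abs]
        refine norm_integral_le_of_norm_le ((h2.add h2').div_const 2) (.of_forall fun u => ?_)
        rw [Real.norm_eq_abs, abs_le]
        constructor <;> nlinarith [sq_nonneg (h u - h (u - w)), sq_nonneg (h u + h (u - w))]
    _ = _ := by
        rw [integral_div, integral_add h2 h2', integral_sub_right_eq_self (fun u => h u ^ 2) w]
        ring

/-- An approximate form of Plancherel's inequality. -/
lemma integral_norm_fourier_sq_le {h : ℝ → ℝ} (h1 : Integrable h)
    (h2 : Integrable fun u => h u ^ 2) {T : ℝ} (hT : 0 < T) :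
    ∫ t in (-T)..T, ‖∫ u, (h u : ℂ) * wave t u‖ ^ 2 ≤ 2 * π * exp 1 * ∫ u, h u ^ 2 := by
  have hc : Integrable fun u => (h u : ℂ) := h1.ofReal
  have hm : Integrable fun u => (h (-u) : ℂ) := hc.comp_neg
  set F : ℝ → ℂ := fun t => ∫ u, (h u : ℂ) * wave t u with hF
  set r : ℝ → ℝ := fun w => ∫ u, h u * h (u - w) with hr
  have hrc : ∀ w, (r w : ℂ) = ∫ u, (h u : ℂ) * (h (-(w - u)) : ℂ) := fun w => by
    change ((∫ u, h u * h (u - w) : ℝ) : ℂ) = _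
    rw [← integral_complex_ofReal]
    congr 1 with u
    rw [neg_sub]; push_cast; rfl
  have hrint : Integrable fun w => (r w : ℂ) := by
    simp_rw [hrc]; exact integrable_integral_mul_sub hc hm
  have hsq : ∀ t, ∫ w, (r w : ℂ) * wave t w = ((‖F t‖ ^ 2 : ℝ) : ℂ) := fun t => by
    simp_rw [hrc]
    rw [integral_convolution_mul_wave hc hm]
    have : ∫ u, (h (-u) : ℂ) * wave t u = (starRingEnd ℂ) (F t) := by
      rw [hF, ← integral_conj, ← integral_neg_eq_self]
      congr 1 with u
      simp [conj_wave]
    rw [this, Complex.mul_conj, Complex.normSq_eq_norm_sq]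
  have hFb : ∀ t, ‖F t‖ ≤ ∫ u, ‖(h u : ℂ)‖ := norm_integral_mul_wave_le _
  have hFc : Continuous F := continuous_integral_mul_wave hc
  set b : ℝ := 1 / T ^ 2 with hb
  have hb0 : 0 < b := by positivity
  have hg : Integrable fun t : ℝ => exp (-b * t ^ 2) := integrable_exp_neg_mul_sq hb0
  have key := integral_fourier_mul hrint hg.ofReal
  simp only [hsq, Complex.coe_algebraMap,
    integral_gaussian_mul_wave hb0] at key
  have key' : ∫ t, ‖F t‖ ^ 2 * exp (-b * t ^ 2) =
      ∫ u, r u * (√(π / b) * exp (-(1 / (4 * b)) * u ^ 2)) := by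
    have := congrArg Complex.re key
    simp only [← Complex.ofReal_mul, integral_complex_ofReal, Complex.ofReal_re] at this
    exact this
  have hg2 : Integrable fun u : ℝ => √(π / b) * exp (-(1 / (4 * b)) * u ^ 2) :=
    (integrable_exp_neg_mul_sq (by positivity)).const_mul _
  have hI0 : (0 : ℝ) ≤ ∫ u, h u ^ 2 := integral_nonneg fun u => sq_nonneg _
  have hup : ∫ u, r u * (√(π / b) * exp (-(1 / (4 * b)) * u ^ 2)) ≤ (∫ u, h u ^ 2) * (2 * π) := by
    calc _ ≤ ∫ u, (∫ u, h u ^ 2) * (√(π / b) * exp (-(1 / (4 * b)) * u ^ 2)) := by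
          refine (le_norm_self _).trans (norm_integral_le_of_norm_le (hg2.const_mul (∫ u, h u ^ 2))
            (.of_forall fun u => ?_))
          rw [norm_mul, Real.norm_eq_abs, Real.norm_of_nonneg (by positivity)]
          exact mul_le_mul_of_nonneg_right (abs_integral_mul_sub_le h2 u) (by positivity)
      _ = _ := by
          rw [integral_const_mul, integral_const_mul, integral_gaussian]
          congr 1
          rw [← Real.sqrt_mul (by positivity), show π / b * (π / (1 / (4 * b))) = (2 * π) ^ 2 by
            field_simp; ring, Real.sqrt_sq (by positivity)]
  have hlow : ∫ t in (-T)..T, ‖F t‖ ^ 2 ≤ ∫ t, exp 1 * (‖F t‖ ^ 2 * exp (-b * t ^ 2)) := by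
    have hintg : Integrable fun t => exp 1 * (‖F t‖ ^ 2 * exp (-b * t ^ 2)) :=
      (hg.bdd_mul (c := (∫ u, ‖(h u : ℂ)‖) ^ 2) (by fun_prop) (.of_forall fun t => by
        rw [Real.norm_of_nonneg (by positivity)]
        exact pow_le_pow_left₀ (norm_nonneg _) (hFb t) 2)).const_mul _
    rw [intervalIntegral.integral_of_le (by linarith)]
    refine (setIntegral_mono_on (Continuous.integrableOn_Ioc (by fun_prop)) hintg.integrableOn
      measurableSet_Ioc fun t ht => ?_).trans
      (setIntegral_le_integral hintg (.of_forall fun t => by positivity))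
    rw [mul_left_comm, ← exp_add]
    refine le_mul_of_one_le_right (by positivity) (one_le_exp ?_)
    have : b * t ^ 2 ≤ 1 := by
      rw [hb, one_div, inv_mul_le_iff₀ (by positivity)]
      nlinarith [ht.1, ht.2]
    linarith
  rw [integral_const_mul, key'] at hlow
  nlinarith [exp_pos 1]

/-- The Laplace transform of `v ↦ v ^ j` is `s ↦ j ! / s ^ (j + 1)`. -/
lemma integral_model (j : ℕ) {κ : ℝ} (hκ : 0 < κ) :
    ∫ v, model j κ v = j.factorial / κ ^ (j + 1) := by
  have h := Real.integral_rpow_mul_exp_neg_mul_Ioi (a := j + 1) (r := κ) (by positivity) hκ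
  have h1 : ∫ v, model j κ v = ∫ v in Set.Ioi 0, v ^ ((j + 1 : ℝ) - 1) * exp (-(κ * v)) := by
    rw [← integral_indicator measurableSet_Ioi]
    congr 1 with v
    simp [model, Set.indicator]
  rw [h1, h, Real.Gamma_nat_eq_factorial, one_div, ← Nat.cast_add_one, Real.rpow_natCast, inv_pow]
  ring

lemma integrable_model (j : ℕ) {κ : ℝ} (hκ : 0 < κ) : Integrable (model j κ) :=
  .of_integral_ne_zero (by rw [integral_model j hκ]; positivity)

lemma integral_model_mul_wave (j : ℕ) {κ : ℝ} (hκ : 0 < κ) (t : ℝ) :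
    ∫ v, (model j κ v : ℂ) * wave t v = j.factorial / (κ + t * Complex.I) ^ (j + 1) := by
  set s : ℂ := κ + t * Complex.I with hs
  have hsre : s.re = κ := by simp [hs]
  have hs0 : s ≠ 0 := fun h => hκ.ne' (by rw [← hsre, h, Complex.zero_re])
  have hform (k : ℕ) (v : ℝ) : (model k κ v : ℂ) * wave t v =
      (Set.Ioi (0 : ℝ)).indicator (fun v : ℝ => (v : ℂ) ^ k * Complex.exp (-(s * v))) v := by
    by_cases hv : 0 < v
    · rw [Set.indicator_of_mem (Set.mem_Ioi.2 hv), model, if_pos hv, wave]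
      push_cast
      rw [mul_assoc, ← Complex.exp_add]
      congr 2; rw [hs]; ring
    · rw [Set.indicator_of_notMem (by simpa using hv), model, if_neg hv]; simp
  have hintg (k : ℕ) : IntegrableOn (fun v : ℝ => (v : ℂ) ^ k * Complex.exp (-(s * v)))
      (Set.Ioi 0) := by
    rw [← integrable_indicator_iff measurableSet_Ioi]
    exact (integrable_mul_wave (integrable_model k hκ).ofReal t).congr (.of_forall (hform k))
  have hderiv (v : ℝ) : HasDerivAt (fun v : ℝ => Complex.exp (-(s * v)))
      (-s * Complex.exp (-(s * v))) v := by
    have h1 : HasDerivAt (fun z : ℂ => Complex.exp (-(s * z)))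
        (Complex.exp (-(s * v)) * (-(s * 1))) v :=
      (((hasDerivAt_id (v : ℂ)).const_mul s).neg).cexp
    convert! h1.comp_ofReal using 1
    ring
  have htend (k : ℕ) : Filter.Tendsto (fun v : ℝ => (v : ℂ) ^ k * Complex.exp (-(s * v)))
      Filter.atTop (nhds 0) := by
    rw [tendsto_zero_iff_norm_tendsto_zero]
    refine (tendsto_rpow_mul_exp_neg_mul_atTop_nhds_zero k κ hκ).congr' ?_
    filter_upwards [Filter.eventually_gt_atTop 0] with v hv
    rw [norm_mul, norm_pow, Complex.norm_exp, Complex.norm_real, Real.norm_of_nonneg hv.le,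
      Real.rpow_natCast]
    simp [hsre]
  simp_rw [hform]
  rw [integral_indicator measurableSet_Ioi]
  induction j with
  | zero =>
    have h := integral_exp_mul_complex_Ioi (a := -s) (by simpa [hsre] using hκ) 0
    simpa [neg_mul] using h
  | succ j ih =>
    have h := integral_Ioi_of_hasDerivAt_of_tendsto'
      (f := fun v : ℝ => (v : ℂ) ^ (j + 1) * Complex.exp (-(s * v)))
      (f' := fun v : ℝ => (j + 1 : ℂ) * ((v : ℂ) ^ j * Complex.exp (-(s * v))) -
        s * ((v : ℂ) ^ (j + 1) * Complex.exp (-(s * v)))) (a := 0) (m := 0)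
      (fun v _ => by
        have h1 : HasDerivAt (fun v : ℝ => (v : ℂ) ^ (j + 1)) (((j + 1 : ℕ) : ℂ) * (v : ℂ) ^ j) v :=
          (hasDerivAt_pow (j + 1) (v : ℂ)).comp_ofReal
        convert! h1.mul (hderiv v) using 1
        push_cast; ring)
      (((hintg j).const_mul _).sub ((hintg (j + 1)).const_mul _)) (htend (j + 1))
    rw [integral_sub ((hintg j).const_mul _) ((hintg (j + 1)).const_mul _), integral_const_mul,
      integral_const_mul, ih] at h
    simp only [Complex.ofReal_zero, ne_eq, Nat.add_eq_zero_iff, one_ne_zero, and_false,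
      not_false_eq_true, zero_pow, zero_mul, sub_zero] at h
    have h2 := sub_eq_zero.1 h
    rw [Nat.factorial_succ]; push_cast
    field_simp at h2 ⊢
    linear_combination -h2

lemma summable_coeff (L : ℝ) (j : ℕ) {κ : ℝ} (hκ : 0 < κ) : Summable (coeff L j κ) := by
  refine Summable.of_nonneg_of_le (coeff_nonneg L j κ) (fun n => ?_)
    ((Real.summable_nat_rpow_inv.2 (show 1 < 1 + κ / 2 by linarith)).mul_left
      (j.factorial / (κ / 2) ^ j))
  rcases Nat.eq_zero_or_pos n with rfl | hn
  · simp only [coeff, rough]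
    simp
    positivity
  have hlog : 0 ≤ log n := log_natCast_nonneg n
  have h1 := Real.pow_div_factorial_le_exp (κ / 2 * log n) (by positivity) j
  rw [div_le_iff₀ (by positivity), mul_pow, mul_comm, ← le_div_iff₀ (by positivity)] at h1
  calc coeff L j κ n ≤ 1 * (log n ^ j * exp (-((1 + κ) * log n))) :=
        mul_le_mul_of_nonneg_right (rough_le_one L n) (by positivity)
    _ ≤ (exp (κ / 2 * log n) * j.factorial / (κ / 2) ^ j) * exp (-((1 + κ) * log n)) := by
        rw [one_mul]; gcongr
    _ = _ := by
        rw [Real.rpow_def_of_pos (by exact_mod_cast hn), ← Real.exp_neg, mul_div_assoc,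
          mul_right_comm,
          ← exp_add, mul_comm]
        congr 2; ring

/-- The Dirichlet series `∑ rough(n) (log n)^j n^{-1-κ-it}`. -/
noncomputable def roughSeries (L : ℝ) (j : ℕ) (κ t : ℝ) : ℂ :=
  ∑' n : ℕ, (coeff L j κ n : ℂ) * wave t (log n)

lemma summable_coeff_mul_wave (L : ℝ) (j : ℕ) {κ : ℝ} (hκ : 0 < κ) (t : ℝ) :
    Summable fun n : ℕ => (coeff L j κ n : ℂ) * wave t (log n) := by
  refine Summable.of_norm_bounded (summable_coeff L j hκ) fun n => ?_
  rw [norm_mul, norm_wave, mul_one, Complex.norm_real, Real.norm_of_nonneg (coeff_nonneg L j κ n)]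

/-- The deviation of `roughSeries` from its main term. -/
noncomputable def seriesError (L : ℝ) (j : ℕ) (κ t : ℝ) : ℂ :=
  roughSeries L j κ t - roughDensity L * (j.factorial / (κ + t * Complex.I) ^ (j + 1))

/-- The Fourier transform of the uniform distribution on `[0, τ]`. -/
noncomputable def windowTransform (τ t : ℝ) : ℂ := (τ : ℂ)⁻¹ * ∫ w in Set.Ico 0 τ, wave t w

lemma norm_wave_sub_one_le (t u : ℝ) : ‖wave t u - 1‖ ≤ |t * u| := by
  have h : wave t u = Complex.exp (Complex.I * (-(t * u) : ℝ)) := by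
    rw [wave]; push_cast; congr 1; ring
  rw [h]
  simpa using Real.norm_exp_I_mul_ofReal_sub_one_le (x := -(t * u))

lemma half_le_norm_windowTransform {τ t : ℝ} (hτ : 0 < τ) (ht : |t| * τ ≤ 1) :
    1 / 2 ≤ ‖windowTransform τ t‖ := by
  have hintg : IntegrableOn (wave t) (Set.Ico 0 τ) :=
    ((continuous_wave_right t).integrableOn_Icc).mono_set Set.Ico_subset_Icc_self
  have h1 : ‖windowTransform τ t - 1‖ ≤ 1 / 2 := by
    have h2 : windowTransform τ t - 1 = (τ : ℂ)⁻¹ * ∫ w in Set.Ico 0 τ, (wave t w - 1) := by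
      rw [integral_sub hintg (by simp), windowTransform, mul_sub]
      simp [hτ.le, hτ.ne']
    have h3 : ‖∫ w in Set.Ico 0 τ, (wave t w - 1)‖ ≤ ∫ w in Set.Ico 0 τ, |t| * w := by
      refine norm_integral_le_of_norm_le
        ((by fun_prop : Continuous fun w : ℝ => |t| * w).integrableOn_Icc.mono_set
          Set.Ico_subset_Icc_self) ?_
      refine (ae_restrict_iff' measurableSet_Ico).2 (.of_forall fun w hw => ?_)
      exact (norm_wave_sub_one_le t w).trans_eq (by rw [abs_mul, abs_of_nonneg hw.1])
    have h5 : ∫ w in Set.Ico 0 τ, |t| * w = |t| * (τ ^ 2 / 2) := by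
      rw [integral_Ico_eq_integral_Ioc, ← intervalIntegral.integral_of_le hτ.le,
        intervalIntegral.integral_const_mul, integral_id]
      ring
    rw [h5] at h3
    rw [h2, norm_mul, norm_inv, Complex.norm_real, Real.norm_of_nonneg hτ.le, inv_mul_le_iff₀ hτ]
    nlinarith
  have h4 : ‖(1 : ℂ)‖ ≤ ‖windowTransform τ t‖ + ‖windowTransform τ t - 1‖ := by
    simpa using norm_sub_le (windowTransform τ t) (windowTransform τ t - 1)
  rw [norm_one] at h4
  linarith

lemma hasSum_blockSum {L : ℝ} (j : ℕ) (κ τ u : ℝ) :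
    HasSum (fun n : ℕ => (Set.Ico (log n) (log n + τ)).indicator (fun _ => coeff L j κ n) u)
      (blockSum L j κ τ u) := by
  have h : ∀ n : ℕ, (Set.Ico (log n) (log n + τ)).indicator (fun _ => coeff L j κ n) u =
      if log n ≤ u ∧ u < log n + τ then coeff L j κ n else 0 := fun n => by
    simp [Set.indicator]
  simp_rw [h]
  refine (summable_of_hasFiniteSupport ((Set.finite_Iic ⌊exp u⌋₊).subset fun n hn => ?_)).hasSum
  have hn' : log n ≤ u := by
    by_contra hc
    exact hn (if_neg fun h => hc h.1)
  rcases Nat.eq_zero_or_pos n with rfl | hpos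
  · simp
  · exact Nat.le_floor ((log_le_iff_le_exp (by exact_mod_cast hpos)).1 hn')

lemma measurable_blockSum (L : ℝ) (j : ℕ) (κ τ : ℝ) : Measurable (blockSum L j κ τ) := by
  refine measurable_of_tendsto_metrizable (f := fun N : ℕ => fun u => ∑ n ∈ range N,
    (Set.Ico (log n) (log n + τ)).indicator (fun _ => coeff L j κ n) u) (fun N => ?_)
    (tendsto_pi_nhds.2 fun u => (hasSum_blockSum j κ τ u).tendsto_sum_nat)
  exact Finset.measurable_sum _ fun n _ => measurable_const.indicator measurableSet_Ico

lemma integral_indicator_mul_wave (a τ c t : ℝ) :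
    ∫ u, (((Set.Ico a (a + τ)).indicator (fun _ => c) u : ℝ) : ℂ) * wave t u =
      c * wave t a * ∫ w in Set.Ico 0 τ, wave t w := by
  rw [← integral_indicator measurableSet_Ico, ← integral_const_mul,
    ← integral_add_right_eq_self _ a]
  congr 1 with u
  by_cases hu : u ∈ Set.Ico 0 τ
  · rw [Set.indicator_of_mem hu, Set.indicator_of_mem (by
      constructor <;> linarith [hu.1, hu.2]), wave_add]
    ring
  · rw [Set.indicator_of_notMem hu, Set.indicator_of_notMem (fun h => hu (by
      constructor <;> linarith [h.1, h.2]))]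
    simp

lemma integral_blockSum_mul_wave (L : ℝ) (j : ℕ) {κ τ : ℝ} (hκ : 0 < κ) (hτ : 0 < τ) (t : ℝ) :
    ∫ u, (blockSum L j κ τ u : ℂ) * wave t u =
      roughSeries L j κ t * ∫ w in Set.Ico 0 τ, wave t w := by
  set F : ℕ → ℝ → ℂ := fun n u =>
    (((Set.Ico (log n) (log n + τ)).indicator (fun _ => coeff L j κ n) u : ℝ) : ℂ) * wave t u
    with hF
  have hind (n : ℕ) : Integrable fun u => ((Set.Ico (log n) (log n + τ)).indicator
      (fun _ => coeff L j κ n) u) :=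
    (integrable_indicator_iff measurableSet_Ico).2 (by simp)
  have hFint (n : ℕ) : Integrable (F n) := integrable_mul_wave (hind n).ofReal t
  have hnorm (n : ℕ) : ∫ u, ‖F n u‖ = τ * coeff L j κ n := by
    have h : ∀ u, ‖F n u‖ = (Set.Ico (log n) (log n + τ)).indicator
        (fun _ => coeff L j κ n) u := fun u => by
      rw [hF, norm_mul, norm_wave, mul_one, Complex.norm_real, Real.norm_of_nonneg
        (Set.indicator_nonneg (fun _ _ => coeff_nonneg L j κ n) u)]
    simp_rw [h]
    rw [integral_indicator measurableSet_Ico]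
    simp [hτ.le]
  have h1 := hasSum_integral_of_summable_integral_norm hFint (by
    simp_rw [hnorm]; exact (summable_coeff L j hκ).mul_left τ)
  have h2 (u : ℝ) : ∑' n, F n u = (blockSum L j κ τ u : ℂ) * wave t u := by
    rw [hF, tsum_mul_right, ← (hasSum_blockSum j κ τ u).tsum_eq, Complex.ofReal_tsum]
  simp_rw [h2] at h1
  rw [← h1.tsum_eq, roughSeries, ← tsum_mul_right]
  exact tsum_congr fun n => integral_indicator_mul_wave _ _ _ _

lemma integral_window_model (j : ℕ) (κ : ℝ) {τ : ℝ} (hτ : 0 < τ) (u : ℝ) :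
    ((∫ v in (u - τ)..u, model j κ v : ℝ) : ℂ) =
      ∫ v, (model j κ v : ℂ) * (((Set.Ico 0 τ).indicator (fun _ => (1 : ℝ)) (u - v) : ℝ) : ℂ) := by
  rw [intervalIntegral.integral_of_le (by linarith), ← integral_indicator measurableSet_Ioc,
    ← integral_complex_ofReal]
  congr 1 with v
  by_cases hv : v ∈ Set.Ioc (u - τ) u
  · rw [Set.indicator_of_mem hv, Set.indicator_of_mem (by
      constructor <;> linarith [hv.1, hv.2])]
    simp
  · rw [Set.indicator_of_notMem hv, Set.indicator_of_notMem (fun h => hv (by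
      constructor <;> linarith [h.1, h.2]))]
    simp

lemma integrable_window_model (j : ℕ) {κ τ : ℝ} (hκ : 0 < κ) (hτ : 0 < τ) :
    Integrable fun u => ((∫ v in (u - τ)..u, model j κ v : ℝ) : ℂ) := by
  simp_rw [integral_window_model j κ hτ]
  refine integrable_integral_mul_sub (f := fun v => (model j κ v : ℂ))
    (g := fun v => (((Set.Ico 0 τ).indicator (fun _ => (1 : ℝ)) v : ℝ) : ℂ))
    (integrable_model j hκ).ofReal
    (Integrable.ofReal ((integrable_indicator_iff measurableSet_Ico).2 (by simp)))

lemma integral_window_model_mul_wave (j : ℕ) {κ τ : ℝ} (hκ : 0 < κ) (hτ : 0 < τ) (t : ℝ) :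
    ∫ u, ((∫ v in (u - τ)..u, model j κ v : ℝ) : ℂ) * wave t u =
      j.factorial / (κ + t * Complex.I) ^ (j + 1) * ∫ w in Set.Ico 0 τ, wave t w := by
  simp_rw [integral_window_model j κ hτ]
  rw [integral_convolution_mul_wave (f := fun v => (model j κ v : ℂ))
    (g := fun v => (((Set.Ico 0 τ).indicator (fun _ => (1 : ℝ)) v : ℝ) : ℂ))
    (integrable_model j hκ).ofReal
    (Integrable.ofReal ((integrable_indicator_iff measurableSet_Ico).2 (by simp))),
    integral_model_mul_wave j hκ]
  congr 1
  simpa [wave_zero] using integral_indicator_mul_wave 0 τ 1 t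

lemma measurable_discrepancy (L : ℝ) (j : ℕ) {κ τ : ℝ} (hκ : 0 < κ) (hτ : 0 < τ) :
    AEStronglyMeasurable (discrepancy L j κ τ) := by
  have h := (integrable_window_model j hκ hτ).re.aestronglyMeasurable
  simp only [RCLike.re_to_complex, Complex.ofReal_re] at h
  exact ((measurable_blockSum L j κ τ).aestronglyMeasurable.sub (h.const_mul _)).const_mul _

/-- The Fourier transform of `discrepancy`. -/
lemma integral_discrepancy_mul_wave {L : ℝ} {j : ℕ} {κ τ : ℝ} (hκ : 0 < κ) (hτ : 0 < τ)
    (hintg : Integrable (discrepancy L j κ τ)) (t : ℝ) :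
    ∫ u, (discrepancy L j κ τ u : ℂ) * wave t u =
      windowTransform τ t * seriesError L j κ t := by
  set M : ℝ → ℂ := fun u => ((∫ v in (u - τ)..u, model j κ v : ℝ) : ℂ) with hM
  have hMint : Integrable M := integrable_window_model j hκ hτ
  have hB (u : ℝ) : (blockSum L j κ τ u : ℂ) =
      τ * discrepancy L j κ τ u + roughDensity L * M u := by
    rw [hM, discrepancy]
    push_cast
    have : (τ : ℂ) ≠ 0 := by exact_mod_cast hτ.ne'
    field_simp
    ring
  have hd : Integrable fun u => (discrepancy L j κ τ u : ℂ) := hintg.ofReal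
  have h1 := integral_blockSum_mul_wave L j hκ hτ t
  have h3 : ∫ u, (τ * discrepancy L j κ τ u + roughDensity L * M u) * wave t u =
      τ * (∫ u, (discrepancy L j κ τ u : ℂ) * wave t u) +
        roughDensity L * ∫ u, M u * wave t u := by
    rw [← integral_const_mul, ← integral_const_mul, ← integral_add
      ((integrable_mul_wave hd t).const_mul _) ((integrable_mul_wave hMint t).const_mul _)]
    congr 1 with u
    ring
  simp_rw [hB] at h1
  rw [h3, hM, integral_window_model_mul_wave j hκ hτ] at h1
  have : (τ : ℂ) ≠ 0 := by exact_mod_cast hτ.ne'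
  rw [windowTransform, seriesError, mul_assoc, eq_inv_mul_iff_mul_eq₀ this]
  linear_combination h1

lemma continuous_roughSeries (L : ℝ) (j : ℕ) {κ : ℝ} (hκ : 0 < κ) :
    Continuous (roughSeries L j κ) := by
  refine continuous_tsum (u := coeff L j κ) (fun n => ?_) (summable_coeff L j hκ) fun n t => ?_
  · exact continuous_const.mul (by unfold wave; fun_prop)
  · rw [norm_mul, norm_wave, mul_one, Complex.norm_real,
      Real.norm_of_nonneg (coeff_nonneg L j κ n)]

lemma add_mul_I_ne_zero {κ : ℝ} (hκ : 0 < κ) (t : ℝ) : (κ + t * Complex.I : ℂ) ≠ 0 := fun h =>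
  hκ.ne' (by simpa using congrArg Complex.re h)

lemma continuous_seriesError (L : ℝ) (j : ℕ) {κ : ℝ} (hκ : 0 < κ) :
    Continuous (seriesError L j κ) := by
  refine (continuous_roughSeries L j hκ).sub (continuous_const.mul (continuous_const.div₀
    (by fun_prop) fun t => pow_ne_zero _ (add_mul_I_ne_zero hκ t)))

lemma abs_discrepancy_le_model (j : ℕ) : ∃ C L₀ : ℝ, 1 ≤ C ∧ 1 ≤ L₀ ∧ ∀ L, L₀ ≤ L → ∀ κ, 0 < κ →
    κ ≤ 1 / L → ∀ u, |discrepancy L j κ (exp (-L / 4)) u| ≤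
      C * (1 / L) * (model j (1 / L) u + exp (-L / 4) * model j κ u) := by
  obtain ⟨C, L₀, hC, hL₀, h⟩ := abs_discrepancy_le j
  refine ⟨C, L₀, hC, hL₀, fun L hL κ hκ0 hκ u => ?_⟩
  rcases le_or_gt u 0 with hu | hu
  · rw [discrepancy_of_nonpos (by linarith) j κ (exp_pos _).le hu]
    simp [model, hu.not_gt]
  · refine (h L hL κ hκ0 hκ u hu).trans_eq ?_
    rw [model, if_pos hu, model, if_pos hu]
    ring

lemma model_sq (j : ℕ) (κ v : ℝ) : model j κ v ^ 2 = model (2 * j) (2 * κ) v := by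
  unfold model
  split_ifs
  · rw [mul_pow, ← pow_mul, mul_comm j, ← exp_nat_mul]; push_cast; congr 2; ring
  · simp

lemma integral_discrepancy_bounds (j : ℕ) : ∃ C L₀ : ℝ, 1 ≤ C ∧ 1 ≤ L₀ ∧ ∀ L, L₀ ≤ L → ∀ κ,
    0 < κ → κ ≤ 1 / L → exp (-L / 4) * (1 / (L * κ)) ^ (2 * j + 1) ≤ 1 →
    Integrable (discrepancy L j κ (exp (-L / 4))) ∧
    Integrable (fun u => discrepancy L j κ (exp (-L / 4)) u ^ 2) ∧
    ∫ u, |discrepancy L j κ (exp (-L / 4)) u| ≤ C * L ^ j ∧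
    ∫ u, discrepancy L j κ (exp (-L / 4)) u ^ 2 ≤ C * (L ^ (2 * j) / L) := by
  obtain ⟨C, L₀, hC, hL₀, h⟩ := abs_discrepancy_le_model j
  refine ⟨max (2 * C * j.factorial) (4 * C ^ 2 * (2 * j).factorial), L₀, ?_, hL₀,
    fun L hL κ hκ0 hκ hτ => ?_⟩
  · refine le_max_of_le_left ?_
    have : (1 : ℝ) ≤ j.factorial := by exact_mod_cast j.factorial_pos
    nlinarith
  have hL0 : 0 < L := by linarith
  set η := 1 / L with hη
  have hη0 : 0 < η := by positivity
  set τ := exp (-L / 4) with hτdef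
  have hτ0 : 0 < τ := exp_pos _
  have hτ1 : τ ≤ 1 := exp_le_one_iff.2 (by linarith)
  set D := discrepancy L j κ τ with hD
  have hm := measurable_discrepancy L j hκ0 hτ0
  have hratio : 1 / (L * κ) = η / κ := by rw [hη]; field_simp
  rw [hratio] at hτ
  have h1r : 1 ≤ η / κ := (one_le_div hκ0).2 hκ
  have hb1 : Integrable fun u => C * η * (model j η u + τ * model j κ u) :=
    ((integrable_model j hη0).add ((integrable_model j hκ0).const_mul τ)).const_mul _
  have hb2 : Integrable fun u => 2 * C ^ 2 * η ^ 2 *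
      (model (2 * j) (2 * η) u + τ ^ 2 * model (2 * j) (2 * κ) u) :=
    ((integrable_model _ (by positivity)).add
      ((integrable_model _ (by positivity)).const_mul _)).const_mul _
  have hle (u : ℝ) : |D u| ≤ C * η * (model j η u + τ * model j κ u) := h L hL κ hκ0 hκ u
  have hle2 (u : ℝ) : D u ^ 2 ≤ 2 * C ^ 2 * η ^ 2 *
      (model (2 * j) (2 * η) u + τ ^ 2 * model (2 * j) (2 * κ) u) := by
    rw [← model_sq, ← model_sq, ← sq_abs]
    calc |D u| ^ 2 ≤ (C * η * (model j η u + τ * model j κ u)) ^ 2 :=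
          pow_le_pow_left₀ (abs_nonneg _) (hle u) 2
      _ ≤ _ := by
          have := mul_nonneg (sq_nonneg (C * η)) (sq_nonneg (model j η u - τ * model j κ u))
          nlinarith
  have hi1 : Integrable D := hb1.mono' hm (.of_forall hle)
  have hi2 : Integrable fun u => D u ^ 2 := hb2.mono' (hm.pow 2) (.of_forall fun u => by
    rw [Real.norm_of_nonneg (sq_nonneg _)]; exact hle2 u)
  refine ⟨hi1, hi2, ?_, ?_⟩
  · calc ∫ u, |D u| ≤ ∫ u, C * η * (model j η u + τ * model j κ u) :=
          integral_mono hi1.abs hb1 hle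
      _ = C * η * (j.factorial / η ^ (j + 1) * (1 + τ * (η / κ) ^ (j + 1))) := by
          rw [integral_const_mul, integral_add (integrable_model j hη0)
            ((integrable_model j hκ0).const_mul τ), integral_const_mul, integral_model j hη0,
            integral_model j hκ0]
          congr 1
          rw [div_pow η κ]
          field_simp
      _ ≤ C * η * (j.factorial / η ^ (j + 1) * (1 + 1)) := by
          gcongr
          refine le_trans ?_ hτ
          exact mul_le_mul_of_nonneg_left (pow_le_pow_right₀ h1r (by omega)) hτ0.le
      _ = 2 * C * j.factorial * L ^ j := by
          simp only [hη, div_pow, one_pow]; field_simp; ring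
      _ ≤ _ := by gcongr; exact le_max_left _ _
  · calc ∫ u, D u ^ 2 ≤ ∫ u, 2 * C ^ 2 * η ^ 2 *
          (model (2 * j) (2 * η) u + τ ^ 2 * model (2 * j) (2 * κ) u) :=
          integral_mono hi2 hb2 hle2
      _ = 2 * C ^ 2 * η ^ 2 * ((2 * j).factorial / (2 * η) ^ (2 * j + 1) *
          (1 + τ * (τ * (η / κ) ^ (2 * j + 1)))) := by
          rw [integral_const_mul, integral_add (integrable_model _ (by positivity))
            ((integrable_model _ (by positivity)).const_mul _), integral_const_mul,
            integral_model _ (by positivity), integral_model _ (by positivity)]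
          congr 1
          rw [mul_pow, mul_pow, div_pow η κ]
          field_simp
      _ ≤ 2 * C ^ 2 * η ^ 2 * ((2 * j).factorial / η ^ (2 * j + 1) * (1 + 1 * 1)) := by
          gcongr
          linarith
      _ = 4 * C ^ 2 * (2 * j).factorial * (L ^ (2 * j) / L) := by
          simp only [hη, div_pow, one_pow]; field_simp; ring
      _ ≤ _ := by gcongr; exact le_max_right _ _

lemma seriesError_bounds (j : ℕ) : ∃ C L₀ : ℝ, 1 ≤ C ∧ 1 ≤ L₀ ∧ ∀ L, L₀ ≤ L → ∀ κ,
    0 < κ → κ ≤ 1 / L → exp (-L / 4) * (1 / (L * κ)) ^ (2 * j + 1) ≤ 1 →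
    (∀ t, |t| ≤ exp (L / 4) → ‖seriesError L j κ t‖ ≤ C * L ^ j) ∧
    ∫ t in (-exp (L / 4))..(exp (L / 4)), ‖seriesError L j κ t‖ ^ 2 ≤ C * (L ^ (2 * j) / L) := by
  obtain ⟨C, L₀, hC, hL₀, h⟩ := integral_discrepancy_bounds j
  have hπ : 1 ≤ π * exp 1 := by nlinarith [Real.pi_gt_three, Real.add_one_le_exp 1]
  refine ⟨8 * π * exp 1 * C, L₀, by nlinarith, hL₀, fun L hL κ hκ0 hκ hsmall => ?_⟩
  obtain ⟨hi1, hi2, hb1, hb2⟩ := h L hL κ hκ0 hκ hsmall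
  have hL0 : 0 < L := by linarith
  set τ := exp (-L / 4) with hτ
  have hτ0 : 0 < τ := exp_pos _
  have hT : exp (L / 4) * τ = 1 := by rw [hτ, ← exp_add]; simp [neg_div]
  set F : ℝ → ℂ := fun t => ∫ u, (discrepancy L j κ τ u : ℂ) * wave t u with hF
  have hd : Integrable fun u => (discrepancy L j κ τ u : ℂ) := hi1.ofReal
  have hle {t : ℝ} (ht : |t| ≤ exp (L / 4)) : ‖seriesError L j κ t‖ ≤ 2 * ‖F t‖ := by
    have h1 := half_le_norm_windowTransform hτ0 (t := t)
      ((mul_le_mul_of_nonneg_right ht hτ0.le).trans_eq hT)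
    have h2 : F t = _ := integral_discrepancy_mul_wave hκ0 hτ0 hi1 t
    rw [h2, norm_mul]
    nlinarith [norm_nonneg (seriesError L j κ t)]
  constructor
  · intro t ht
    have h2 : ‖F t‖ ≤ C * L ^ j := (norm_integral_mul_wave_le _ t).trans (by simpa using hb1)
    have h3 : 0 ≤ C * L ^ j := by positivity
    nlinarith [hle ht]
  · calc _ ≤ ∫ t in (-exp (L / 4))..(exp (L / 4)), 4 * ‖F t‖ ^ 2 := by
          have hc := continuous_seriesError L j hκ0
          have hFc : Continuous F := continuous_integral_mul_wave hd
          refine intervalIntegral.integral_mono_on (by linarith [exp_pos (L / 4)])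
            (Continuous.intervalIntegrable (by fun_prop) _ _)
            (Continuous.intervalIntegrable (by fun_prop) _ _) fun t ht => ?_
          nlinarith [hle (abs_le.2 ht), norm_nonneg (seriesError L j κ t), norm_nonneg (F t)]
      _ ≤ 4 * (2 * π * exp 1 * (C * (L ^ (2 * j) / L))) := by
          rw [intervalIntegral.integral_const_mul]
          gcongr
          exact (integral_norm_fourier_sq_le hi1 hi2 (exp_pos _)).trans (by gcongr)
      _ = _ := by ring

/-! ### The logarithmic derivative of the sieved zeta function -/

/-- The product of the primes up to `exp L`. -/
noncomputable def sieveModulus (L : ℝ) : ℕ := ∏ p ∈ primesUpTo (exp L), p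

/-- The indicator function of the integers coprime to `sieveModulus L`. -/
noncomputable def principal (L : ℝ) (n : ℕ) : ℂ :=
  (1 : DirichletCharacter ℂ (sieveModulus L)) n

lemma sieveModulus_ne_zero (L : ℝ) : sieveModulus L ≠ 0 :=
  Finset.prod_ne_zero_iff.2 fun _ hp => (prime_of_mem_primesUpTo _ hp).ne_zero

lemma coprime_sieveModulus_iff (L : ℝ) (n : ℕ) :
    n.Coprime (sieveModulus L) ↔ ∀ p ∈ primesUpTo (exp L), ¬ p ∣ n := by
  rw [sieveModulus, Nat.coprime_prod_right_iff]
  refine forall₂_congr fun p hp => ?_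
  rw [Nat.coprime_comm, (prime_of_mem_primesUpTo _ hp).coprime_iff_not_dvd]

lemma principal_eq {L : ℝ} {n : ℕ} (hn : n ≠ 0) :
    principal L n = rough L n + if n = 1 then 1 else 0 := by
  have h : principal L n = if ∀ p ∈ primesUpTo (exp L), ¬ p ∣ n then 1 else 0 := by
    rw [principal]
    split_ifs with h
    · exact MulChar.one_apply ((ZMod.isUnit_iff_coprime _ _).2 ((coprime_sieveModulus_iff L n).2 h))
    · exact MulChar.map_nonunit _ fun hu =>
        h ((coprime_sieveModulus_iff L n).1 ((ZMod.isUnit_iff_coprime _ _).1 hu))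
  rw [h, rough]
  rcases eq_or_ne n 1 with rfl | h1
  · have : ∀ p ∈ primesUpTo (exp L), ¬ p ∣ 1 := fun p hp hd =>
      (prime_of_mem_primesUpTo _ hp).one_lt.ne' (Nat.dvd_one.1 hd)
    rw [if_pos this]; simp
  · have : 1 < n := by omega
    simp only [this, h1, true_and, if_false, add_zero]
    split_ifs <;> simp

lemma lseries_eq_tsum (f : ℕ → ℂ) (κ t : ℝ) :
    LSeries f (1 + κ + Complex.I * t) = ∑' n : ℕ, if n = 0 then 0 else
      f n * (exp (-((1 + κ) * log n)) : ℝ) * wave t (log n) := by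
  rw [LSeries]
  refine tsum_congr fun n => ?_
  rw [LSeries.term_def]
  split_ifs with hn
  · rfl
  · rw [Complex.cpow_def_of_ne_zero (by exact_mod_cast hn), div_eq_mul_inv, ← Complex.exp_neg,
      wave, mul_assoc, Complex.ofReal_exp, ← Complex.exp_add, Complex.natCast_log]
    push_cast
    congr 2; ring

lemma lseries_principal {L κ : ℝ} (hκ : 0 < κ) (t : ℝ) :
    LSeries (principal L) (1 + κ + Complex.I * t) = 1 + roughSeries L 0 κ t := by
  rw [lseries_eq_tsum, roughSeries]
  have h1 : HasSum (fun n : ℕ => if n = 1 then (1 : ℂ) else 0) 1 := hasSum_ite_eq 1 1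
  have h2 := (summable_coeff_mul_wave L 0 hκ t).hasSum
  rw [← (h1.add h2).tsum_eq]
  refine tsum_congr fun n => ?_
  split_ifs with h0 hn1 hn1
  · omega
  · subst h0; simp [coeff, rough]
  · subst hn1; simp [principal_eq, coeff, rough, wave_zero]
  · rw [principal_eq h0, if_neg hn1, coeff]; push_cast; ring

lemma lseries_logMul_principal (L κ t : ℝ) :
    LSeries (LSeries.logMul (principal L)) (1 + κ + Complex.I * t) = roughSeries L 1 κ t := by
  rw [lseries_eq_tsum, roughSeries]
  refine tsum_congr fun n => ?_
  split_ifs with h0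
  · subst h0; simp [coeff, rough]
  · rw [LSeries.logMul, principal_eq h0, coeff, ← Complex.natCast_log]
    split_ifs with h1
    · subst h1; simp
    · push_cast; ring

lemma lseries_logMul_logMul_principal (L κ t : ℝ) :
    LSeries (LSeries.logMul (LSeries.logMul (principal L))) (1 + κ + Complex.I * t) =
      roughSeries L 2 κ t := by
  rw [lseries_eq_tsum, roughSeries]
  refine tsum_congr fun n => ?_
  split_ifs with h0
  · subst h0; simp [coeff, rough]
  · rw [LSeries.logMul, LSeries.logMul, principal_eq h0, coeff, ← Complex.natCast_log]
    split_ifs with h1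
    · subst h1; simp
    · push_cast; ring

/-- The coefficient of the Dirichlet series `∑ rough(n) Λ(n) (log n) n^{-1-κ}`. -/
noncomputable def mangoldtCoeff (L κ : ℝ) (n : ℕ) : ℝ :=
  rough L n * (ArithmeticFunction.vonMangoldt n * log n * exp (-((1 + κ) * log n)))

lemma mangoldtCoeff_nonneg (L κ : ℝ) (n : ℕ) : 0 ≤ mangoldtCoeff L κ n :=
  mul_nonneg (rough_nonneg L n) (mul_nonneg (mul_nonneg ArithmeticFunction.vonMangoldt_nonneg
    (log_natCast_nonneg n)) (exp_pos _).le)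

lemma mangoldtCoeff_le (L κ : ℝ) (n : ℕ) : mangoldtCoeff L κ n ≤ coeff L 2 κ n := by
  rw [mangoldtCoeff, coeff, sq]
  have := rough_nonneg L n
  have := log_natCast_nonneg n
  gcongr
  exact ArithmeticFunction.vonMangoldt_le_log

lemma one_lt_re {κ : ℝ} (hκ : 0 < κ) (t : ℝ) : 1 < (1 + κ + Complex.I * t : ℂ).re := by
  simpa using hκ

lemma principal_abscissa_lt {L : ℝ} {s : ℂ} (hs : 1 < s.re) :
    LSeries.abscissaOfAbsConv (principal L) < s.re := by
  unfold principal
  rw [DirichletCharacter.absicssaOfAbsConv_eq_one (sieveModulus_ne_zero L)]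
  exact_mod_cast hs

lemma hasDerivAt_lseries_principal (L : ℝ) {s : ℂ} (hs : 1 < s.re) :
    HasDerivAt (LSeries (principal L)) (-LSeries (LSeries.logMul (principal L)) s) s :=
  LSeries_hasDerivAt (principal_abscissa_lt hs)

lemma lseries_principal_ne_zero (L : ℝ) {s : ℂ} (hs : 1 < s.re) : LSeries (principal L) s ≠ 0 :=
  DirichletCharacter.LSeries_ne_zero_of_one_lt_re _ hs

lemma one_add_roughSeries_ne_zero (L : ℝ) {κ : ℝ} (hκ : 0 < κ) (t : ℝ) :
    1 + roughSeries L 0 κ t ≠ 0 := by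
  rw [← lseries_principal hκ]
  exact lseries_principal_ne_zero L (one_lt_re hκ t)

lemma tsum_mangoldtCoeff_mul_wave (L : ℝ) {κ : ℝ} (hκ : 0 < κ) (t : ℝ) :
    ∑' n : ℕ, (mangoldtCoeff L κ n : ℂ) * wave t (log n) =
      roughSeries L 2 κ t / (1 + roughSeries L 0 κ t) -
        (roughSeries L 1 κ t / (1 + roughSeries L 0 κ t)) ^ 2 := by
  set s : ℂ := 1 + κ + Complex.I * t with hs
  have hs1 : 1 < s.re := one_lt_re hκ t
  set f : ℕ → ℂ := fun n => principal L n * ArithmeticFunction.vonMangoldt n with hf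
  have hfeq {z : ℂ} (hz : 1 < z.re) :
      LSeries f z = LSeries (LSeries.logMul (principal L)) z / LSeries (principal L) z := by
    have h := DirichletCharacter.LSeries_twist_vonMangoldt_eq
      (1 : DirichletCharacter ℂ (sieveModulus L)) hz
    rw [show deriv (LSeries fun n : ℕ => (1 : DirichletCharacter ℂ (sieveModulus L)) n) z = _ from
      (hasDerivAt_lseries_principal L hz).deriv, neg_neg] at h
    exact h
  have hfabs : LSeries.abscissaOfAbsConv f < s.re := by
    obtain ⟨x, hx1, hx2⟩ := exists_between hs1
    have h : LSeriesSummable f (x : ℂ) := DirichletCharacter.LSeriesSummable_twist_vonMangoldt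
      (1 : DirichletCharacter ℂ (sieveModulus L)) (by simpa using hx1)
    exact h.abscissaOfAbsConv_le.trans_lt (by simpa using hx2)
  have h1 : ∑' n : ℕ, (mangoldtCoeff L κ n : ℂ) * wave t (log n) =
      LSeries (LSeries.logMul f) s := by
    rw [hs, lseries_eq_tsum]
    refine tsum_congr fun n => ?_
    split_ifs with h0
    · subst h0; simp [mangoldtCoeff]
    · rw [LSeries.logMul, hf]
      simp only
      rw [principal_eq h0, mangoldtCoeff, ← Complex.natCast_log]
      split_ifs with h1
      · subst h1; simp
      · push_cast; ring
  have h2 := LSeries_deriv hfabs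
  have h3 : LSeries f =ᶠ[nhds s] fun z =>
      LSeries (LSeries.logMul (principal L)) z / LSeries (principal L) z := by
    filter_upwards [(isOpen_lt continuous_const Complex.continuous_re).mem_nhds hs1] with z hz
    exact hfeq hz
  have h4 : HasDerivAt (LSeries (LSeries.logMul (principal L)))
      (-LSeries (LSeries.logMul (LSeries.logMul (principal L))) s) s :=
    LSeries_hasDerivAt (by
      rw [LSeries.abscissaOfAbsConv_logMul]; exact principal_abscissa_lt hs1)
  have hne := lseries_principal_ne_zero L hs1
  rw [h3.deriv_eq, (h4.fun_div (hasDerivAt_lseries_principal L hs1) hne).deriv] at h2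
  rw [h1, ← neg_eq_iff_eq_neg.2 h2, hs, lseries_logMul_logMul_principal, lseries_logMul_principal,
    lseries_principal hκ]
  have := one_add_roughSeries_ne_zero L hκ t
  field_simp
  ring

/-- The Dirichlet series `∑ rough(n) (log n - Λ(n)) (log n) n^{-1-κ-it}`. -/
noncomputable def compositeSeries (L κ t : ℝ) : ℂ :=
  ∑' n : ℕ, ((coeff L 2 κ n - mangoldtCoeff L κ n : ℝ) : ℂ) * wave t (log n)

lemma summable_compositeCoeff (L : ℝ) {κ : ℝ} (hκ : 0 < κ) :
    Summable fun n => coeff L 2 κ n - mangoldtCoeff L κ n :=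
  (summable_coeff L 2 hκ).of_nonneg_of_le (fun n => sub_nonneg.2 (mangoldtCoeff_le L κ n))
    fun n => sub_le_self _ (mangoldtCoeff_nonneg L κ n)

lemma compositeSeries_eq (L : ℝ) {κ : ℝ} (hκ : 0 < κ) (t : ℝ) :
    compositeSeries L κ t =
      roughSeries L 2 κ t * roughSeries L 0 κ t / (1 + roughSeries L 0 κ t) +
        (roughSeries L 1 κ t / (1 + roughSeries L 0 κ t)) ^ 2 := by
  have hs : Summable fun n : ℕ => (mangoldtCoeff L κ n : ℂ) * wave t (log n) := by
    refine Summable.of_norm_bounded (summable_coeff L 2 hκ) fun n => ?_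
    rw [norm_mul, norm_wave, mul_one, Complex.norm_real,
      Real.norm_of_nonneg (mangoldtCoeff_nonneg L κ n)]
    exact mangoldtCoeff_le L κ n
  have h : compositeSeries L κ t = roughSeries L 2 κ t -
      ∑' n : ℕ, (mangoldtCoeff L κ n : ℂ) * wave t (log n) := by
    rw [compositeSeries, roughSeries, ← (summable_coeff_mul_wave L 2 hκ t).tsum_sub hs]
    exact tsum_congr fun n => by push_cast; ring
  rw [h, tsum_mangoldtCoeff_mul_wave L hκ]
  have := one_add_roughSeries_ne_zero L hκ t
  field_simp
  ring

lemma one_le_roughSeries_product (L : ℝ) {κ : ℝ} (hκ : 0 < κ) (t : ℝ) :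
    1 ≤ ‖1 + roughSeries L 0 κ 0‖ ^ 3 * ‖1 + roughSeries L 0 κ t‖ ^ 4 *
      ‖1 + roughSeries L 0 κ (2 * t)‖ := by
  have h := DirichletCharacter.norm_LSeries_product_ge_one
    (1 : DirichletCharacter ℂ (sieveModulus L)) hκ t
  rw [one_pow] at h
  have h0 := lseries_principal (L := L) hκ 0
  have h2 := lseries_principal (L := L) hκ (2 * t)
  rw [Complex.ofReal_zero, mul_zero, add_zero] at h0
  rw [show Complex.I * ((2 * t : ℝ) : ℂ) = 2 * Complex.I * t by push_cast; ring] at h2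
  rw [← h0, ← lseries_principal hκ t, ← h2, ← norm_pow, ← norm_pow, ← norm_mul, ← norm_mul]
  exact h

lemma hasDerivAt_roughSeries (L : ℝ) {κ : ℝ} (hκ : 0 < κ) (t : ℝ) :
    HasDerivAt (fun κ => 1 + roughSeries L 0 κ t) (-roughSeries L 1 κ t) κ := by
  have h := hasDerivAt_lseries_principal L (one_lt_re hκ t)
  rw [lseries_logMul_principal] at h
  have h1 : HasDerivAt (fun κ : ℝ => (1 + κ + Complex.I * t : ℂ)) 1 κ :=
    ((Complex.ofRealCLM.hasDerivAt.const_add 1).add_const _)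
  have h2 := HasDerivAt.scomp κ h h1
  rw [one_smul] at h2
  refine h2.congr_of_eventuallyEq ?_
  filter_upwards [lt_mem_nhds hκ] with k hk
  exact (lseries_principal hk t).symm

/-- The set of `t` with `a < |t| ≤ b`. -/
def band (a b : ℝ) : Set ℝ := {t | a < |t| ∧ |t| ≤ b}

lemma measurableSet_band (a b : ℝ) : MeasurableSet (band a b) :=
  (measurableSet_lt measurable_const measurable_id.abs).inter
    (measurableSet_le measurable_id.abs measurable_const)

lemma band_subset_Icc (a b : ℝ) : band a b ⊆ Set.Icc (-b) b := fun _ ht => abs_le.1 ht.2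

lemma integrableOn_band {f : ℝ → ℝ} (hf : Continuous f) (a b : ℝ) : IntegrableOn f (band a b) :=
  hf.integrableOn_Icc.mono_set (band_subset_Icc a b)

/-- The range of `κ` for which the error terms are under control. -/
def Admissible (L κ : ℝ) : Prop := 0 < κ ∧ κ ≤ 1 / L ∧ exp (-L / 4) * (1 / (L * κ)) ^ 5 ≤ 1

lemma Admissible.mono {L κ κ' : ℝ} (h : Admissible L κ) (hL : 0 < L) (h1 : κ ≤ κ')
    (h2 : κ' ≤ 1 / L) : Admissible L κ' := by
  have hκ := h.1
  have hκ' := h.1.trans_le h1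
  refine ⟨hκ', h2, le_trans ?_ h.2.2⟩
  gcongr

lemma seriesError_bounds_uniform : ∃ C L₀ : ℝ, 1 ≤ C ∧ 1 ≤ L₀ ∧ ∀ L, L₀ ≤ L → ∀ κ,
    Admissible L κ → ∀ j ≤ 2, (∀ t, |t| ≤ exp (L / 4) → ‖seriesError L j κ t‖ ≤ C * L ^ j) ∧
    ∫ t in (-exp (L / 4))..(exp (L / 4)), ‖seriesError L j κ t‖ ^ 2 ≤ C * (L ^ (2 * j) / L) := by
  choose C L₀ hC hL₀ h using seriesError_bounds
  have hle (f : ℕ → ℝ) {j : ℕ} (hj : j ≤ 2) : f j ≤ max (f 0) (max (f 1) (f 2)) := by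
    interval_cases j <;> simp
  refine ⟨max (C 0) (max (C 1) (C 2)), max (L₀ 0) (max (L₀ 1) (L₀ 2)),
    (hC 0).trans (le_max_left _ _), (hL₀ 0).trans (le_max_left _ _), fun L hL κ hκ j hj => ?_⟩
  have hL1 : L₀ j ≤ L := (hle L₀ hj).trans hL
  have hL0 : 0 < L := by linarith [hL₀ j]
  have h1 : 1 ≤ 1 / (L * κ) := by
    rw [one_le_div (mul_pos hL0 hκ.1), mul_comm, ← le_div_iff₀ hL0]; exact hκ.2.1
  obtain ⟨h2, h3⟩ := h j L hL1 κ hκ.1 hκ.2.1 ((mul_le_mul_of_nonneg_left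
    (pow_le_pow_right₀ h1 (by omega)) (exp_pos _).le).trans hκ.2.2)
  exact ⟨fun t ht => (h2 t ht).trans (mul_le_mul_of_nonneg_right (hle C hj) (by positivity)),
    h3.trans (mul_le_mul_of_nonneg_right (hle C hj) (by positivity))⟩

lemma norm_main_term_le {L κ t : ℝ} (hL : 0 < L) (hκ : 0 < κ) {j : ℕ} (hj : j ≤ 2) {m : ℝ}
    (hm0 : 0 < m) (hm : m ≤ κ ∨ m ≤ |t|) :
    ‖(roughDensity L : ℂ) * (j.factorial / (κ + t * Complex.I) ^ (j + 1))‖ ≤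
      1 / L * (2 / m ^ (j + 1)) := by
  have h1 : m ≤ ‖(κ + t * Complex.I : ℂ)‖ := by
    rcases hm with hm | hm
    · have := Complex.abs_re_le_norm (κ + t * Complex.I : ℂ)
      simp [abs_of_pos hκ] at this
      linarith
    · have := Complex.abs_im_le_norm (κ + t * Complex.I : ℂ)
      simp at this
      linarith
  have h2 : (j.factorial : ℝ) ≤ 2 := by exact_mod_cast Nat.factorial_le hj
  rw [norm_mul, norm_div, norm_pow, Complex.norm_real, Complex.norm_natCast,
    Real.norm_of_nonneg (roughDensity_pos L).le]
  gcongr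
  exact roughDensity_le hL

lemma roughSeries_eq (L : ℝ) (j : ℕ) (κ t : ℝ) : roughSeries L j κ t =
    roughDensity L * (j.factorial / (κ + t * Complex.I) ^ (j + 1)) + seriesError L j κ t := by
  rw [seriesError]; ring

lemma norm_roughSeries_le : ∃ C L₀ : ℝ, 1 ≤ C ∧ 1 ≤ L₀ ∧ ∀ L, L₀ ≤ L → ∀ κ, Admissible L κ →
    ∀ j ≤ 2, (∀ t, 1 / L ≤ |t| → |t| ≤ exp (L / 4) → ‖roughSeries L j κ t‖ ≤ C * L ^ j) ∧
      ‖roughSeries L j κ 0‖ ≤ C * (1 / (L * κ)) ^ (j + 1) * L ^ j ∧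
      ∫ t in band (1 / L) (exp (L / 4)), ‖roughSeries L j κ t‖ ^ 2 ≤ C * (L ^ (2 * j) / L) := by
  obtain ⟨C, L₀, hC, hL₀, h⟩ := seriesError_bounds_uniform
  refine ⟨64 + 2 * C, L₀, by linarith, hL₀, fun L hL κ hκ j hj => ?_⟩
  obtain ⟨hE, hE2⟩ := h L hL κ hκ j hj
  have hL0 : 0 < L := by linarith
  refine ⟨fun t ht1 ht2 => ?_, ?_, ?_⟩
  · rw [roughSeries_eq]
    refine (norm_add_le_of_le (norm_main_term_le hL0 hκ.1 hj (by positivity) (.inr ht1))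
      (hE t ht2)).trans ?_
    have : 1 / L * (2 / (1 / L) ^ (j + 1)) = 2 * L ^ j := by
      rw [one_div_pow]; field_simp; ring
    rw [this, ← add_mul]
    exact mul_le_mul_of_nonneg_right (by linarith) (by positivity)
  · rw [roughSeries_eq]
    refine (norm_add_le_of_le (norm_main_term_le hL0 hκ.1 hj hκ.1 (.inl le_rfl))
      (hE 0 (by simpa using (exp_pos _).le))).trans ?_
    have h1 : 1 ≤ (1 / (L * κ)) ^ (j + 1) := one_le_pow₀ (by
      rw [one_le_div (mul_pos hL0 hκ.1), mul_comm, ← le_div_iff₀ hL0]; exact hκ.2.1)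
    have h2 : 1 / L * (2 / κ ^ (j + 1)) = 2 * (1 / (L * κ)) ^ (j + 1) * L ^ j := by
      have := hκ.1
      rw [one_div_pow, mul_pow]; field_simp; ring
    have h3 : C * L ^ j ≤ C * (1 / (L * κ)) ^ (j + 1) * L ^ j := by
      gcongr
      exact le_mul_of_one_le_right (by linarith) h1
    rw [h2]
    have h4 : 0 ≤ (1 / (L * κ)) ^ (j + 1) * L ^ j := by positivity
    nlinarith
  · have hintg : Integrable fun t : ℝ => (1 + (L * t) ^ 2)⁻¹ :=
      integrable_inv_one_add_sq.comp_mul_left' hL0.ne'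
    have hval : ∫ t : ℝ, (1 + (L * t) ^ 2)⁻¹ = π / L := by
      rw [Measure.integral_comp_mul_left (fun t => (1 + t ^ 2)⁻¹), integral_univ_inv_one_add_sq,
        abs_of_pos (by positivity), smul_eq_mul]
      ring
    have hEc : Continuous fun t => 2 * ‖seriesError L j κ t‖ ^ 2 := by
      have := continuous_seriesError L j hκ.1
      fun_prop
    have hRc : Continuous fun t => ‖roughSeries L j κ t‖ ^ 2 := by
      have := continuous_roughSeries L j hκ.1
      fun_prop
    have hpt {t : ℝ} (ht : t ∈ band (1 / L) (exp (L / 4))) : ‖roughSeries L j κ t‖ ^ 2 ≤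
        16 * L ^ (2 * j) * (1 + (L * t) ^ 2)⁻¹ + 2 * ‖seriesError L j κ t‖ ^ 2 := by
      have ht0 : 0 < |t| := lt_trans (by positivity) ht.1
      have h1 := norm_main_term_le (t := t) hL0 hκ.1 hj ht0 (.inr le_rfl)
      have h2 := norm_add_le (roughDensity L * (j.factorial / (κ + t * Complex.I) ^ (j + 1)) : ℂ)
        (seriesError L j κ t)
      rw [← roughSeries_eq] at h2
      have hLt : 1 ≤ L * |t| := by
        have := ht.1.le
        rwa [div_le_iff₀' hL0] at this
      have h3 : (1 / L * (2 / |t| ^ (j + 1))) ^ 2 ≤ 8 * L ^ (2 * j) * (1 + (L * t) ^ 2)⁻¹ := by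
        have h5 : (1 / L * (2 / |t| ^ (j + 1))) ^ 2 =
            4 * L ^ (2 * j) * (1 / (L * |t|) ^ (2 * j) * (1 / (L * |t|) ^ 2)) := by
          rw [mul_pow L |t|, mul_pow L |t|]; field_simp; ring
        have h6 : 1 / (L * |t|) ^ (2 * j) ≤ 1 := by
          rw [div_le_one (by positivity)]; exact one_le_pow₀ hLt
        have h7 : 1 / (L * |t|) ^ 2 ≤ 2 * (1 + (L * t) ^ 2)⁻¹ := by
          rw [← div_eq_mul_inv, div_le_div_iff₀ (by positivity) (by positivity), mul_pow, mul_pow,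
            sq_abs]
          nlinarith [one_le_pow₀ hLt (n := 2), mul_pow L |t| 2, sq_abs t]
        rw [h5]
        calc _ ≤ 4 * L ^ (2 * j) * (1 * (2 * (1 + (L * t) ^ 2)⁻¹)) := by gcongr
          _ = _ := by ring
      have h8 : ‖roughSeries L j κ t‖ ≤
          1 / L * (2 / |t| ^ (j + 1)) + ‖seriesError L j κ t‖ := by linarith
      have h9 := pow_le_pow_left₀ (norm_nonneg _) h8 2
      nlinarith [sq_nonneg (1 / L * (2 / |t| ^ (j + 1)) - ‖seriesError L j κ t‖)]
    calc _ ≤ ∫ t in band (1 / L) (exp (L / 4)), (16 * L ^ (2 * j) * (1 + (L * t) ^ 2)⁻¹ +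
          2 * ‖seriesError L j κ t‖ ^ 2) :=
          setIntegral_mono_on (integrableOn_band hRc _ _)
            ((hintg.const_mul _).integrableOn.add (integrableOn_band hEc _ _))
            (measurableSet_band _ _) fun t ht => hpt ht
      _ = (∫ t in band (1 / L) (exp (L / 4)), 16 * L ^ (2 * j) * (1 + (L * t) ^ 2)⁻¹) +
          ∫ t in band (1 / L) (exp (L / 4)), 2 * ‖seriesError L j κ t‖ ^ 2 :=
          integral_add (hintg.const_mul _).integrableOn (integrableOn_band hEc _ _)
      _ ≤ 16 * L ^ (2 * j) * (π / L) + 2 * (C * (L ^ (2 * j) / L)) := by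
          gcongr
          · refine (setIntegral_le_integral (hintg.const_mul _)
              (.of_forall fun t => by positivity)).trans_eq ?_
            rw [integral_const_mul, hval]
          · refine (setIntegral_mono_set hEc.integrableOn_Icc (.of_forall fun t => by positivity)
              (band_subset_Icc _ _).eventuallyLE).trans ?_
            rw [integral_Icc_eq_integral_Ioc, ← intervalIntegral.integral_of_le
              (by linarith [exp_pos (L / 4)]), intervalIntegral.integral_const_mul]
            gcongr
      _ ≤ (64 + 2 * C) * (L ^ (2 * j) / L) := by
          have h1 : 0 ≤ L ^ (2 * j) / L := by positivity
          have h2 : 16 * L ^ (2 * j) * (π / L) = 16 * π * (L ^ (2 * j) / L) := by ring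
          rw [h2]
          nlinarith [Real.pi_le_four]

lemma le_norm_one_add_roughSeries : ∃ c ε L₀ : ℝ, 0 < c ∧ 0 < ε ∧ ε ≤ 1 ∧ 1 ≤ L₀ ∧ ∀ L, L₀ ≤ L →
    ∀ κ, Admissible L κ → κ ≤ ε / L → ∀ t, 1 / L ≤ |t| → 2 * |t| ≤ exp (L / 4) →
      c ≤ ‖1 + roughSeries L 0 κ t‖ := by
  obtain ⟨C, L₀, hC, hL₀, h⟩ := norm_roughSeries_le
  set M := C + 1 with hM
  have hM0 : 0 < M := by linarith
  set ε := 1 / (16 * M ^ 8) with hε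
  have hε0 : 0 < ε := by positivity
  have hε1 : ε ≤ 1 := by
    rw [hε, div_le_one (by positivity)]
    linarith [one_le_pow₀ (show 1 ≤ M by linarith) (n := 8)]
  refine ⟨M * ε, ε, L₀, by positivity, hε0, hε1, hL₀, fun L hL κ hκ hκε t ht1 ht2 => ?_⟩
  have hL0 : 0 < L := by linarith
  have hadm {κ' : ℝ} (h1 : κ ≤ κ') (h2 : κ' ≤ ε / L) : Admissible L κ' :=
    hκ.mono hL0 h1 (h2.trans (by gcongr))
  have hκ' := hadm hκε le_rfl
  have h0 : ‖1 + roughSeries L 0 (ε / L) 0‖ ≤ M / ε := by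
    have h1 := norm_add_le (1 : ℂ) (roughSeries L 0 (ε / L) 0)
    have h2 := (h L hL _ hκ' 0 (by norm_num)).2.1
    have h3 : 1 / (L * (ε / L)) = 1 / ε := by field_simp
    rw [norm_one] at h1
    rw [h3] at h2
    have h4 : 1 ≤ 1 / ε := by rwa [one_le_div hε0]
    have h5 : M / ε = C * (1 / ε) + 1 / ε := by rw [hM]; ring
    simp only [zero_add, pow_one, pow_zero, mul_one] at h2
    linarith
  have h2t : ‖1 + roughSeries L 0 (ε / L) (2 * t)‖ ≤ M := by
    have h1 := norm_add_le (1 : ℂ) (roughSeries L 0 (ε / L) (2 * t))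
    have h2 := (h L hL _ hκ' 0 (by norm_num)).1 (2 * t)
      (by rw [abs_mul, abs_two]; linarith [abs_nonneg t]) (by rwa [abs_mul, abs_two])
    rw [norm_one] at h1
    simp only [pow_zero, mul_one] at h2
    linarith
  have hlow : 2 * M * ε ≤ ‖1 + roughSeries L 0 (ε / L) t‖ := by
    by_contra! hlt
    have h1 := one_le_roughSeries_product L hκ'.1 t
    have h2 : ‖1 + roughSeries L 0 (ε / L) t‖ ^ 4 < (2 * M * ε) ^ 4 :=
      pow_lt_pow_left₀ hlt (norm_nonneg _) (by norm_num)
    have h3 : (M / ε) ^ 3 * (2 * M * ε) ^ 4 * M = 1 := by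
      have : (M / ε) ^ 3 * (2 * M * ε) ^ 4 * M = 16 * M ^ 8 * ε := by field_simp; ring
      rw [this, hε]; field_simp
    have h4 : ‖1 + roughSeries L 0 (ε / L) 0‖ ^ 3 * ‖1 + roughSeries L 0 (ε / L) t‖ ^ 4 *
        ‖1 + roughSeries L 0 (ε / L) (2 * t)‖ ≤
        (M / ε) ^ 3 * ‖1 + roughSeries L 0 (ε / L) t‖ ^ 4 * M := by gcongr
    have h5 : (M / ε) ^ 3 * ‖1 + roughSeries L 0 (ε / L) t‖ ^ 4 * M <
        (M / ε) ^ 3 * (2 * M * ε) ^ 4 * M := by gcongr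
    linarith
  have hmv := norm_image_sub_le_of_norm_deriv_le_segment' (a := κ) (b := ε / L)
    (f := fun κ => 1 + roughSeries L 0 κ t) (f' := fun κ => -roughSeries L 1 κ t) (C := C * L)
    (fun x hx => (hasDerivAt_roughSeries L (hκ.1.trans_le hx.1) t).hasDerivWithinAt)
    (fun x hx => by
      have := (h L hL x (hadm hx.1 hx.2.le) 1 (by norm_num)).1 t ht1 (by linarith [abs_nonneg t])
      rwa [norm_neg, pow_one] at *)
    (ε / L) (Set.right_mem_Icc.2 hκε)
  have h6 : C * L * (ε / L - κ) ≤ C * ε := by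
    have : C * L * (ε / L) = C * ε := by field_simp
    have : 0 ≤ C * L * κ := by have := hκ.1; positivity
    nlinarith
  have h7 := norm_sub_norm_le (1 + roughSeries L 0 (ε / L) t) (1 + roughSeries L 0 κ t)
  have h8 : C * ε + M * ε ≤ 2 * M * ε := by nlinarith
  linarith

lemma continuous_compositeSeries (L : ℝ) {κ : ℝ} (hκ : 0 < κ) :
    Continuous (compositeSeries L κ) := by
  refine continuous_tsum (fun n => continuous_const.mul (by unfold wave; fun_prop))
    (summable_compositeCoeff L hκ).norm fun n t => ?_
  rw [norm_mul, norm_wave, mul_one, Complex.norm_real]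

lemma integral_norm_compositeSeries_le : ∃ C ε L₀ : ℝ, 0 < C ∧ 0 < ε ∧ ε ≤ 1 ∧ 1 ≤ L₀ ∧
    ∀ L, L₀ ≤ L → ∀ κ, Admissible L κ → κ ≤ ε / L →
      ∫ t in band (1 / L) (exp (L / 4) / 2), ‖compositeSeries L κ t‖ ≤ C * L := by
  obtain ⟨C, L₀, hC, hL₀, h⟩ := norm_roughSeries_le
  obtain ⟨c, ε, L₁, hc, hε, hε1, hL₁, hlow⟩ := le_norm_one_add_roughSeries
  refine ⟨(2 * c⁻¹ + (c⁻¹) ^ 2) * C, ε, max L₀ L₁, by positivity, hε, hε1,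
    hL₀.trans (le_max_left _ _), fun L hL κ hκ hκε => ?_⟩
  have hL0 : 0 < L := by linarith [(le_max_left L₀ L₁).trans hL]
  set B := band (1 / L) (exp (L / 4) / 2) with hB
  have hBs : B ⊆ band (1 / L) (exp (L / 4)) :=
    fun t ht => ⟨ht.1, ht.2.trans (by linarith [exp_pos (L / 4)])⟩
  have hc2 (j : ℕ) : Continuous fun t => ‖roughSeries L j κ t‖ ^ 2 := by
    have := continuous_roughSeries L j hκ.1
    fun_prop
  have hintg (j : ℕ) : IntegrableOn (fun t => ‖roughSeries L j κ t‖ ^ 2) B :=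
    integrableOn_band (hc2 j) _ _
  have hI {j : ℕ} (hj : j ≤ 2) : ∫ t in B, ‖roughSeries L j κ t‖ ^ 2 ≤ C * (L ^ (2 * j) / L) :=
    (setIntegral_mono_set (integrableOn_band (hc2 j) _ _) (.of_forall fun t => by positivity)
      hBs.eventuallyLE).trans (h L ((le_max_left _ _).trans hL) κ hκ j hj).2.2
  have hadd : IntegrableOn (fun t => c⁻¹ * (L ^ 2)⁻¹ * ‖roughSeries L 2 κ t‖ ^ 2 +
      c⁻¹ * L ^ 2 * ‖roughSeries L 0 κ t‖ ^ 2) B :=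
    ((hintg 2).const_mul _).add ((hintg 0).const_mul _)
  have hpt {t : ℝ} (ht : t ∈ B) : ‖compositeSeries L κ t‖ ≤
      c⁻¹ * (L ^ 2)⁻¹ * ‖roughSeries L 2 κ t‖ ^ 2 + c⁻¹ * L ^ 2 * ‖roughSeries L 0 κ t‖ ^ 2 +
        (c⁻¹) ^ 2 * ‖roughSeries L 1 κ t‖ ^ 2 := by
    have hlt : ‖1 + roughSeries L 0 κ t‖⁻¹ ≤ c⁻¹ :=
      inv_anti₀ hc (hlow L ((le_max_right _ _).trans hL) κ hκ hκε t ht.1.le (by linarith [ht.2]))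
    rw [compositeSeries_eq L hκ.1 t]
    refine (norm_add_le _ _).trans ?_
    rw [norm_pow, norm_div, norm_div, norm_mul, div_eq_mul_inv, div_eq_mul_inv, mul_pow]
    have h1 : ‖roughSeries L 2 κ t‖ * ‖roughSeries L 0 κ t‖ ≤
        (L ^ 2)⁻¹ * ‖roughSeries L 2 κ t‖ ^ 2 + L ^ 2 * ‖roughSeries L 0 κ t‖ ^ 2 := by
      have h2 : L⁻¹ * L = 1 := inv_mul_cancel₀ hL0.ne'
      have h3 := two_mul_le_add_sq (L⁻¹ * ‖roughSeries L 2 κ t‖) (L * ‖roughSeries L 0 κ t‖)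
      have h4 : 2 * (L⁻¹ * ‖roughSeries L 2 κ t‖) * (L * ‖roughSeries L 0 κ t‖) =
          2 * (‖roughSeries L 2 κ t‖ * ‖roughSeries L 0 κ t‖) := by
        linear_combination 2 * ‖roughSeries L 2 κ t‖ * ‖roughSeries L 0 κ t‖ * h2
      rw [h4, mul_pow, mul_pow, inv_pow] at h3
      have : 0 ≤ ‖roughSeries L 2 κ t‖ * ‖roughSeries L 0 κ t‖ := by positivity
      linarith
    calc _ ≤ ((L ^ 2)⁻¹ * ‖roughSeries L 2 κ t‖ ^ 2 + L ^ 2 * ‖roughSeries L 0 κ t‖ ^ 2) * c⁻¹ +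
          ‖roughSeries L 1 κ t‖ ^ 2 * c⁻¹ ^ 2 := by gcongr
      _ = _ := by ring
  calc _ ≤ ∫ t in B, (c⁻¹ * (L ^ 2)⁻¹ * ‖roughSeries L 2 κ t‖ ^ 2 +
        c⁻¹ * L ^ 2 * ‖roughSeries L 0 κ t‖ ^ 2 + (c⁻¹) ^ 2 * ‖roughSeries L 1 κ t‖ ^ 2) :=
        setIntegral_mono_on (integrableOn_band (continuous_compositeSeries L hκ.1).norm _ _)
          (hadd.add ((hintg 1).const_mul _))
          (measurableSet_band _ _) fun t ht => hpt ht
    _ = c⁻¹ * (L ^ 2)⁻¹ * (∫ t in B, ‖roughSeries L 2 κ t‖ ^ 2) +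
        c⁻¹ * L ^ 2 * (∫ t in B, ‖roughSeries L 0 κ t‖ ^ 2) +
          (c⁻¹) ^ 2 * ∫ t in B, ‖roughSeries L 1 κ t‖ ^ 2 := by
        rw [integral_add hadd ((hintg 1).const_mul _),
          integral_add ((hintg 2).const_mul _) ((hintg 0).const_mul _),
          integral_const_mul, integral_const_mul, integral_const_mul]
    _ ≤ c⁻¹ * (L ^ 2)⁻¹ * (C * (L ^ (2 * 2) / L)) + c⁻¹ * L ^ 2 * (C * (L ^ (2 * 0) / L)) +
          (c⁻¹) ^ 2 * (C * (L ^ (2 * 1) / L)) := by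
        gcongr
        exacts [hI le_rfl, hI (by norm_num), hI (by norm_num)]
    _ = _ := by field_simp; ring

lemma tsum_coeff_le : ∃ C L₀ : ℝ, 1 ≤ C ∧ 1 ≤ L₀ ∧ ∀ L, L₀ ≤ L → ∀ κ, Admissible L κ →
    ∑' n, coeff L 2 κ n ≤ C * (1 / (L * κ)) ^ 3 * L ^ 2 := by
  obtain ⟨C, L₀, hC, hL₀, h⟩ := norm_roughSeries_le
  refine ⟨C, L₀, hC, hL₀, fun L hL κ hκ => le_of_eq_of_le ?_ (h L hL κ hκ 2 le_rfl).2.1⟩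
  have h0 : roughSeries L 2 κ 0 = ((∑' n, coeff L 2 κ n : ℝ) : ℂ) := by
    rw [roughSeries, Complex.ofReal_tsum]
    simp [wave]
  rw [h0, Complex.norm_real, Real.norm_of_nonneg (tsum_nonneg fun n => coeff_nonneg ..)]

lemma norm_compositeSeries_le (L : ℝ) {κ : ℝ} (hκ : 0 < κ) (t : ℝ) :
    ‖compositeSeries L κ t‖ ≤ ∑' n, coeff L 2 κ n := by
  refine tsum_of_norm_bounded (summable_coeff L 2 hκ).hasSum fun n => ?_
  rw [norm_mul, norm_wave, mul_one, Complex.norm_real, Real.norm_of_nonneg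
    (sub_nonneg.2 (mangoldtCoeff_le L κ n))]
  linarith [mangoldtCoeff_nonneg L κ n]

/-- `ψ` is a bump function with Fourier transform `g`. -/
structure SmoothingKernel (ψ : ℝ → ℝ) (g : ℝ → ℂ) (C : ℝ) : Prop where
  nonneg : ∀ v, 0 ≤ ψ v
  le_one : ∀ v, ψ v ≤ 1
  support : ∀ v, ψ v ≠ 0 → 0 ≤ v ∧ v ≤ 26
  eq_one : ∀ v, 7 ≤ v → v ≤ 18 → ψ v = 1
  lipschitz : ∀ u v, |ψ u - ψ v| ≤ C * |u - v|
  inversion : ∀ v, (ψ v : ℂ) = ∫ t, g t * wave t (-v)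
  continuous_transform : Continuous g
  integrable_transform : Integrable g
  norm_transform_le : ∀ t, ‖g t‖ ≤ C
  decay : ∀ t, |t| ^ 4 * ‖g t‖ ≤ C
  lipschitz_transform : ∀ s t, ‖g s - g t‖ ≤ C * |s - t|

lemma exists_bump : ∃ b : ℝ → ℝ, ContDiff ℝ ∞ b ∧ HasCompactSupport b ∧ (∀ v, 0 ≤ b v) ∧
    (∀ v, b v ≤ 1) ∧ (∀ v, b v ≠ 0 → 0 < v ∧ v < 4) ∧ ∀ v, 1 ≤ v → v ≤ 3 → b v = 1 := by
  let b : ContDiffBump (2 : ℝ) := ⟨1, 2, one_pos, one_lt_two⟩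
  refine ⟨b, b.contDiff, b.hasCompactSupport, fun _ => b.nonneg, fun _ => b.le_one, fun v hv => ?_,
    fun v h1 h2 => b.one_of_mem_closedBall ?_⟩
  · have h1 : v ∈ Metric.ball (2 : ℝ) 2 := by
      rw [← b.support_eq]; exact hv
    rw [Metric.mem_ball, Real.dist_eq, abs_lt] at h1
    constructor <;> linarith
  · rw [Metric.mem_closedBall, Real.dist_eq, abs_le]
    constructor <;> simp only [b] <;> linarith

lemma exists_smoothingKernel : ∃ ψ g C, 1 ≤ C ∧ SmoothingKernel ψ g C := by
  obtain ⟨b, hb, hbs, hb0, hb1, hbsupp, hbone⟩ := exists_bump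
  obtain ⟨g, hg⟩ : ∃ g : SchwartzMap ℝ ℂ,
      ∀ v, (b v : ℂ) = FourierTransformInv.fourierInv (g : ℝ → ℂ) v := by
    have hcs : HasCompactSupport fun v => (b v : ℂ) := hbs.comp_left Complex.ofReal_zero
    have hcd : ContDiff ℝ ∞ fun v => (b v : ℂ) := Complex.ofRealCLM.contDiff.comp hb
    generalize hf : hcs.toSchwartzMap hcd = f
    have hfb (v : ℝ) : f v = b v := by rw [← hf]; rfl
    refine ⟨FourierTransform.fourier f, fun v => ?_⟩
    rw [← SchwartzMap.fourierInv_coe, FourierTransform.fourierInv_fourier_eq, hfb]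
  obtain ⟨K, hK⟩ := hb.lipschitzWith_of_hasCompactSupport hbs (by simp)
  obtain ⟨C₀, -, hC₀⟩ := g.decay 0 0
  obtain ⟨C₁, -, hC₁⟩ := g.decay 0 1
  obtain ⟨C₄, -, hC₄⟩ := g.decay 4 0
  simp only [pow_zero, one_mul, norm_iteratedFDeriv_zero, Real.norm_eq_abs] at hC₀ hC₁ hC₄
  set C := 1 + (K + (|C₀| + (|C₁| + |C₄|))) with hC
  have hK0 : (0 : ℝ) ≤ K := K.2
  have := abs_nonneg C₀; have := abs_nonneg C₁; have := abs_nonneg C₄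
  have := le_abs_self C₀; have := le_abs_self C₁; have := le_abs_self C₄
  refine ⟨fun v => b (v / (2 * π)), g, C, by linarith, fun v => hb0 _, fun v => hb1 _,
    fun v hv => ?_, fun v h1 h2 => hbone _ ?_ ?_, fun u v => ?_, fun v => ?_, g.continuous,
    g.integrable, fun t => (hC₀ t).trans (by linarith), fun t => (hC₄ t).trans (by linarith),
    fun s t => ?_⟩
  · obtain ⟨h2, h3⟩ := hbsupp _ hv
    rw [div_lt_iff₀ (by positivity)] at h3
    rw [lt_div_iff₀ (by positivity)] at h2
    constructor <;> nlinarith [Real.pi_lt_d2]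
  · rw [le_div_iff₀ (by positivity)]; nlinarith [Real.pi_lt_d2]
  · rw [div_le_iff₀ (by positivity)]; nlinarith [Real.pi_gt_three]
  · have h1 := hK.dist_le_mul (u / (2 * π)) (v / (2 * π))
    rw [Real.dist_eq, Real.dist_eq, ← sub_div, abs_div, abs_of_pos (two_pi_pos)] at h1
    have h2 : |u - v| / (2 * π) ≤ |u - v| :=
      div_le_self (abs_nonneg _) (by nlinarith [Real.pi_gt_three])
    refine h1.trans ?_
    have := abs_nonneg (u - v)
    calc (K : ℝ) * (|u - v| / (2 * π)) ≤ K * |u - v| := by gcongr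
      _ ≤ _ := by gcongr; linarith
  · rw [hg, Real.fourierInv_eq']
    refine integral_congr_ae (.of_forall fun t => ?_)
    simp only [smul_eq_mul, wave]
    rw [mul_comm]
    congr 2
    simp
    field_simp
  · have h1 := Convex.norm_image_sub_le_of_norm_deriv_le (f := g) (C := C) (s := Set.univ)
      (fun x _ => g.differentiableAt) (fun x _ => ?_) convex_univ (Set.mem_univ t) (Set.mem_univ s)
    · simpa using h1
    · have h2 := hC₁ x
      rw [norm_iteratedFDeriv_eq_norm_iteratedDeriv, iteratedDeriv_one] at h2
      linarith

/-- The difference of two dilations of `ψ` of the same mass. -/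
noncomputable def dilationDiff (ψ : ℝ → ℝ) (T v : ℝ) : ℝ := T * ψ (T * v) - ψ v

/-- The Fourier transform of `dilationDiff`. -/
noncomputable def transformDiff (g : ℝ → ℂ) (T t : ℝ) : ℂ := g (t / T) - g t

namespace SmoothingKernel

variable {ψ : ℝ → ℝ} {g : ℝ → ℂ} {C T : ℝ}

lemma integrable_transformDiff (h : SmoothingKernel ψ g C) (hT : 0 < T) :
    Integrable (transformDiff g T) :=
  (h.integrable_transform.comp_div hT.ne').sub h.integrable_transform

lemma dilationDiff_eq (h : SmoothingKernel ψ g C) (hT : 0 < T) (v : ℝ) :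
    (dilationDiff ψ T v : ℂ) = ∫ t, transformDiff g T t * wave t (-v) := by
  have h1 : ∫ t, g (t / T) * wave t (-v) = T * ψ (T * v) := by
    have h2 := Measure.integral_comp_div (fun s => g s * wave s (-(T * v))) T
    rw [← h.inversion, abs_of_pos hT] at h2
    rw [← Complex.real_smul, ← h2]
    congr 1 with t
    simp only [wave]
    push_cast
    have hT' : (T : ℂ) ≠ 0 := by exact_mod_cast hT.ne'
    congr 2
    field_simp
  have h3 {f : ℝ → ℂ} (hf : Integrable f) : Integrable fun t => f t * wave t (-v) := by
    simp_rw [wave_comm _ (-v)]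
    exact integrable_mul_wave hf _
  simp only [dilationDiff, transformDiff, sub_mul]
  rw [integral_sub (h3 (h.integrable_transform.comp_div hT.ne')) (h3 h.integrable_transform), h1,
    ← h.inversion]
  push_cast; rfl

lemma tsum_mul_dilationDiff (h : SmoothingKernel ψ g C) (hT : 0 < T) {a : ℕ → ℝ} (ha : Summable a)
    (X : ℝ) : ((∑' n, a n * dilationDiff ψ T (X - log n) : ℝ) : ℂ) =
      ∫ t, transformDiff g T t * wave t (-X) * ∑' n, (a n : ℂ) * wave t (log n) := by
  have hG := h.integrable_transformDiff hT
  set F : ℕ → ℝ → ℂ := fun n t => a n * (transformDiff g T t * wave t (log n - X)) with hF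
  have hI (n : ℕ) : Integrable fun t => transformDiff g T t * wave t (log n - X) := by
    simp_rw [wave_comm _ (log _ - X)]
    exact integrable_mul_wave hG _
  have hsum : Summable fun n => ∫ t, ‖F n t‖ := by
    simp only [hF, norm_mul, norm_wave, mul_one, Complex.norm_real, integral_const_mul]
    exact ha.norm.mul_right _
  have hs := hasSum_integral_of_summable_integral_norm (fun n => (hI n).const_mul (a n : ℂ)) hsum
  rw [Complex.ofReal_tsum, ← tsum_congr fun n => ?_, hs.tsum_eq]
  · congr 1 with t
    rw [← tsum_mul_left]
    refine tsum_congr fun n => ?_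
    rw [sub_eq_add_neg, wave_add]
    ring
  · rw [integral_const_mul, Complex.ofReal_mul, h.dilationDiff_eq hT]
    simp

lemma norm_transformDiff_le (h : SmoothingKernel ψ g C) (t : ℝ) :
    ‖transformDiff g T t‖ ≤ 2 * C := by
  have h1 := norm_sub_le (g (t / T)) (g t)
  rw [transformDiff]
  linarith [h.norm_transform_le (t / T), h.norm_transform_le t]

lemma norm_transformDiff_le_abs (h : SmoothingKernel ψ g C) (hC : 0 ≤ C) (hT : 1 ≤ T) (t : ℝ) :
    ‖transformDiff g T t‖ ≤ C * |t| := by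
  refine (h.lipschitz_transform _ _).trans (mul_le_mul_of_nonneg_left ?_ hC)
  have h1 : t / T - t = -(t * (1 - 1 / T)) := by ring
  have h2 : 1 / T ≤ 1 := by rw [div_le_one (by linarith)]; exact hT
  have h3 : 0 < 1 / T := by positivity
  rw [h1, abs_neg, abs_mul, abs_of_nonneg (show 0 ≤ 1 - 1 / T by linarith)]
  exact mul_le_of_le_one_right (abs_nonneg _) (by linarith)

lemma norm_transformDiff_tail_le (h : SmoothingKernel ψ g C) (hC : 0 ≤ C) (hT : 2 ≤ T ^ 4)
    (hT1 : 1 ≤ T) {t : ℝ} (ht : T ^ 4 / 2 ≤ |t|) :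
    ‖transformDiff g T t‖ ≤ 16 * C / T ^ 4 * (1 + t ^ 2)⁻¹ := by
  have ht1 : 1 ≤ |t| := by linarith
  have ht0 : 0 < |t| := by linarith
  have hT0 : 0 < T := by linarith
  have h1 : ‖g (t / T)‖ ≤ C * T ^ 4 / |t| ^ 4 := by
    have := h.decay (t / T)
    rw [abs_div, abs_of_pos hT0, div_pow] at this
    rw [le_div_iff₀ (by positivity)]
    rw [div_mul_eq_mul_div, div_le_iff₀ (by positivity)] at this
    linarith
  have h2 : ‖g t‖ ≤ C * T ^ 4 / |t| ^ 4 := by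
    have := h.decay t
    rw [le_div_iff₀ (by positivity)]
    have : C * 1 ≤ C * T ^ 4 := by gcongr; linarith
    linarith
  have h3 : (T ^ 4) ^ 2 / 4 ≤ |t| ^ 2 := by
    have := pow_le_pow_left₀ (by positivity) ht 2
    rw [div_pow] at this
    linarith
  have h4 : 1 + t ^ 2 ≤ 2 * |t| ^ 2 := by
    rw [← sq_abs t]; linarith [one_le_pow₀ ht1 (n := 2)]
  refine (norm_sub_le _ _).trans ((add_le_add h1 h2).trans ?_)
  rw [← div_eq_mul_inv, div_div, ← add_div, div_le_div_iff₀ (by positivity) (by positivity)]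
  have h5 : (1 + t ^ 2) * (T ^ 4) ^ 2 ≤ 2 * |t| ^ 2 * (4 * |t| ^ 2) := by gcongr; linarith
  calc (C * T ^ 4 + C * T ^ 4) * (T ^ 4 * (1 + t ^ 2)) = 2 * C * ((1 + t ^ 2) * (T ^ 4) ^ 2) := by
        ring
    _ ≤ 2 * C * (2 * |t| ^ 2 * (4 * |t| ^ 2)) := by gcongr
    _ = _ := by ring

lemma abs_tsum_composite_mul_le (h : SmoothingKernel ψ g C) (hC : 1 ≤ C) : ∃ C' ε L₀ : ℝ, 0 < C' ∧
    0 < ε ∧ ε ≤ 1 ∧ 1 ≤ L₀ ∧ ∀ L, L₀ ≤ L → ∀ κ, Admissible L κ → κ ≤ ε / L → ∀ X,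
      |∑' n, (coeff L 2 κ n - mangoldtCoeff L κ n) * dilationDiff ψ (exp (L / 16)) (X - log n)| ≤
        C' * (L + (1 / (L * κ)) ^ 3) := by
  obtain ⟨C₁, ε, L₀, hC₁, hε, hε1, hL₀, h1⟩ := integral_norm_compositeSeries_le
  obtain ⟨C₂, L₂, hC₂, hL₂, h2⟩ := tsum_coeff_le
  refine ⟨2 * C * C₁ + 2 * (C * C₂) + 16 * C * C₂ * π * 32, ε, max 16 (max L₀ L₂), by positivity,
    hε, hε1, le_max_of_le_left (by norm_num), fun L hL κ hκ hκε X => ?_⟩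
  have hL16 : 16 ≤ L := (le_max_left _ _).trans hL
  have hL0 : 0 < L := by linarith
  set T := exp (L / 16) with hT
  have hT1 : 2 ≤ T := by linarith [add_one_le_exp (L / 16)]
  have hT4 : T ^ 4 = exp (L / 4) := by rw [hT, ← exp_nat_mul]; congr 1; push_cast; ring
  have hT42 : 2 ≤ T ^ 4 := by
    linarith [pow_le_pow_left₀ (by norm_num) hT1 4]
  set B := C₂ * (1 / (L * κ)) ^ 3 * L ^ 2 with hB
  have hκ0 := hκ.1
  have hB0 : 0 ≤ B := by positivity
  have hN (t : ℝ) : ‖compositeSeries L κ t‖ ≤ B :=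
    (norm_compositeSeries_le L hκ0 t).trans
      (h2 L ((le_max_right _ _).trans ((le_max_right _ _).trans hL)) κ hκ)
  have hI := h1 L ((le_max_left _ _).trans ((le_max_right _ _).trans hL)) κ hκ hκε
  set f₁ : ℝ → ℝ := (band (1 / L) (exp (L / 4) / 2)).indicator
    fun t => 2 * C * ‖compositeSeries L κ t‖ with hf₁
  set f₂ : ℝ → ℝ := (Set.Icc (-(1 / L)) (1 / L)).indicator fun _ => C * (1 / L) * B with hf₂
  set f₃ : ℝ → ℝ := fun t => 16 * C / T ^ 4 * B * (1 + t ^ 2)⁻¹ with hf₃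
  have hf₁0 (t : ℝ) : 0 ≤ f₁ t := Set.indicator_nonneg (fun t _ => by positivity) t
  have hf₂0 (t : ℝ) : 0 ≤ f₂ t := Set.indicator_nonneg (fun t _ => by positivity) t
  have hf₃0 (t : ℝ) : 0 ≤ f₃ t := by positivity
  have hi₁ : Integrable f₁ := (integrable_indicator_iff (measurableSet_band _ _)).2
    (integrableOn_band (continuous_const.mul (continuous_compositeSeries L hκ0).norm) _ _)
  have hi₂ : Integrable f₂ := (integrable_indicator_iff measurableSet_Icc).2
    (continuous_const.integrableOn_Icc)
  have hi₃ : Integrable f₃ := integrable_inv_one_add_sq.const_mul _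
  have hpt (t : ℝ) : ‖transformDiff g T t * wave t (-X) * compositeSeries L κ t‖ ≤
      f₁ t + f₂ t + f₃ t := by
    rw [norm_mul, norm_mul, norm_wave, mul_one]
    rcases le_or_gt |t| (1 / L) with ht | ht
    · have h3 : f₂ t = C * (1 / L) * B := Set.indicator_of_mem (Set.mem_Icc.2 (abs_le.1 ht)) _
      have h4 : ‖transformDiff g T t‖ ≤ C * (1 / L) :=
        (h.norm_transformDiff_le_abs (by linarith) (by linarith) t).trans (by gcongr)
      have := mul_le_mul h4 (hN t) (norm_nonneg _) (by positivity)
      linarith [hf₁0 t, hf₃0 t]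
    · rcases le_or_gt |t| (exp (L / 4) / 2) with ht2 | ht2
      · have h3 : f₁ t = 2 * C * ‖compositeSeries L κ t‖ := Set.indicator_of_mem
          (show t ∈ band (1 / L) (exp (L / 4) / 2) from ⟨ht, ht2⟩) _
        have := mul_le_mul_of_nonneg_right (h.norm_transformDiff_le (T := T) t)
          (norm_nonneg (compositeSeries L κ t))
        linarith [hf₂0 t, hf₃0 t]
      · have h3 := h.norm_transformDiff_tail_le (by linarith) hT42 (by linarith)
          (by rw [hT4]; exact ht2.le)
        have h4 := mul_le_mul h3 (hN t) (norm_nonneg _) (by positivity)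
        have h5 : f₃ t = 16 * C / T ^ 4 * (1 + t ^ 2)⁻¹ * B := by rw [hf₃]; ring
        linarith [hf₁0 t, hf₂0 t]
  have hintg := norm_integral_le_of_norm_le ((hi₁.add hi₂).add hi₃) (.of_forall hpt)
  have h12 : Integrable fun t => f₁ t + f₂ t := hi₁.add hi₂
  have heq := h.tsum_mul_dilationDiff (T := T) (by linarith) (summable_compositeCoeff L hκ0) X
  rw [← Real.norm_eq_abs, ← Complex.norm_real, heq]
  refine hintg.trans ?_
  simp only [Pi.add_apply]
  have i₃ : ∫ t, f₃ t = 16 * C / T ^ 4 * B * π := by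
    rw [hf₃, integral_const_mul, integral_univ_inv_one_add_sq]
  rw [integral_add h12 hi₃, integral_add hi₁ hi₂, i₃, hf₁, hf₂,
    integral_indicator (measurableSet_band _ _), integral_indicator measurableSet_Icc,
    integral_const_mul, setIntegral_const]
  have hvol : volume.real (Set.Icc (-(1 / L)) (1 / L)) = 2 / L := by
    rw [Real.volume_real_Icc_of_le (by linarith [show 0 < 1 / L by positivity])]; ring
  rw [hvol, smul_eq_mul]
  have e1 : 2 / L * (C * (1 / L) * B) = 2 * (C * C₂) * (1 / (L * κ)) ^ 3 := by
    rw [hB]; field_simp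
  have e2 : L ^ 2 ≤ 32 * T ^ 4 := by
    have := quadratic_le_exp_of_nonneg (x := L / 4) (by positivity)
    rw [hT4]; nlinarith
  have e3 : 16 * C / T ^ 4 * B * π ≤ 16 * C * C₂ * π * 32 * (1 / (L * κ)) ^ 3 := by
    have : 16 * C / T ^ 4 * B * π = 16 * C * C₂ * π * (1 / (L * κ)) ^ 3 * (L ^ 2 / T ^ 4) := by
      rw [hB]; ring
    rw [this]
    have e4 : L ^ 2 / T ^ 4 ≤ 32 := by rwa [div_le_iff₀ (by positivity)]
    calc _ ≤ 16 * C * C₂ * π * (1 / (L * κ)) ^ 3 * 32 := by gcongr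
      _ = _ := by ring
  have e5 : 2 * C * (∫ t in band (1 / L) (exp (L / 4) / 2), ‖compositeSeries L κ t‖) ≤
      2 * C * C₁ * L := by
    rw [mul_assoc _ C₁]; gcongr
  rw [e1]
  have p1 : 0 ≤ 2 * C * C₁ * (1 / (L * κ)) ^ 3 := by positivity
  have p2 : 0 ≤ (2 * (C * C₂) + 16 * C * C₂ * π * 32) * L := by positivity
  linarith

end SmoothingKernel

lemma abs_tsum_coeff_sub_integral_le (L : ℝ) (j : ℕ) {κ τ M Λ : ℝ} {D : ℝ → ℝ} (hκ : 0 < κ)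
    (hτ : 0 < τ) (hΛ : 0 ≤ Λ) (hD : Continuous D) (hM : ∀ v, |D v| ≤ M)
    (hLip : ∀ u v, |D u - D v| ≤ Λ * |u - v|) (X : ℝ) :
    |∑' n, coeff L j κ n * D (X - log n) - ∫ u, D (X - u) * (τ⁻¹ * blockSum L j κ τ u)| ≤
      Λ * τ * ∑' n, coeff L j κ n := by
  have hM0 : 0 ≤ M := (abs_nonneg _).trans (hM 0)
  have hDX : Continuous fun u => D (X - u) := by fun_prop
  set I : ℕ → Set ℝ := fun n => Set.Ico (log n) (log n + τ) with hI
  have hvol (n : ℕ) : volume.real (I n) = τ := by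
    rw [hI, Real.volume_real_Ico_of_le (by linarith)]; ring
  have hvol' (n : ℕ) : volume (I n) < ⊤ := by simp [hI]
  have hIm (n : ℕ) : MeasurableSet (I n) := measurableSet_Ico
  have hDI (n : ℕ) : IntegrableOn (fun u => D (X - u)) (I n) :=
    hDX.integrableOn_Icc.mono_set Set.Ico_subset_Icc_self
  set F : ℕ → ℝ → ℝ := fun n => (I n).indicator fun u => τ⁻¹ * coeff L j κ n * D (X - u) with hF
  have hFi (n : ℕ) : Integrable (F n) :=
    (integrable_indicator_iff (hIm n)).2 ((hDI n).const_mul _)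
  have hsum : Summable fun n => ∫ u, ‖F n u‖ := by
    refine ((summable_coeff L j hκ).mul_right M).of_nonneg_of_le
      (fun n => integral_nonneg fun u => norm_nonneg _) fun n => ?_
    have h1 (u : ℝ) : ‖F n u‖ = (I n).indicator (fun u => ‖τ⁻¹ * coeff L j κ n * D (X - u)‖) u :=
      norm_indicator_eq_indicator_norm _ _
    simp_rw [h1]
    rw [integral_indicator (hIm n)]
    have h2 := norm_setIntegral_le_of_norm_le_const (μ := volume) (s := I n)
      (C := τ⁻¹ * coeff L j κ n * M) (f := fun u => ‖τ⁻¹ * coeff L j κ n * D (X - u)‖) (hvol' n)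
      fun u _ => by
        have := coeff_nonneg L j κ n
        rw [norm_norm, norm_mul, Real.norm_of_nonneg (by positivity), Real.norm_eq_abs]
        gcongr
        exact hM _
    rw [hvol] at h2
    refine (le_norm_self _).trans (h2.trans_eq ?_)
    field_simp
  have hs := hasSum_integral_of_summable_integral_norm hFi hsum
  have hval (u : ℝ) : ∑' n, F n u = D (X - u) * (τ⁻¹ * blockSum L j κ τ u) := by
    rw [← (((hasSum_blockSum (L := L) j κ τ u).mul_left τ⁻¹).mul_left (D (X - u))).tsum_eq]
    refine tsum_congr fun n => ?_
    by_cases hu : u ∈ Set.Ico (log n) (log n + τ)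
    · simp only [hF, hI, Set.indicator_of_mem hu]; ring
    · simp only [hF, hI, Set.indicator_of_notMem hu]; ring
  simp_rw [hval] at hs
  have hterm (n : ℕ) : |coeff L j κ n * D (X - log n) - ∫ u, F n u| ≤
      Λ * τ * coeff L j κ n := by
    have h1 : ∫ u, F n u = τ⁻¹ * coeff L j κ n * ∫ u in I n, D (X - u) := by
      rw [hF, integral_indicator (hIm n), integral_const_mul]
    have h2 : coeff L j κ n * D (X - log n) =
        τ⁻¹ * coeff L j κ n * ∫ u in I n, D (X - log n) := by
      rw [setIntegral_const, hvol, smul_eq_mul]; field_simp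
    have h3 : ‖∫ u in I n, (D (X - log n) - D (X - u))‖ ≤ Λ * τ * volume.real (I n) := by
      refine norm_setIntegral_le_of_norm_le_const (hvol' n) fun u hu => ?_
      refine (hLip _ _).trans (mul_le_mul_of_nonneg_left ?_ hΛ)
      rw [abs_le]
      constructor <;> linarith [hu.1, hu.2]
    rw [integral_sub (by simp [hI]) (hDI n), hvol, Real.norm_eq_abs] at h3
    have hc := coeff_nonneg L j κ n
    rw [h1, h2, ← mul_sub, abs_mul, abs_of_nonneg (show 0 ≤ τ⁻¹ * coeff L j κ n by positivity)]
    calc _ ≤ τ⁻¹ * coeff L j κ n * (Λ * τ * τ) := by gcongr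
      _ = _ := by field_simp
  have hsc := (summable_coeff L j hκ).mul_left (Λ * τ)
  have hsd : Summable fun n => coeff L j κ n * D (X - log n) - ∫ u, F n u :=
    Summable.of_norm_bounded hsc hterm
  have hsD : Summable fun n => coeff L j κ n * D (X - log n) :=
    (hsd.add hs.summable).congr fun n => by ring
  rw [← hs.tsum_eq, ← hsD.tsum_sub hs.summable, ← tsum_mul_left]
  exact tsum_of_norm_bounded (f := fun n => coeff L j κ n * D (X - log n) - ∫ u, F n u)
    hsc.hasSum hterm

lemma abs_model_two_sub_le {X w δ : ℝ} (hw : 0 < w) (hwX : w ≤ X) (hδ : X - δ ≤ w) :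
    |model 2 (1 / X) w - model 2 (1 / X) X| ≤ 3 * δ * X := by
  have hX : 0 < X := hw.trans_le hwX
  rw [model, model, if_pos hw, if_pos hX]
  set a := exp (-(1 / X * w)) with ha
  set b := exp (-(1 / X * X)) with hb
  have ha0 : 0 < a := exp_pos _
  have ha1 : a ≤ 1 := exp_le_one_iff.2 (by have : 0 ≤ 1 / X * w := by positivity
                                           linarith)
  have hba : b ≤ a := exp_le_exp.2 (by gcongr)
  have hab : X * (a - b) ≤ X - w := by
    have h1 : b = a * exp (-(1 / X * (X - w))) := by rw [ha, hb, ← exp_add]; ring_nf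
    have h2 := add_one_le_exp (-(1 / X * (X - w)))
    have h3 : X * (1 / X * (X - w)) = X - w := by field_simp
    have h4 : a - b ≤ 1 / X * (X - w) := by
      rw [h1]
      have : 0 ≤ 1 / X * (X - w) := mul_nonneg (by positivity) (by linarith)
      nlinarith
    calc X * (a - b) ≤ X * (1 / X * (X - w)) := by gcongr
      _ = _ := h3
  have h1 : w ^ 2 * a - X ^ 2 * b = X * (X * (a - b)) - (X - w) * (X + w) * a := by ring
  have h2 : 0 ≤ X * (a - b) := mul_nonneg hX.le (by linarith)
  have h3 : 0 ≤ (X - w) * (X + w) * a :=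
    mul_nonneg (mul_nonneg (by linarith) (by linarith)) ha0.le
  have h4 : (X - w) * (X + w) * a ≤ δ * (2 * X) * 1 := by
    gcongr <;> nlinarith
  have h5 : X * (X * (a - b)) ≤ X * δ := by gcongr; linarith
  rw [h1, abs_le]
  constructor <;> nlinarith

lemma abs_window_model_two_sub_le {X u τ δ : ℝ} (hτ : 0 < τ) (hu : τ < u) (huX : u ≤ X)
    (hδ : X - δ ≤ u - τ) :
    |τ⁻¹ * (∫ v in (u - τ)..u, model 2 (1 / X) v) - model 2 (1 / X) X| ≤ 3 * δ * X := by
  have hX : 0 < X := by linarith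
  have h1 := intervalIntegral.norm_integral_le_of_norm_le_const (a := u - τ) (b := u)
    (f := fun v => model 2 (1 / X) v - model 2 (1 / X) X) (C := 3 * δ * X) fun v hv => by
      rw [Set.uIoc_of_le (by linarith)] at hv
      exact abs_model_two_sub_le (by linarith [hv.1]) (hv.2.trans huX) (by linarith [hv.1])
  rw [intervalIntegral.integral_sub
    (integrable_model 2 (show 0 < 1 / X by positivity)).intervalIntegrable (by simp),
    intervalIntegral.integral_const, smul_eq_mul, sub_sub_cancel, abs_of_pos hτ,
    Real.norm_eq_abs] at h1
  have h2 : τ⁻¹ * (∫ v in (u - τ)..u, model 2 (1 / X) v) - model 2 (1 / X) X =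
      τ⁻¹ * ((∫ v in (u - τ)..u, model 2 (1 / X) v) - τ * model 2 (1 / X) X) := by field_simp
  rw [h2, abs_mul, abs_of_pos (inv_pos.2 hτ), inv_mul_le_iff₀ hτ]
  linarith

namespace SmoothingKernel

variable {ψ : ℝ → ℝ} {g : ℝ → ℂ} {C T : ℝ}

lemma continuous (h : SmoothingKernel ψ g C) (hC : 0 ≤ C) : Continuous ψ :=
  (LipschitzWith.of_dist_le_mul (K := ⟨C, hC⟩) fun u v => h.lipschitz u v).continuous

lemma le_indicator (h : SmoothingKernel ψ g C) (v : ℝ) :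
    ψ v ≤ (Set.Icc (0 : ℝ) 26).indicator (fun _ => 1) v := by
  by_cases hv : v ∈ Set.Icc (0 : ℝ) 26
  · rw [Set.indicator_of_mem hv]; exact h.le_one v
  · rw [Set.indicator_of_notMem hv]
    by_contra! h1
    exact hv (h.support v h1.ne')

lemma integrable_indicator_Icc : Integrable ((Set.Icc (0 : ℝ) 26).indicator fun _ => (1 : ℝ)) :=
  (integrable_indicator_iff measurableSet_Icc).2 continuous_const.integrableOn_Icc

lemma integrable (h : SmoothingKernel ψ g C) (hC : 0 ≤ C) : Integrable ψ :=
  integrable_indicator_Icc.mono' (h.continuous hC).aestronglyMeasurable (.of_forall fun v => by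
    rw [Real.norm_of_nonneg (h.nonneg v)]; exact h.le_indicator v)

lemma integral_le (h : SmoothingKernel ψ g C) (hC : 0 ≤ C) : ∫ v, ψ v ≤ 26 := by
  refine (integral_mono (h.integrable hC) integrable_indicator_Icc h.le_indicator).trans_eq ?_
  rw [integral_indicator measurableSet_Icc, setIntegral_const, Real.volume_real_Icc_of_le
    (by norm_num)]
  norm_num

lemma integrable_dilation (h : SmoothingKernel ψ g C) (hC : 0 ≤ C) (hT : 0 < T) :
    Integrable fun v => T * ψ (T * v) :=
  ((h.integrable hC).comp_mul_left' hT.ne').const_mul T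

lemma integral_dilation (hT : 0 < T) : ∫ v, T * ψ (T * v) = ∫ v, ψ v := by
  rw [integral_const_mul, Measure.integral_comp_mul_left, abs_of_pos (inv_pos.2 hT), smul_eq_mul,
    mul_inv_cancel_left₀ hT.ne']

lemma integral_dilationDiff (h : SmoothingKernel ψ g C) (hC : 0 ≤ C) (hT : 0 < T) :
    ∫ v, dilationDiff ψ T v = 0 := by
  simp only [dilationDiff]
  rw [integral_sub (h.integrable_dilation hC hT) (h.integrable hC), integral_dilation hT, sub_self]

lemma integrable_dilationDiff (h : SmoothingKernel ψ g C) (hC : 0 ≤ C) (hT : 0 < T) :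
    Integrable (dilationDiff ψ T) :=
  (h.integrable_dilation hC hT).sub (h.integrable hC)

lemma integral_abs_dilationDiff_le (h : SmoothingKernel ψ g C) (hC : 0 ≤ C) (hT : 0 < T) :
    ∫ v, |dilationDiff ψ T v| ≤ 52 := by
  refine (integral_mono (h.integrable_dilationDiff hC hT).abs
    ((h.integrable_dilation hC hT).add (h.integrable hC)) fun v => ?_).trans ?_
  · have h1 : 0 ≤ T * ψ (T * v) := mul_nonneg hT.le (h.nonneg _)
    have h2 := h.nonneg v
    simp only [dilationDiff, Pi.add_apply]
    rw [abs_le]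
    constructor <;> linarith
  · simp only [Pi.add_apply]
    rw [integral_add (h.integrable_dilation hC hT) (h.integrable hC), integral_dilation hT]
    linarith [h.integral_le hC]

lemma continuous_dilationDiff (h : SmoothingKernel ψ g C) (hC : 0 ≤ C) :
    Continuous (dilationDiff ψ T) := by
  have := h.continuous hC
  unfold dilationDiff
  fun_prop

lemma dilationDiff_support (h : SmoothingKernel ψ g C) (hT : 1 ≤ T) {v : ℝ}
    (hv : dilationDiff ψ T v ≠ 0) : 0 ≤ v ∧ v ≤ 26 := by
  by_cases h1 : ψ v = 0
  · have h2 : ψ (T * v) ≠ 0 := fun h2 => hv (by simp [dilationDiff, h1, h2])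
    obtain ⟨h3, h4⟩ := h.support _ h2
    have h5 : 0 ≤ v := nonneg_of_mul_nonneg_right h3 (by linarith)
    exact ⟨h5, by nlinarith⟩
  · exact h.support _ h1

lemma abs_dilationDiff_le (h : SmoothingKernel ψ g C) (hT : 0 ≤ T) (v : ℝ) :
    |dilationDiff ψ T v| ≤ T + 1 := by
  have h1 : 0 ≤ T * ψ (T * v) := mul_nonneg hT (h.nonneg _)
  have h2 : T * ψ (T * v) ≤ T * 1 := mul_le_mul_of_nonneg_left (h.le_one _) hT
  rw [dilationDiff, abs_le]
  constructor <;> linarith [h.nonneg v, h.le_one v]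

lemma dilationDiff_lipschitz (h : SmoothingKernel ψ g C) (hC : 0 ≤ C) (hT : 1 ≤ T) (u v : ℝ) :
    |dilationDiff ψ T u - dilationDiff ψ T v| ≤ 2 * C * T ^ 2 * |u - v| := by
  have hT0 : 0 ≤ T := by linarith
  have h1 : dilationDiff ψ T u - dilationDiff ψ T v =
      T * (ψ (T * u) - ψ (T * v)) - (ψ u - ψ v) := by simp only [dilationDiff]; ring
  have h2 := h.lipschitz (T * u) (T * v)
  rw [← mul_sub, abs_mul, abs_of_nonneg hT0] at h2
  have h3 := abs_sub (T * (ψ (T * u) - ψ (T * v))) (ψ u - ψ v)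
  rw [abs_mul, abs_of_nonneg hT0] at h3
  have h4 : C * |u - v| ≤ C * T ^ 2 * |u - v| := by
    have : C * 1 ≤ C * T ^ 2 := by gcongr; exact one_le_pow₀ hT
    nlinarith [abs_nonneg (u - v)]
  have h5 : T * |ψ (T * u) - ψ (T * v)| ≤ T * (C * (T * |u - v|)) := by gcongr
  rw [h1]
  linarith [h.lipschitz u v, show T * (C * (T * |u - v|)) = C * T ^ 2 * |u - v| by ring]

lemma abs_integral_dilationDiff_mul_le (h : SmoothingKernel ψ g C) (hC : 0 ≤ C) (hT : 1 ≤ T)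
    {H : ℝ → ℝ} (hH : Measurable H) {X c E : ℝ}
    (hE : ∀ u, X - 26 ≤ u → u ≤ X → |H u - c| ≤ E) :
    |∫ u, dilationDiff ψ T (X - u) * H u| ≤ 52 * E := by
  have hT0 : 0 < T := by linarith
  have hE0 : 0 ≤ E := (abs_nonneg _).trans (hE X (by linarith) le_rfl)
  have hDX : Integrable fun u => dilationDiff ψ T (X - u) :=
    (h.integrable_dilationDiff hC hT0).comp_sub_left X
  have hpt (u : ℝ) : ‖dilationDiff ψ T (X - u) * (H u - c)‖ ≤ E * |dilationDiff ψ T (X - u)| := by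
    by_cases h0 : dilationDiff ψ T (X - u) = 0
    · simp [h0]
    · obtain ⟨h1, h2⟩ := h.dilationDiff_support hT h0
      rw [norm_mul, mul_comm]
      exact mul_le_mul_of_nonneg_right (hE u (by linarith) (by linarith)) (abs_nonneg _)
  have hintg : Integrable fun u => dilationDiff ψ T (X - u) * (H u - c) :=
    (hDX.abs.const_mul E).mono' (hDX.aestronglyMeasurable.mul
      (hH.sub_const c).aestronglyMeasurable) (.of_forall hpt)
  have h1 : ∫ u, dilationDiff ψ T (X - u) * H u =
      (∫ u, dilationDiff ψ T (X - u) * (H u - c)) + ∫ u, dilationDiff ψ T (X - u) * c := by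
    rw [← integral_add hintg (hDX.mul_const c)]
    congr 1 with u
    ring
  rw [h1, integral_mul_const, integral_sub_left_eq_self (dilationDiff ψ T) volume X,
    h.integral_dilationDiff hC hT0, zero_mul, add_zero]
  refine (norm_integral_le_of_norm_le (hDX.abs.const_mul E) (.of_forall hpt)).trans ?_
  rw [integral_const_mul, integral_sub_left_eq_self (fun v => |dilationDiff ψ T v|) volume X]
  have := h.integral_abs_dilationDiff_le hC hT0
  nlinarith

lemma abs_tsum_coeff_mul_le (h : SmoothingKernel ψ g C) (hC : 1 ≤ C) : ∃ C' L₀ : ℝ, 0 < C' ∧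
    1 ≤ L₀ ∧ ∀ L, L₀ ≤ L → ∀ A, 1 ≤ A → Admissible L (1 / (A * L)) →
      |∑' n, coeff L 2 (1 / (A * L)) n * dilationDiff ψ (exp (L / 16)) (A * L - log n)| ≤
        C' * (L + A ^ 3) := by
  obtain ⟨C₁, L₁, hC₁, hL₁, h1⟩ := abs_discrepancy_le_model 2
  obtain ⟨C₂, L₂, hC₂, hL₂, h2⟩ := tsum_coeff_le
  refine ⟨256 * C * C₂ + 52 * (6 * C₁ + (4 * C₁ + 81)), max 28 (max L₁ L₂), by positivity,
    le_max_of_le_left (by norm_num), fun L hL A hA hadm => ?_⟩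
  have hL28 : 28 ≤ L := (le_max_left _ _).trans hL
  have hL0 : 0 < L := by linarith
  have hA0 : 0 < A := by linarith
  set X := A * L with hX
  have hLX : L ≤ X := le_mul_of_one_le_left hL0.le hA
  have hX0 : 0 < X := by positivity
  set T := exp (L / 16) with hT
  set τ := exp (-L / 4) with hτ
  have hT1 : 1 ≤ T := one_le_exp (by positivity)
  have hτ0 : 0 < τ := exp_pos _
  have hτ1 : τ ≤ 1 := exp_le_one_iff.2 (by linarith)
  have hLκ : 1 / (L * (1 / X)) = A := by rw [hX]; field_simp
  have hS := h2 L ((le_max_right _ _).trans ((le_max_right _ _).trans hL)) _ hadm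
  rw [hLκ] at hS
  have hlin := abs_tsum_coeff_sub_integral_le L 2 hadm.1 hτ0
    (show 0 ≤ 2 * C * T ^ 2 by positivity) (h.continuous_dilationDiff (by linarith))
    (h.abs_dilationDiff_le (by linarith)) (h.dilationDiff_lipschitz (by linarith) hT1) X
  have hfirst : 2 * C * T ^ 2 * τ * ∑' n, coeff L 2 (1 / X) n ≤ 256 * C * C₂ * A ^ 3 := by
    have e1 : T ^ 2 * τ * L ^ 2 ≤ 128 := by
      have e2 : T ^ 2 * τ = (exp (L / 8))⁻¹ := by
        rw [hT, hτ, ← exp_nat_mul, ← exp_add, ← exp_neg]; congr 1; push_cast; ring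
      have e3 := quadratic_le_exp_of_nonneg (x := L / 8) (by positivity)
      rw [e2, inv_mul_le_iff₀ (exp_pos _)]
      nlinarith
    calc _ ≤ 2 * C * T ^ 2 * τ * (C₂ * A ^ 3 * L ^ 2) := by gcongr
      _ = 2 * C * C₂ * A ^ 3 * (T ^ 2 * τ * L ^ 2) := by ring
      _ ≤ 2 * C * C₂ * A ^ 3 * 128 := by gcongr
      _ = _ := by ring
  have hsecond : ∀ u, X - 26 ≤ u → u ≤ X →
      |τ⁻¹ * blockSum L 2 (1 / X) τ u - roughDensity L * model 2 (1 / X) X| ≤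
        6 * C₁ * L + (4 * C₁ + 81) * A ^ 2 := by
    intro u hu1 hu2
    have hu0 : 0 < u := by linarith
    have e1 : τ⁻¹ * blockSum L 2 (1 / X) τ u - roughDensity L * model 2 (1 / X) X =
        discrepancy L 2 (1 / X) τ u + roughDensity L *
          (τ⁻¹ * (∫ v in (u - τ)..u, model 2 (1 / X) v) - model 2 (1 / X) X) := by
      rw [discrepancy]; ring
    have e2 := h1 L ((le_max_left _ _).trans ((le_max_right _ _).trans hL)) (1 / X) hadm.1
      hadm.2.1 u
    have e3 := abs_window_model_two_sub_le (δ := 27) hτ0 (by linarith) hu2 (by linarith)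
    have e4 : model 2 (1 / L) u ≤ 6 * L ^ 2 := by
      rw [model, if_pos hu0]
      have i1 : exp (-(1 / L * u)) ≤ 3 * exp (-A) := by
        have : -(1 / L * u) ≤ 1 + -A := by
          have i2 : L * (1 / L * u) = u := by field_simp
          have i3 : L * (1 / L * u) ≥ L * (A - 1) := by rw [i2]; linarith [hX]
          linarith [le_of_mul_le_mul_left i3 hL0]
        refine (exp_le_exp.2 this).trans ?_
        rw [exp_add]
        gcongr
        linarith [exp_one_lt_d9]
      have i4 : A ^ 2 * exp (-A) ≤ 2 := by
        rw [exp_neg, mul_inv_le_iff₀ (exp_pos _)]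
        linarith [quadratic_le_exp_of_nonneg hA0.le]
      calc u ^ 2 * exp (-(1 / L * u)) ≤ X ^ 2 * (3 * exp (-A)) := by gcongr
        _ = 3 * L ^ 2 * (A ^ 2 * exp (-A)) := by rw [hX]; ring
        _ ≤ 3 * L ^ 2 * 2 := by gcongr
        _ = _ := by ring
    have e5 : τ * model 2 (1 / X) u ≤ 4 * A ^ 2 * L := by
      have i1 : L * τ ≤ 4 := by
        have := add_one_le_exp (L / 4)
        rw [hτ, neg_div, exp_neg, mul_inv_le_iff₀ (exp_pos _)]
        linarith
      calc τ * model 2 (1 / X) u ≤ τ * X ^ 2 := by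
            gcongr; exact model_le hadm.1.le hX0.le hu2
        _ = A ^ 2 * L * (L * τ) := by rw [hX]; ring
        _ ≤ A ^ 2 * L * 4 := by gcongr
        _ = _ := by ring
    have e6 : |discrepancy L 2 (1 / X) τ u| ≤ C₁ * (6 * L + 4 * A ^ 2) := by
      refine e2.trans ?_
      calc _ ≤ C₁ * (1 / L) * (6 * L ^ 2 + 4 * A ^ 2 * L) := by gcongr
        _ = _ := by field_simp
    have e7 : |roughDensity L *
        (τ⁻¹ * (∫ v in (u - τ)..u, model 2 (1 / X) v) - model 2 (1 / X) X)| ≤ 81 * A ^ 2 := by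
      rw [abs_mul, abs_of_pos (roughDensity_pos L)]
      calc _ ≤ 1 / L * (3 * 27 * X) := by
            gcongr
            exact roughDensity_le hL0
        _ = 81 * A := by rw [hX]; field_simp; ring
        _ ≤ _ := by nlinarith
    rw [e1]
    refine (abs_add_le _ _).trans ((add_le_add e6 e7).trans_eq ?_)
    ring
  have hthird := h.abs_integral_dilationDiff_mul_le (by linarith) hT1
    ((measurable_blockSum L 2 (1 / X) τ).const_mul τ⁻¹) hsecond
  have hA23 : A ^ 2 ≤ A ^ 3 := pow_le_pow_right₀ hA (by norm_num)
  have p1 : (4 * C₁ + 81) * A ^ 2 ≤ (4 * C₁ + 81) * A ^ 3 := by gcongr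
  have p2 : 0 ≤ (256 * C * C₂ + 52 * (4 * C₁ + 81)) * L := by positivity
  have p3 : 0 ≤ 52 * (6 * C₁) * A ^ 3 := by positivity
  have h9 := abs_sub_abs_le_abs_sub
    (∑' n, coeff L 2 (1 / X) n * dilationDiff ψ T (X - log n))
    (∫ u, dilationDiff ψ T (X - u) * (τ⁻¹ * blockSum L 2 (1 / X) τ u))
  linarith

end SmoothingKernel

lemma eventually_half_le_theta : ∀ᶠ y : ℝ in Filter.atTop, y / 2 ≤ Chebyshev.theta y := by
  have hlo := (isLittleO_log_rpow_atTop (r := 1 / 2) (by norm_num)).bound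
    (c := 1 / 100) (by norm_num)
  filter_upwards [hlo, Filter.eventually_ge_atTop 20] with y hy hy20
  have hy0 : 0 ≤ y := by linarith
  rw [← sqrt_eq_rpow, norm_of_nonneg (log_nonneg (by linarith)),
    norm_of_nonneg (sqrt_nonneg y)] at hy
  have hs := mul_self_sqrt hy0
  have hs1 : 1 ≤ √y := one_le_sqrt.2 (by linarith)
  have h1 : √y * log y ≤ 1 / 100 * y := by
    nlinarith [mul_le_mul_of_nonneg_left hy (sqrt_nonneg y)]
  have h2 : log (y + 2) ≤ log y + 1 := by
    rw [← log_exp 1, ← log_mul (by linarith) (exp_pos 1).ne']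
    exact log_le_log (by linarith) (by nlinarith [exp_one_gt_d9])
  have h3 : log y ≤ 1 / 100 * y := by nlinarith
  have h4 := Chebyshev.theta_ge' (x := y) (by linarith)
  nlinarith [log_two_gt_d9]

lemma sum_log_primes_ge : ∃ X₀ : ℝ, ∀ X, X₀ ≤ X →
    exp (X - 7) / 4 ≤ ∑ p ∈ Ioc ⌊exp (X - 18)⌋₊ ⌊exp (X - 7)⌋₊ with p.Prime, log p := by
  obtain ⟨y₀, hy₀⟩ := Filter.eventually_atTop.1 eventually_half_le_theta
  refine ⟨max y₀ 0 + 7, fun X hX => ?_⟩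
  have h1 := hy₀ (exp (X - 7))
    (by linarith [add_one_le_exp (X - 7), le_max_left y₀ 0])
  have h2 := Chebyshev.theta_le_log4_mul_x (exp_pos (X - 18)).le
  have hle : ⌊exp (X - 18)⌋₊ ≤ ⌊exp (X - 7)⌋₊ := Nat.floor_mono (exp_le_exp.2 (by linarith))
  have h3 : Chebyshev.theta (exp (X - 7)) = Chebyshev.theta (exp (X - 18)) +
      ∑ p ∈ Ioc ⌊exp (X - 18)⌋₊ ⌊exp (X - 7)⌋₊ with p.Prime, log p := by
    rw [Chebyshev.theta, Chebyshev.theta, ← sum_union, ← filter_union,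
      Ioc_union_Ioc_eq_Ioc (Nat.zero_le _) hle]
    exact disjoint_filter_filter (Ioc_disjoint_Ioc_of_le le_rfl)
  have h4 : exp (X - 7) = exp (X - 18) * exp 11 := by rw [← exp_add]; congr 1; ring
  have h5 : log 4 ≤ 2 := by
    rw [show (4 : ℝ) = 2 ^ 2 by norm_num, log_pow]
    push_cast
    linarith [log_two_lt_d9]
  have h6 := exp_pos (X - 18)
  have h7 : (12 : ℝ) ≤ exp 11 := by linarith [add_one_le_exp (11 : ℝ)]
  nlinarith

lemma mangoldtCoeff_prime {L κ : ℝ} {p : ℕ} (hp : p.Prime) (h : exp L < p) :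
    mangoldtCoeff L κ p = log p * log p * exp (-((1 + κ) * log p)) := by
  have hr : rough L p = 1 := by
    rw [rough, if_pos]
    refine ⟨hp.one_lt, fun r hr hrp => ?_⟩
    obtain ⟨h1, h2⟩ := (mem_primesUpTo (exp_pos L).le).1 hr
    rw [(Nat.prime_dvd_prime_iff_eq h2 hp).1 hrp] at h1
    linarith
  rw [mangoldtCoeff, hr, ArithmeticFunction.vonMangoldt_apply_prime hp, one_mul]

namespace SmoothingKernel

variable {ψ : ℝ → ℝ} {g : ℝ → ℂ} {C : ℝ}

lemma le_tsum_mangoldtCoeff_mul (h : SmoothingKernel ψ g C) : ∃ X₀ : ℝ, ∀ L X, X₀ ≤ X →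
    L ≤ X - 18 → exp (-8) / 8 * X ≤ ∑' n, mangoldtCoeff L (1 / X) n * ψ (X - log n) := by
  obtain ⟨X₀, hX₀⟩ := sum_log_primes_ge
  refine ⟨max X₀ 36, fun L X hX hL => ?_⟩
  have hX36 : 36 ≤ X := (le_max_right _ _).trans hX
  have hsum := hX₀ X ((le_max_left _ _).trans hX)
  set B := (Ioc ⌊exp (X - 18)⌋₊ ⌊exp (X - 7)⌋₊).filter Nat.Prime with hB
  have hκ : 0 < 1 / X := by positivity
  have hterm (p : ℕ) (hp : p ∈ B) : (X - 18) * exp (-X - 1) * log p ≤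
      mangoldtCoeff L (1 / X) p * ψ (X - log p) := by
    obtain ⟨hp1, hpp⟩ := mem_filter.1 hp
    rw [mem_Ioc, Nat.floor_lt (exp_pos _).le, Nat.le_floor_iff (exp_pos _).le] at hp1
    have hp0 : (0 : ℝ) < p := by exact_mod_cast hpp.pos
    have hlo : X - 18 < log p := (lt_log_iff_exp_lt hp0).2 hp1.1
    have hhi : log p ≤ X - 7 := (log_le_iff_le_exp hp0).2 hp1.2
    rw [mangoldtCoeff_prime hpp ((exp_le_exp.2 hL).trans_lt hp1.1),
      h.eq_one _ (by linarith) (by linarith), mul_one]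
    have hexp : exp (-X - 1) ≤ exp (-((1 + 1 / X) * log p)) := by
      rw [exp_le_exp]
      have : 1 / X * log p ≤ 1 := by
        rw [one_div, inv_mul_le_iff₀ (by linarith)]; linarith
      linarith
    have hlog : 0 ≤ log p := by linarith
    calc (X - 18) * exp (-X - 1) * log p ≤ log p * exp (-X - 1) * log p := by gcongr
      _ = log p * log p * exp (-X - 1) := by ring
      _ ≤ _ := by gcongr
  have hsummable : Summable fun n => mangoldtCoeff L (1 / X) n * ψ (X - log n) :=
    .of_nonneg_of_le (fun n => mul_nonneg (mangoldtCoeff_nonneg _ _ n) (h.nonneg _))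
      (fun n => (mul_le_of_le_one_right (mangoldtCoeff_nonneg _ _ n) (h.le_one _)).trans
        (mangoldtCoeff_le L _ n)) (summable_coeff L 2 hκ)
  refine le_trans ?_ (hsummable.sum_le_tsum B fun n _ =>
    mul_nonneg (mangoldtCoeff_nonneg _ _ n) (h.nonneg _))
  refine le_trans ?_ (sum_le_sum hterm)
  rw [← mul_sum]
  calc exp (-8) / 8 * X ≤ (X - 18) * (exp (-8) / 4) := by nlinarith [exp_pos (-8)]
    _ = (X - 18) * exp (-X - 1) * (exp (X - 7) / 4) := by
      rw [show (-8 : ℝ) = (-X - 1) + (X - 7) by ring, exp_add]; ring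
    _ ≤ _ := mul_le_mul_of_nonneg_left hsum (mul_nonneg (by linarith) (exp_pos _).le)

lemma abs_tsum_mangoldtCoeff_mul_le (h : SmoothingKernel ψ g C) (hC : 1 ≤ C) :
    ∃ C' A₀ L₀ : ℝ, 0 < C' ∧ 1 ≤ A₀ ∧ 1 ≤ L₀ ∧ ∀ A L, A₀ ≤ A → L₀ ≤ L →
      exp (-L / 4) * A ^ 5 ≤ 1 →
      |∑' n, mangoldtCoeff L (1 / (A * L)) n * dilationDiff ψ (exp (L / 16)) (A * L - log n)| ≤
        C' * (L + A ^ 3) := by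
  obtain ⟨C₁, ε, L₁, hC₁, hε, hε1, hL₁, h1⟩ := h.abs_tsum_composite_mul_le hC
  obtain ⟨C₂, L₂, hC₂, hL₂, h2⟩ := h.abs_tsum_coeff_mul_le hC
  refine ⟨C₁ + C₂, 1 / ε, max L₁ L₂, by positivity, (one_le_div hε).2 hε1,
    hL₁.trans (le_max_left _ _), fun A L hA hL hAL => ?_⟩
  have hA1 : 1 ≤ A := ((one_le_div hε).2 hε1).trans hA
  have hL1 : 1 ≤ L := hL₁.trans ((le_max_left _ _).trans hL)
  have hA0 : 0 < A := by linarith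
  have hL0 : 0 < L := by linarith
  have hκ : 0 < 1 / (A * L) := by positivity
  have hAeq : 1 / (L * (1 / (A * L))) = A := by field_simp
  have hadm : Admissible L (1 / (A * L)) :=
    ⟨hκ, one_div_le_one_div_of_le hL0 (by nlinarith), by rwa [hAeq]⟩
  have hκε : 1 / (A * L) ≤ ε / L := by
    rw [← div_div]
    exact div_le_div_of_nonneg_right ((one_div_le hε hA0).1 hA) hL0.le
  have b1 := h1 L ((le_max_left _ _).trans hL) _ hadm hκε (A * L)
  have b2 := h2 L ((le_max_right _ _).trans hL) A hA1 hadm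
  rw [hAeq] at b1
  have hbdd (n : ℕ) := h.abs_dilationDiff_le (exp_pos (L / 16)).le (A * L - log n)
  have hmul {f : ℕ → ℝ} (hf : Summable f) :
      Summable fun n => f n * dilationDiff ψ (exp (L / 16)) (A * L - log n) := by
    refine .of_norm_bounded (hf.norm.mul_right (exp (L / 16) + 1)) fun n => ?_
    rw [norm_mul]
    exact mul_le_mul_of_nonneg_left (hbdd n) (norm_nonneg _)
  have heq : ∑' n, mangoldtCoeff L (1 / (A * L)) n *
        dilationDiff ψ (exp (L / 16)) (A * L - log n) =
      ∑' n, coeff L 2 (1 / (A * L)) n * dilationDiff ψ (exp (L / 16)) (A * L - log n) -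
      ∑' n, (coeff L 2 (1 / (A * L)) n - mangoldtCoeff L (1 / (A * L)) n) *
        dilationDiff ψ (exp (L / 16)) (A * L - log n) := by
    rw [← (hmul (summable_coeff L 2 hκ)).tsum_sub (hmul (summable_compositeCoeff L hκ))]
    exact tsum_congr fun n => by ring
  rw [heq]
  refine (abs_sub _ _).trans ?_
  linarith

end SmoothingKernel

/-- Short intervals contain prime powers, in logarithmic coordinates. -/
lemma exists_isPrimePow_log_near : ∃ A X₀ : ℝ, 1 ≤ A ∧ ∀ X, X₀ ≤ X →
    ∃ n : ℕ, IsPrimePow n ∧ log n ≤ X ∧ X - log n ≤ 26 * exp (-(X / (16 * A))) := by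
  obtain ⟨ψ, g, C, hC, h⟩ := exists_smoothingKernel
  obtain ⟨C₀, A₀, L₀, hC₀, hA₀, hL₀, hub⟩ := h.abs_tsum_mangoldtCoeff_mul_le hC
  obtain ⟨X₁, hlb⟩ := h.le_tsum_mangoldtCoeff_mul
  set c := exp (-8) / 8 with hc
  have hc0 : 0 < c := by positivity
  set A := max A₀ (max 2 (3 * C₀ / c)) with hA
  have hA2 : 2 ≤ A := (le_max_left _ _).trans (le_max_right _ _)
  have hA0 : 0 < A := by linarith
  have hAc : 3 * C₀ ≤ c * A := by
    rw [← div_le_iff₀' hc0]; exact (le_max_right _ _).trans (le_max_right _ _)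
  obtain ⟨L₁, hL₁⟩ := Filter.eventually_atTop.1 <|
    (((tendsto_exp_neg_atTop_nhds_zero.comp
      (Filter.tendsto_id.atTop_div_const (r := (4 : ℝ)) (by norm_num))).mul_const
        (A ^ 5)).eventually_le_const (by rw [zero_mul]; exact one_pos))
  refine ⟨A, A * (max L₀ (max L₁ (max 18 (A ^ 3)))) + max X₁ 0, by linarith, fun X hX => ?_⟩
  set L := X / A with hL
  have hXL : X = A * L := by rw [hL]; field_simp
  have hmaxL : max L₀ (max L₁ (max 18 (A ^ 3))) ≤ L := by
    rw [hL, le_div_iff₀ hA0]; linarith [le_max_right X₁ 0]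
  simp only [max_le_iff] at hmaxL
  obtain ⟨hLL₀, hLL₁, hL18, hLA⟩ := hmaxL
  have hX₁ : X₁ ≤ X := by
    have : 0 ≤ A * max L₀ (max L₁ (max 18 (A ^ 3))) :=
      mul_nonneg hA0.le (by linarith [le_max_left L₀ (max L₁ (max 18 (A ^ 3)))])
    linarith [le_max_left X₁ 0]
  have hT : 0 < exp (L / 16) := exp_pos _
  have hub' := hub A L (le_max_left _ _) hLL₀ (by
    have := hL₁ L hLL₁
    simpa only [Function.comp_apply, id, neg_div] using this)
  have hlb' := hlb L X hX₁ (by rw [hXL]; nlinarith)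
  rw [← hXL] at hub'
  obtain ⟨n, hn⟩ : ∃ n, mangoldtCoeff L (1 / X) n * ψ (exp (L / 16) * (X - log n)) ≠ 0 := by
    by_contra! hall
    have heq : ∑' n, mangoldtCoeff L (1 / X) n * dilationDiff ψ (exp (L / 16)) (X - log n) =
        -∑' n, mangoldtCoeff L (1 / X) n * ψ (X - log n) := by
      rw [← tsum_neg]
      refine tsum_congr fun n => ?_
      rw [dilationDiff]
      linear_combination exp (L / 16) * hall n
    rw [heq, abs_neg] at hub'
    have h1 := hlb'.trans ((le_abs_self _).trans hub')
    have h2 : C₀ * (L + A ^ 3) ≤ C₀ * (2 * L) := mul_le_mul_of_nonneg_left (by linarith) hC₀.le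
    rw [hXL] at h1
    nlinarith
  obtain ⟨hn1, hn2⟩ := mul_ne_zero_iff.1 hn
  have hprime : IsPrimePow n := by
    rw [← ArithmeticFunction.vonMangoldt_ne_zero_iff]
    rintro h0
    simp [mangoldtCoeff, h0] at hn1
  obtain ⟨h1, h2⟩ := h.support _ hn2
  refine ⟨n, hprime, by linarith [nonneg_of_mul_nonneg_right h1 hT], ?_⟩
  rw [exp_neg, show X / (16 * A) = L / 16 by rw [hL]; field_simp, ← div_eq_mul_inv,
    le_div_iff₀ hT]
  linarith

/-- Hoheisel's theorem for prime powers. -/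
theorem exists_isPrimePow_sub_le : ∃ θ : ℝ, θ ∈ Set.Ioo (0 : ℝ) 1 ∧ ∃ x₀ : ℕ, 2 ≤ x₀ ∧
    ∀ x : ℕ, x₀ ≤ x → ∃ n : ℕ, IsPrimePow n ∧ n ≤ x ∧ (x : ℝ) - n ≤ (x : ℝ) ^ θ := by
  obtain ⟨A, X₀, hA, h⟩ := exists_isPrimePow_log_near
  have hδ : 0 < 1 / (32 * A) := by positivity
  have hδ1 : 1 / (32 * A) < 1 := by rw [div_lt_one (by positivity)]; linarith
  obtain ⟨x₁, hx₁⟩ := Filter.eventually_atTop.1 <|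
    ((tendsto_log_atTop.comp tendsto_natCast_atTop_atTop).eventually_ge_atTop X₀).and
      (((tendsto_rpow_atTop hδ).comp tendsto_natCast_atTop_atTop).eventually_ge_atTop (26 : ℝ))
  refine ⟨1 - 1 / (32 * A), ⟨by linarith, by linarith⟩, max x₁ 2, le_max_right _ _,
    fun x hx => ?_⟩
  obtain ⟨hlog, hpow⟩ := hx₁ x ((le_max_left _ _).trans hx)
  simp only [Function.comp_apply] at hlog hpow
  obtain ⟨n, hn, hnx, hgap⟩ := h (log x) hlog
  have hx0 : (0 : ℝ) < x := by
    exact_mod_cast two_pos.trans_le ((le_max_right _ _).trans hx)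
  have hn0 : (0 : ℝ) < n := by exact_mod_cast hn.pos
  refine ⟨n, hn, by exact_mod_cast (log_le_log_iff hn0 hx0).1 hnx, ?_⟩
  have hratio : 1 - (log x - log n) ≤ n / x := by
    have := add_one_le_exp (log n - log x)
    rw [exp_sub, exp_log hn0, exp_log hx0] at this
    linarith
  rw [le_div_iff₀ hx0] at hratio
  have hexp : exp (-(log x / (16 * A))) = (x : ℝ) ^ (-(1 / (32 * A))) * x ^ (-(1 / (32 * A))) := by
    rw [← rpow_add hx0, rpow_def_of_pos hx0]; congr 1; field_simp; ring
  calc (x : ℝ) - n ≤ (log x - log n) * x := by linarith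
    _ ≤ 26 * exp (-(log x / (16 * A))) * x := by gcongr
    _ ≤ (x : ℝ) ^ (1 / (32 * A)) * exp (-(log x / (16 * A))) * x := by gcongr
    _ = (x : ℝ) ^ (1 - 1 / (32 * A)) := by
      rw [hexp, ← mul_assoc, ← rpow_add hx0, add_neg_cancel, rpow_zero, one_mul, sub_eq_neg_add,
        rpow_add hx0, rpow_one]

end Hoheisel

theorem stmt_3 :
    ∃ θ : ℝ, θ ∈ Set.Ioo (0 : ℝ) 1 ∧
      ∃ X₀ : ℕ, 0 < X₀ ∧
        ∀ x : ℕ, X₀ ≤ x → ¬ IsPrimePow x → (P x : ℝ) ≤ (x : ℝ) ^ θ := by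
  obtain ⟨θ, hθ, x₀, hx₀, h⟩ := Hoheisel.exists_isPrimePow_sub_le
  refine ⟨θ, hθ, x₀, two_pos.trans_le hx₀, fun x hx hpp => ?_⟩
  obtain ⟨n, hn, hnx, hgap⟩ := h x hx
  have hq : n ≤ q x := le_csSup ⟨x, fun m hm => hm.2⟩ ⟨Or.inl hn, hnx⟩
  rw [P, if_neg (by omega), if_neg hpp]
  refine le_trans ?_ hgap
  rw [← Nat.cast_sub hnx]
  exact_mod_cast Nat.sub_le_sub_left hq x
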